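/- arXiv:1310.3874 — 2 statements merged into one kernel-verified Lean document; each statement's English description precedes it below -/
import Mathlib

section
/- Let D₁, D₂ ⊆ ℝ^d be regular domains with D₁ ∩ D₂ compact and D₂ of finite volume and finite surface area, and let f be a smooth bounded vector field defined on a neighborhood of D₂. Then there exists a sequence of regular domains D_{2,i} whose boundaries ∂D_{2,i} are transverse to ∂D₁, such that as i → ∞: (a) Vol(D_{2,i}) → Vol(D₂); (b) Area(∂D_{2,i}) → Area(∂D₂); and (c) ∫_{∂D_{2,i}} f · n_{∂D_{2,i}} dA → ∫_{∂D₂} f · n_{∂D₂} dA. Moreover, the D_{2,i} can be chosen to be a decreasing sequence of domains whose intersection is D₂, or an increasing sequence of domains whose union is the interior of D₂. -/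
open MeasureTheory Metric Set Filter
open scoped RealInnerProductSpace ENNReal Topology

noncomputable section

/-- A *regular domain* in `ℝ^d`: a closed set which is an embedded `d`-dimensional smooth
submanifold with boundary.  Equivalently, near each boundary point the set is the sublevel set
`{u ≤ 0}` of a smooth local defining function `u` with nonvanishing gradient; the outward unit
normal along the boundary is then `∇u/‖∇u‖`.  We bundle the outward unit normal field. -/
structure RegularDomain (d : ℕ) where
  carrier : Set (EuclideanSpace ℝ (Fin d))
  normal : EuclideanSpace ℝ (Fin d) → EuclideanSpace ℝ (Fin d)
  isClosed : IsClosed carrier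
  regular : ∀ p ∈ frontier carrier,
    ∃ U : Set (EuclideanSpace ℝ (Fin d)), IsOpen U ∧ p ∈ U ∧
      ∃ u : EuclideanSpace ℝ (Fin d) → ℝ,
        ContDiffOn ℝ (⊤ : ℕ∞) u U ∧
        (∀ x ∈ U, gradient u x ≠ 0) ∧
        carrier ∩ U = {x ∈ U | u x ≤ 0} ∧
        ∀ x ∈ frontier carrier ∩ U, normal x = ‖gradient u x‖⁻¹ • gradient u x

/-- The divergence `∇ · f` of a vector field on `ℝ^d`, as the trace of its derivative. -/
def vdiv {d : ℕ} (f : EuclideanSpace ℝ (Fin d) → EuclideanSpace ℝ (Fin d))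
    (x : EuclideanSpace ℝ (Fin d)) : ℝ :=
  LinearMap.trace ℝ _ ((fderiv ℝ f x :
    EuclideanSpace ℝ (Fin d) →ₗ[ℝ] EuclideanSpace ℝ (Fin d)))

/-- Two regular domains have *transverse* boundaries if at every common boundary point their
outward unit normals are linearly independent (for hypersurfaces this is equivalent to the
tangent spaces spanning `ℝ^d`). -/
def TransverseBoundaries {d : ℕ} (D D' : RegularDomain d) : Prop :=
  ∀ p ∈ frontier D.carrier ∩ frontier D'.carrier,
    LinearIndependent ℝ ![D.normal p, D'.normal p]

section PartP1
section Diffeo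
variable {E : Type*} [NormedAddCommGroup E] [InnerProductSpace ℝ E] [FiniteDimensional ℝ E]

lemma lipschitz_of_fderiv {Y : E → E} (hY : ContDiff ℝ (⊤ : ℕ∞) Y) {L : ℝ}
    (hL : ∀ x, ‖fderiv ℝ Y x‖ ≤ L) (x y : E) : ‖Y x - Y y‖ ≤ L * ‖x - y‖ :=
  Convex.norm_image_sub_le_of_norm_fderiv_le (𝕜 := ℝ) (s := univ)
    (fun x _ => (hY.differentiable (by simp)) x) (fun x _ => hL x) convex_univ
    (mem_univ _) (mem_univ _)

/-- Small Lipschitz perturbations of the identity are diffeomorphisms. -/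
lemma exists_pert_homeo {Y : E → E} (hY : ContDiff ℝ (⊤ : ℕ∞) Y)
    (hL : ∀ x, ‖fderiv ℝ Y x‖ ≤ 1 / 4) {t : ℝ} (ht : |t| ≤ 1) :
    ∃ φ : E ≃ₜ E, (∀ x, φ x = x + t • Y x) ∧ ContDiff ℝ (⊤ : ℕ∞) φ ∧
      ContDiff ℝ (⊤ : ℕ∞) φ.symm := by
  have happ : ApproximatesLinearOn (fun x => x + t • Y x)
      ((ContinuousLinearEquiv.refl ℝ E : E ≃L[ℝ] E) : E →L[ℝ] E) univ (1 / 4 : NNReal) := by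
    intro x _ y _
    have h1 := lipschitz_of_fderiv hY hL x y
    have h2 : x + t • Y x - (y + t • Y y) -
      ((ContinuousLinearEquiv.refl ℝ E : E ≃L[ℝ] E) : E →L[ℝ] E) (x - y)
        = t • (Y x - Y y) := by
      simp [smul_sub]; abel
    rw [h2, norm_smul, Real.norm_eq_abs]
    push_cast
    calc |t| * ‖Y x - Y y‖ ≤ 1 * (1 / 4 * ‖x - y‖) := by gcongr
      _ = _ := by ring
  have hc : Subsingleton E ∨ (1 / 4 : NNReal) <
      ‖((ContinuousLinearEquiv.refl ℝ E).symm : E →L[ℝ] E)‖₊⁻¹ := by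
    rcases subsingleton_or_nontrivial E with h | h
    · exact Or.inl h
    · right
      have : ‖((ContinuousLinearEquiv.refl ℝ E).symm : E →L[ℝ] E)‖₊ = 1 := by
        ext; simp
      rw [this]
      rw [← NNReal.coe_lt_coe]; norm_num
  let φ : E ≃ₜ E := happ.toHomeomorph _ hc
  have hφ : ∀ x, φ x = x + t • Y x := fun x => rfl
  have hsm : ContDiff ℝ (⊤ : ℕ∞) φ := by
    have : (φ : E → E) = fun x => x + t • Y x := funext hφ
    rw [this]; fun_prop
  refine ⟨φ, hφ, hsm, ?_⟩
  have hder : ∀ x, ∃ A : E ≃L[ℝ] E, HasFDerivAt φ (A : E →L[ℝ] E) x := by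
    intro x
    have h1 : HasFDerivAt φ (ContinuousLinearMap.id ℝ E + t • fderiv ℝ Y x) x := by
      have : (φ : E → E) = fun x => x + t • Y x := funext hφ
      rw [this]
      exact (hasFDerivAt_id x).add ((hY.differentiable (by simp) x).hasFDerivAt.const_smul t)
    have hinj : Function.Injective (ContinuousLinearMap.id ℝ E + t • fderiv ℝ Y x) := by
      rw [injective_iff_map_eq_zero]
      intro v hv
      simp only [add_apply, ContinuousLinearMap.id_apply,
        smul_apply] at hv
      have h3 : ‖v‖ = ‖t • fderiv ℝ Y x v‖ := by
        rw [← norm_neg (t • _), ← eq_neg_of_add_eq_zero_left hv]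
      rw [norm_smul, Real.norm_eq_abs] at h3
      have h4 : ‖fderiv ℝ Y x v‖ ≤ 1 / 4 * ‖v‖ :=
        ((fderiv ℝ Y x).le_opNorm v).trans (by gcongr; exact hL x)
      have h5 : |t| * ‖fderiv ℝ Y x v‖ ≤ 1 * (1 / 4 * ‖v‖) := by gcongr
      have : ‖v‖ ≤ 0 := by linarith
      simpa using this
    refine ⟨(LinearEquiv.ofInjectiveEndo _ hinj).toContinuousLinearEquiv, ?_⟩
    convert h1 using 1
    ext v; rfl
  choose A hA using hder
  exact φ.contDiff_symm hA hsm

/-- The key monotonicity statement. -/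
lemma pert_nested {D : Set E} (hD : IsClosed D) {Y : E → E} (hY : ContDiff ℝ (⊤ : ℕ∞) Y)
    (hL : ∀ x, ‖fderiv ℝ Y x‖ ≤ 1 / 4)
    (hloc : ∀ y ∈ frontier D, Y y ≠ 0 ∧ ∃ U : Set E, IsOpen U ∧ y ∈ U ∧ ∃ u : E → ℝ, ∃ g : E,
      g ≠ 0 ∧ HasGradientAt u g y ∧ u y = 0 ∧ (∀ x ∈ U, x ∈ D ↔ u x ≤ 0) ∧
      1 / 2 * (‖Y y‖ * ‖g‖) ≤ ⟪g, Y y⟫)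
    {s t : ℝ} (hs : -1 ≤ s) (hst : s < t) (ht : t ≤ 1) {x y : E} (hx : x ∈ D)
    (hxy : y + t • Y y = x + s • Y x) : y ∈ interior D := by
  have hex : ∀ r : ℝ, ∃ z : E, |r| ≤ 1 → z + r • Y z = x + s • Y x := by
    intro r
    by_cases hr : |r| ≤ 1
    · obtain ⟨φ, hφ, -⟩ := exists_pert_homeo hY hL hr
      exact ⟨φ.symm (x + s • Y x), fun _ => by rw [← hφ, φ.apply_symm_apply]⟩
    · exact ⟨0, fun h => absurd h hr⟩
  choose c hc using hex
  have habs : ∀ r ∈ Icc s t, |r| ≤ 1 := fun r hr =>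
    abs_le.2 ⟨hs.trans hr.1, hr.2.trans ht⟩
  -- basic estimates
  have hlip := lipschitz_of_fderiv hY hL
  have hinj : ∀ r : ℝ, |r| ≤ 1 → ∀ z w : E, z + r • Y z = w + r • Y w → z = w := by
    intro r hr z w h
    obtain ⟨φ, hφ, -⟩ := exists_pert_homeo hY hL hr
    apply φ.injective; rw [hφ, hφ, h]
  have hcs : c s = x := hinj s (habs s ⟨le_rfl, hst.le⟩) _ _ (hc s (habs s ⟨le_rfl, hst.le⟩))
  have hct : c t = y := hinj t (habs t ⟨hst.le, le_rfl⟩) _ _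
    ((hc t (habs t ⟨hst.le, le_rfl⟩)).trans hxy.symm)
  have hdiff : ∀ r ∈ Icc s t, ∀ r' ∈ Icc s t,
      c r' - c r + (r' - r) • Y (c r) = - (r' • (Y (c r') - Y (c r))) := by
    intro r hr r' hr'
    have h1 := hc r (habs r hr)
    have h2 := hc r' (habs r' hr')
    have h3 : c r' + r' • Y (c r') = c r + r • Y (c r) := h2.trans h1.symm
    have : c r' = c r + r • Y (c r) - r' • Y (c r') := by rw [← h3]; abel
    conv_lhs => rw [this]
    module
  have hest1 : ∀ r ∈ Icc s t, ∀ r' ∈ Icc s t,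
      ‖c r' - c r‖ ≤ 4 / 3 * (|r' - r| * ‖Y (c r)‖) := by
    intro r hr r' hr'
    have h1 := hdiff r hr r' hr'
    have h2 : c r' - c r = - (r' • (Y (c r') - Y (c r))) - (r' - r) • Y (c r) := by
      rw [← h1]; abel
    have h3 : ‖c r' - c r‖ ≤ |r'| * ‖Y (c r') - Y (c r)‖ + |r' - r| * ‖Y (c r)‖ := by
      conv_lhs => rw [h2]
      refine (norm_sub_le _ _).trans ?_
      rw [norm_neg, norm_smul, norm_smul]; rfl
    have h4 : |r'| * ‖Y (c r') - Y (c r)‖ ≤ 1 * (1 / 4 * ‖c r' - c r‖) := by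
      gcongr
      · exact habs r' hr'
      · exact hlip _ _
    linarith
  have hest2 : ∀ r ∈ Icc s t, ∀ r' ∈ Icc s t,
      ‖c r' - c r + (r' - r) • Y (c r)‖ ≤ 1 / 3 * (|r' - r| * ‖Y (c r)‖) := by
    intro r hr r' hr'
    rw [hdiff r hr r' hr', norm_neg, norm_smul, Real.norm_eq_abs]
    have h4 : |r'| * ‖Y (c r') - Y (c r)‖ ≤ 1 * (1 / 4 * ‖c r' - c r‖) := by
      gcongr
      · exact habs r' hr'
      · exact hlip _ _
    have := hest1 r hr r' hr'
    linarith
  have hcont : ContinuousOn c (Icc s t) := by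
    intro r hr
    rw [ContinuousWithinAt, tendsto_iff_norm_sub_tendsto_zero]
    have hlim : Tendsto (fun r' : ℝ => 4 / 3 * (|r' - r| * ‖Y (c r)‖)) (𝓝[Icc s t] r) (𝓝 0) := by
      have : Continuous (fun r' : ℝ => 4 / 3 * (|r' - r| * ‖Y (c r)‖)) := by fun_prop
      have h := this.tendsto r
      simp at h
      simpa using h.mono_left nhdsWithin_le_nhds
    refine squeeze_zero' (Eventually.of_forall fun _ => norm_nonneg _) ?_ hlim
    filter_upwards [self_mem_nhdsWithin] with r' hr'
    exact hest1 r hr r' hr'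
  -- the local step
  have hstep : ∀ r ∈ Icc s t, c r ∈ frontier D → ∀ᶠ r' in 𝓝[Icc s t] r,
      (r < r' → c r' ∈ D) ∧ (r' < r → c r' ∉ D) := by
    intro r hr hfr
    obtain ⟨hY0, U, hU, hyU, u, g, hg0, hg, hu0, hDU, hcone⟩ := hloc _ hfr
    have hg1 : 0 < ‖g‖ := norm_pos_iff.2 hg0
    have hY1 : 0 < ‖Y (c r)‖ := norm_pos_iff.2 hY0
    have hlo := (hasGradientAt_iff_isLittleO.1 hg).def (show 0 < ‖g‖ / 16 by positivity)
    have e1 := (hcont r hr).eventually hlo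
    have e2 := (hcont r hr).eventually (hU.mem_nhds hyU)
    filter_upwards [e1, e2, self_mem_nhdsWithin] with r' h1 h2 hr'
    have a1 := hest1 r hr r' hr'
    have a2 := hest2 r hr r' hr'
    rw [hu0, sub_zero, Real.norm_eq_abs] at h1
    have h3 : |u (c r') - ⟪g, c r' - c r⟫| ≤ 1 / 12 * (|r' - r| * ‖Y (c r)‖ * ‖g‖) := by
      refine h1.trans ?_
      calc ‖g‖ / 16 * ‖c r' - c r‖ ≤ ‖g‖ / 16 * (4 / 3 * (|r' - r| * ‖Y (c r)‖)) := by gcongr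
        _ = _ := by ring
    have h4 : |⟪g, c r' - c r + (r' - r) • Y (c r)⟫| ≤ 1 / 3 * (|r' - r| * ‖Y (c r)‖ * ‖g‖) := by
      refine (abs_real_inner_le_norm _ _).trans ?_
      calc ‖g‖ * ‖c r' - c r + (r' - r) • Y (c r)‖
          ≤ ‖g‖ * (1 / 3 * (|r' - r| * ‖Y (c r)‖)) := by gcongr
        _ = _ := by ring
    rw [inner_add_right, real_inner_smul_right] at h4
    rw [abs_le] at h3 h4
    have hp : 0 < ‖Y (c r)‖ * ‖g‖ := by positivity
    rw [hDU _ h2]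
    constructor
    · intro hlt
      rw [abs_of_pos (sub_pos.2 hlt)] at h3 h4
      have := mul_le_mul_of_nonneg_left hcone (sub_pos.2 hlt).le
      have hpp := mul_pos (sub_pos.2 hlt) hp
      nlinarith
    · intro hlt
      rw [abs_of_neg (sub_neg.2 hlt)] at h3 h4
      have := mul_le_mul_of_nonneg_left hcone (sub_pos.2 hlt).le
      have hpp := mul_pos (sub_pos.2 hlt) hp
      push Not
      nlinarith
  have hall : Icc s t ⊆ {r | c r ∈ D} := by
    apply IsClosed.Icc_subset_of_forall_mem_nhdsWithin
    · rw [inter_comm]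
      exact hcont.preimage_isClosed_of_isClosed isClosed_Icc hD
    · simpa [hcs] using hx
    · rintro r ⟨hrD, hr⟩
      have hnh : 𝓝[>] r ≤ 𝓝[Icc s t] r := by
        have : Icc s t ∈ 𝓝[>] r := by
          filter_upwards [Ioo_mem_nhdsGT hr.2] with z hz
          exact ⟨hr.1.trans hz.1.le, hz.2.le⟩
        exact le_inf nhdsWithin_le_nhds (le_principal_iff.2 this)
      by_cases hfr : c r ∈ frontier D
      · filter_upwards [hnh (hstep r ⟨hr.1, hr.2.le⟩ hfr), self_mem_nhdsWithin] with z hz hz2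
        exact hz.1 hz2
      · have hInt : c r ∈ interior D := by
          by_contra h
          exact hfr ⟨subset_closure hrD, h⟩
        have := (hcont r ⟨hr.1, hr.2.le⟩).eventually (isOpen_interior.mem_nhds hInt)
        filter_upwards [hnh this] with z hz
        exact interior_subset hz
  by_contra hni
  have hyD : c t ∈ D := hall ⟨hst.le, le_rfl⟩
  have hfr : c t ∈ frontier D := ⟨subset_closure hyD, by rwa [hct]⟩
  have hnh : 𝓝[<] t ≤ 𝓝[Icc s t] t := by
    have : Icc s t ∈ 𝓝[<] t := by
      filter_upwards [Ioo_mem_nhdsLT hst] with z hz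
      exact ⟨hz.1.le, hz.2.le⟩
    exact le_inf nhdsWithin_le_nhds (le_principal_iff.2 this)
  have hev := (hstep t ⟨hst.le, le_rfl⟩ hfr).filter_mono hnh
  obtain ⟨z, ⟨hz1, hz2⟩, hz3⟩ := (hev.and (Ioo_mem_nhdsLT hst)).exists
  exact hz2 hz3.2 (hall ⟨hz3.1.le, hz3.2.le⟩)

end Diffeo

end PartP1

section PartP2
section Dom
variable {d : ℕ}

lemma gradient_contDiffOn {F : Type*} [NormedAddCommGroup F] [InnerProductSpace ℝ F]
    [CompleteSpace F] {u : F → ℝ} {U : Set F} (hU : IsOpen U)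
    (hu : ContDiffOn ℝ (⊤ : ℕ∞) u U) : ContDiffOn ℝ (⊤ : ℕ∞) (gradient u) U := by
  have h1 : ContDiffOn ℝ (⊤ : ℕ∞) (fderiv ℝ u) U := hu.fderiv_of_isOpen hU (by simp)
  exact (InnerProductSpace.toDual ℝ F).symm.toContinuousLinearEquiv.contDiff.comp_contDiffOn h1

lemma hasGradientAt_of_contDiffOn {F : Type*} [NormedAddCommGroup F] [InnerProductSpace ℝ F]
    [CompleteSpace F] {u : F → ℝ} {U : Set F} (hU : IsOpen U)
    (hu : ContDiffOn ℝ (⊤ : ℕ∞) u U) {x : F} (hx : x ∈ U) : HasGradientAt u (gradient u x) x :=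
  ((hu.contDiffAt (hU.mem_nhds hx)).differentiableAt (by simp)).hasGradientAt

lemma RegularDomain.chart (D : RegularDomain d) {p : EuclideanSpace ℝ (Fin d)}
    (hp : p ∈ frontier D.carrier) :
    ∃ U : Set (EuclideanSpace ℝ (Fin d)), IsOpen U ∧ p ∈ U ∧
      ∃ u : EuclideanSpace ℝ (Fin d) → ℝ,
        ContDiffOn ℝ (⊤ : ℕ∞) u U ∧
        (∀ x ∈ U, gradient u x ≠ 0) ∧
        (∀ x ∈ U, x ∈ D.carrier ↔ u x ≤ 0) ∧
        ∀ x ∈ frontier D.carrier ∩ U, u x = 0 ∧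
          D.normal x = ‖gradient u x‖⁻¹ • gradient u x := by
  obtain ⟨U, hU, hpU, u, hu, hg, hDU, hn⟩ := D.regular p hp
  have hiff : ∀ x ∈ U, x ∈ D.carrier ↔ u x ≤ 0 := by
    intro x hx
    have := Set.ext_iff.1 hDU x
    simp only [mem_inter_iff, mem_ofPred_eq, hx, and_true, true_and] at this
    exact this
  refine ⟨U, hU, hpU, u, hu, hg, hiff, fun x hx => ⟨?_, hn x hx⟩⟩
  have hxD : x ∈ D.carrier := D.isClosed.frontier_subset hx.1
  refine le_antisymm ((hiff x hx.2).1 hxD) ?_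
  by_contra hneg
  push Not at hneg
  refine hx.1.2 ?_
  rw [mem_interior_iff_mem_nhds]
  have hc : ContinuousAt u x := (hu.continuousOn.continuousAt (hU.mem_nhds hx.2))
  filter_upwards [hc.eventually (gt_mem_nhds hneg), hU.mem_nhds hx.2] with z hz hzU
  exact (hiff z hzU).2 hz.le

lemma RegularDomain.norm_normal (D : RegularDomain d) {p : EuclideanSpace ℝ (Fin d)}
    (hp : p ∈ frontier D.carrier) : ‖D.normal p‖ = 1 := by
  obtain ⟨U, hU, hpU, u, hu, hg, hDU, hn⟩ := D.chart hp
  rw [(hn p ⟨hp, hpU⟩).2, norm_smul, norm_inv, norm_norm]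
  exact inv_mul_cancel₀ (norm_ne_zero_iff.2 (hg p hpU))

lemma RegularDomain.continuousOn_normal (D : RegularDomain d) :
    ContinuousOn D.normal (frontier D.carrier) := by
  intro p hp
  obtain ⟨U, hU, hpU, u, hu, hg, hDU, hn⟩ := D.chart hp
  have h1 : ContinuousAt (gradient u) p :=
    (gradient_contDiffOn hU hu).continuousOn.continuousAt (hU.mem_nhds hpU)
  have h2 : ContinuousAt (fun x => ‖gradient u x‖⁻¹ • gradient u x) p :=
    (h1.norm.inv₀ (norm_ne_zero_iff.2 (hg p hpU))).smul h1
  refine (h2.continuousWithinAt (s := frontier D.carrier)).congr_of_eventuallyEq ?_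
    (hn p ⟨hp, hpU⟩).2
  filter_upwards [self_mem_nhdsWithin, mem_nhdsWithin_of_mem_nhds (hU.mem_nhds hpU)] with x hx hxU
  exact (hn x ⟨hx, hxU⟩).2

/-- The conormal pushforward. -/
def pushNormal (D : RegularDomain d) (φ : EuclideanSpace ℝ (Fin d) ≃ₜ EuclideanSpace ℝ (Fin d))
    (x : EuclideanSpace ℝ (Fin d)) : EuclideanSpace ℝ (Fin d) :=
  ContinuousLinearMap.adjoint (fderiv ℝ φ.symm x) (D.normal (φ.symm x))

/-- Image of a regular domain under a diffeomorphism. -/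
def RegularDomain.image (D : RegularDomain d)
    (φ : EuclideanSpace ℝ (Fin d) ≃ₜ EuclideanSpace ℝ (Fin d))
    (hφ : ContDiff ℝ (⊤ : ℕ∞) φ) (hφs : ContDiff ℝ (⊤ : ℕ∞) φ.symm) : RegularDomain d where
  carrier := φ '' D.carrier
  normal := fun x => ‖pushNormal D φ x‖⁻¹ • pushNormal D φ x
  isClosed := φ.isClosedMap _ D.isClosed
  regular := by
    intro p hp
    rw [← φ.image_frontier] at hp
    obtain ⟨q, hq, rfl⟩ := hp
    obtain ⟨U, hU, hpU, u, hu, hg, hDU, hn⟩ := D.chart hq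
    have hgrad : ∀ x ∈ φ '' U, HasGradientAt (u ∘ φ.symm)
        (ContinuousLinearMap.adjoint (fderiv ℝ φ.symm x) (gradient u (φ.symm x))) x := by
      rintro _ ⟨x, hx, rfl⟩
      have h1 := (hasGradientAt_of_contDiffOn hU hu hx).hasFDerivAt
      have h2 := (hφs.differentiable (by simp) (φ x)).hasFDerivAt
      have h1' : HasFDerivAt u (InnerProductSpace.toDual ℝ _ (gradient u x)) (φ.symm (φ x)) := by
        rwa [φ.symm_apply_apply]
      rw [hasGradientAt_iff_hasFDerivAt]
      have heq : InnerProductSpace.toDual ℝ _ (ContinuousLinearMap.adjoint (fderiv ℝ φ.symm (φ x))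
          (gradient u (φ.symm (φ x)))) =
          (InnerProductSpace.toDual ℝ _ (gradient u x)).comp (fderiv ℝ φ.symm (φ x)) := by
        refine ContinuousLinearMap.ext fun v => ?_
        rw [φ.symm_apply_apply, InnerProductSpace.toDual_apply_apply,
          ContinuousLinearMap.adjoint_inner_left, ContinuousLinearMap.comp_apply,
          InnerProductSpace.toDual_apply_apply]
      rw [heq]
      exact h1'.comp _ h2
    refine ⟨φ '' U, φ.isOpenMap _ hU, mem_image_of_mem _ hpU, u ∘ φ.symm, ?_, ?_, ?_, ?_⟩
    · refine hu.comp hφs.contDiffOn ?_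
      rintro _ ⟨x, hx, rfl⟩
      simpa using hx
    · rintro x hx
      rw [(hgrad x hx).gradient]
      obtain ⟨y, hy, rfl⟩ := hx
      rw [φ.symm_apply_apply]
      intro h0
      -- the derivative of the inverse is invertible
      have h2 := (hφs.differentiable (by simp) (φ y)).hasFDerivAt
      have h3 := (hφ.differentiable (by simp) y).hasFDerivAt
      have h4 : HasFDerivAt (φ.symm ∘ φ) ((fderiv ℝ φ.symm (φ y)).comp (fderiv ℝ φ y)) y :=
        h2.comp y h3
      have h5 : (φ.symm ∘ φ : EuclideanSpace ℝ (Fin d) → EuclideanSpace ℝ (Fin d)) = id := by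
        ext x; simp
      rw [h5] at h4
      have h6 := h4.unique (hasFDerivAt_id y)
      have h7 : ⟪gradient u y, gradient u y⟫ = 0 := by
        have : gradient u y = fderiv ℝ φ.symm (φ y) (fderiv ℝ φ y (gradient u y)) := by
          have := DFunLike.congr_fun h6 (gradient u y)
          simpa using this.symm
        conv_lhs => rw [this]
        conv_lhs => arg 3; rw [← this]
        rw [real_inner_comm, ← ContinuousLinearMap.adjoint_inner_left, h0, inner_zero_left]
      exact hg y hy (inner_self_eq_zero.1 h7)
    · ext x
      constructor
      · rintro ⟨⟨y, hy, rfl⟩, ⟨z, hz, hzy⟩⟩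
        have := φ.injective hzy
        subst this
        exact ⟨⟨z, hz, rfl⟩, by simpa using (hDU z hz).1 hy⟩
      · rintro ⟨⟨y, hy, rfl⟩, h2⟩
        exact ⟨⟨y, (hDU y hy).2 (by simpa using h2), rfl⟩, ⟨y, hy, rfl⟩⟩
    · rintro x ⟨hx, hxU⟩
      rw [(hgrad x hxU).gradient]
      rw [← φ.image_frontier] at hx
      obtain ⟨y, hy, rfl⟩ := hx
      obtain ⟨z, hz, hzy⟩ := hxU
      have := φ.injective hzy
      subst this
      have h1 := (hn z ⟨hy, hz⟩).2
      simp only [pushNormal, φ.symm_apply_apply]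
      rw [h1, map_smul, norm_smul, norm_inv, norm_norm, smul_smul, mul_inv, inv_inv]
      congr 1
      have : ‖gradient u z‖ ≠ 0 := norm_ne_zero_iff.2 (hg z hz)
      field_simp

lemma RegularDomain.frontier_image (D : RegularDomain d)
    (φ : EuclideanSpace ℝ (Fin d) ≃ₜ EuclideanSpace ℝ (Fin d))
    (hφ : ContDiff ℝ (⊤ : ℕ∞) φ) (hφs : ContDiff ℝ (⊤ : ℕ∞) φ.symm) :
    frontier (D.image φ hφ hφs).carrier = φ '' frontier D.carrier :=
  (φ.image_frontier _).symm

/-- Dual characterization of the pushed normal. -/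
lemma adjoint_pushNormal (D : RegularDomain d)
    (φ : EuclideanSpace ℝ (Fin d) ≃ₜ EuclideanSpace ℝ (Fin d))
    (hφ : ContDiff ℝ (⊤ : ℕ∞) φ) (hφs : ContDiff ℝ (⊤ : ℕ∞) φ.symm)
    (y : EuclideanSpace ℝ (Fin d)) :
    ContinuousLinearMap.adjoint (fderiv ℝ φ y) (pushNormal D φ (φ y)) = D.normal y := by
  have h2 := (hφs.differentiable (by simp) (φ y)).hasFDerivAt
  have h3 := (hφ.differentiable (by simp) y).hasFDerivAt
  have h4 : HasFDerivAt (φ.symm ∘ φ) ((fderiv ℝ φ.symm (φ y)).comp (fderiv ℝ φ y)) y :=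
    h2.comp y h3
  have h5 : (φ.symm ∘ φ : EuclideanSpace ℝ (Fin d) → EuclideanSpace ℝ (Fin d)) = id := by
    ext x; simp
  rw [h5] at h4
  have h6 := h4.unique (hasFDerivAt_id y)
  rw [pushNormal, φ.symm_apply_apply]
  refine ext_inner_right ℝ fun v => ?_
  rw [ContinuousLinearMap.adjoint_inner_left, ContinuousLinearMap.adjoint_inner_left]
  have := DFunLike.congr_fun h6 v
  simp only [ContinuousLinearMap.comp_apply] at this
  rw [this]; rfl

end Dom

end PartP2

section PartP3
section Meas

lemma tendsto_hausdorff_image {E : Type*} [MetricSpace E] [MeasurableSpace E] [BorelSpace E]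
    (φ : ℕ → E ≃ₜ E) (K : ℕ → NNReal) (hK : Tendsto K atTop (𝓝 1))
    (h1 : ∀ i, LipschitzWith (K i) (φ i)) (h2 : ∀ i, LipschitzWith (K i) (φ i).symm)
    {s : ℝ} (hs : 0 ≤ s) (A : Set E) :
    Tendsto (fun i => μH[s] (φ i '' A)) atTop (𝓝 (μH[s] A)) := by
  have hKs : Tendsto (fun i => (K i : ℝ≥0∞) ^ s) atTop (𝓝 1) := by
    have : Tendsto (fun i => (K i : ℝ≥0∞)) atTop (𝓝 1) := by
      have := ENNReal.tendsto_coe.2 hK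
      rwa [ENNReal.coe_one] at this
    simpa [Function.comp_def] using (ENNReal.continuous_rpow_const (y := s)).tendsto 1 |>.comp this
  have hup : Tendsto (fun i => (K i : ℝ≥0∞) ^ s * μH[s] A) atTop (𝓝 (μH[s] A)) := by
    simpa using ENNReal.Tendsto.mul_const (b := μH[s] A) hKs (Or.inl one_ne_zero)
  have hlo : Tendsto (fun i => ((K i : ℝ≥0∞) ^ s)⁻¹ * μH[s] A) atTop (𝓝 (μH[s] A)) := by
    have := tendsto_inv_iff.2 hKs
    simpa using ENNReal.Tendsto.mul_const (b := μH[s] A) this (Or.inl (by simp))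
  refine tendsto_of_tendsto_of_tendsto_of_le_of_le hlo hup (fun i => ?_) (fun i => ?_)
  · have h := (h2 i).hausdorffMeasure_image_le hs (φ i '' A)
    rw [← image_comp] at h
    have h3 : ((φ i).symm ∘ φ i : E → E) = id := by ext x; simp
    rw [h3, image_id] at h
    show ((K i : ℝ≥0∞) ^ s)⁻¹ * μH[s] A ≤ μH[s] (φ i '' A)
    have hne : (K i : ℝ≥0∞) ^ s ≠ ⊤ := ENNReal.rpow_ne_top_of_nonneg hs ENNReal.coe_ne_top
    rw [mul_comm, ← div_eq_mul_inv]
    exact ENNReal.div_le_of_le_mul' h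
  · exact (h1 i).hausdorffMeasure_image_le hs A

lemma tendsto_integral_of_close {α : Type*} [MeasurableSpace α] (μ : Measure α) [IsFiniteMeasure μ]
    (ν : ℕ → Measure α) (C : ℕ → NNReal) (hC0 : ∀ i, 0 < C i) (hC : Tendsto C atTop (𝓝 1))
    (h1 : ∀ i, ν i ≤ C i • μ) (h2 : ∀ i, μ ≤ C i • ν i)
    (h : ℕ → α → ℝ) (g : α → ℝ) (M : ℝ) (hm : ∀ i, AEStronglyMeasurable (h i) μ)
    (hb : ∀ i, ∀ᵐ x ∂μ, ‖h i x‖ ≤ M) (hl : ∀ᵐ x ∂μ, Tendsto (fun i => h i x) atTop (𝓝 (g x))) :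
    Tendsto (fun i => ∫ x, h i x ∂(ν i)) atTop (𝓝 (∫ x, g x ∂μ)) := by
  have hdom : Tendsto (fun i => ∫ x, h i x ∂μ) atTop (𝓝 (∫ x, g x ∂μ)) :=
    tendsto_integral_of_dominated_convergence (fun _ => M) hm (integrable_const M) hb hl
  have hCr : Tendsto (fun i => (C i : ℝ)) atTop (𝓝 1) := by
    have := NNReal.tendsto_coe.2 hC
    rwa [NNReal.coe_one] at this
  have hdom2 : Tendsto (fun i => (C i : ℝ) * ∫ x, h i x ∂μ) atTop (𝓝 (∫ x, g x ∂μ)) := by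
    simpa using hCr.mul hdom
  set m : ℝ := μ.real univ with hmdef
  have herr : Tendsto (fun i => M * ((C i : ℝ) * m - (C i : ℝ)⁻¹ * m)) atTop (𝓝 0) := by
    have := ((hCr.mul_const m).sub ((hCr.inv₀ one_ne_zero).mul_const m)).const_mul M
    simpa using this
  have hkey : ∀ i, ‖(∫ x, h i x ∂(ν i)) - (C i : ℝ) * ∫ x, h i x ∂μ‖ ≤
      M * ((C i : ℝ) * m - (C i : ℝ)⁻¹ * m) := by
    intro i
    have hfin : IsFiniteMeasure (C i • μ) := inferInstance
    have hνfin : IsFiniteMeasure (ν i) := isFiniteMeasure_of_le _ (h1 i)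
    set κ := C i • μ - ν i with hκ
    have hadd : κ + ν i = C i • μ := Measure.sub_add_cancel_of_le (h1 i)
    have hκle : κ ≤ C i • μ := Measure.sub_le
    have hκfin : IsFiniteMeasure κ := isFiniteMeasure_of_le _ hκle
    have hac : C i • μ ≪ μ := Measure.smul_absolutelyContinuous
    have hbκ : ∀ᵐ x ∂κ, ‖h i x‖ ≤ M := (hκle.absolutelyContinuous.trans hac) (hb i)
    have hbν : ∀ᵐ x ∂(ν i), ‖h i x‖ ≤ M := ((h1 i).absolutelyContinuous.trans hac) (hb i)
    have hiκ : Integrable (h i) κ :=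
      Integrable.of_bound ((hm i).mono_ac (hκle.absolutelyContinuous.trans hac)) M hbκ
    have hiν : Integrable (h i) (ν i) :=
      Integrable.of_bound ((hm i).mono_ac ((h1 i).absolutelyContinuous.trans hac)) M hbν
    have hInt : ∫ x, h i x ∂κ + ∫ x, h i x ∂(ν i) = (C i : ℝ) * ∫ x, h i x ∂μ := by
      rw [← integral_add_measure hiκ hiν, hadd, integral_smul_nnreal_measure]
      rfl
    have hmass : κ.real univ + (ν i).real univ = (C i : ℝ) * m := by
      rw [← measureReal_add_apply, hadd, measureReal_nnreal_smul_apply]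
    have hνm : m ≤ (C i : ℝ) * (ν i).real univ := by
      have := h2 i univ
      have h3 : μ.real univ ≤ (C i • ν i).real univ :=
        ENNReal.toReal_mono (measure_ne_top _ _) this
      rwa [measureReal_nnreal_smul_apply] at h3
    have hCp : (0 : ℝ) < C i := by exact_mod_cast hC0 i
    have hνm2 : (C i : ℝ)⁻¹ * m ≤ (ν i).real univ := by
      rw [inv_mul_le_iff₀ hCp]; exact hνm
    have heq : (∫ x, h i x ∂(ν i)) - (C i : ℝ) * ∫ x, h i x ∂μ = - ∫ x, h i x ∂κ := by
      rw [← hInt]; ring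
    rw [heq, norm_neg]
    have hn := norm_integral_le_of_norm_le_const hbκ
    rcases le_or_gt 0 M with hM | hM
    · refine hn.trans ?_
      gcongr
      linarith
    · have hz : μ = 0 := by
        rw [← ae_eq_bot, ← Filter.eventually_false_iff_eq_bot]
        filter_upwards [hb i] with x hx
        linarith [norm_nonneg (h i x)]
      have hz' : κ.real univ = 0 := by
        have : κ ≤ 0 := by simpa [hz] using hκle
        have : κ = 0 := le_antisymm this (Measure.zero_le _)
        simp [this]
      have hm0 : m = 0 := by simp [hmdef, hz]
      rw [hz', mul_zero] at hn
      rw [hm0]; simpa using hn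
  have hsub : Tendsto (fun i => (∫ x, h i x ∂(ν i)) - (C i : ℝ) * ∫ x, h i x ∂μ) atTop (𝓝 0) :=
    squeeze_zero_norm hkey herr
  simpa using hsub.add hdom2

lemma tendsto_surface_integral {E : Type*} [MetricSpace E] [MeasurableSpace E] [BorelSpace E]
    (φ : ℕ → E ≃ₜ E) (K : ℕ → NNReal) (hK0 : ∀ i, 0 < K i) (hK : Tendsto K atTop (𝓝 1))
    (h1 : ∀ i, LipschitzWith (K i) (φ i)) (h2 : ∀ i, LipschitzWith (K i) (φ i).symm)
    {s : ℝ} (hs : 0 ≤ s) (S : Set E) (hS : IsClosed S) (hfin : μH[s] S < ⊤)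
    (g : ℕ → E → ℝ) (g₀ : E → ℝ) (M : ℝ)
    (hm : ∀ i, AEStronglyMeasurable (fun x => g i (φ i x)) (μH[s].restrict S))
    (hb : ∀ i, ∀ x ∈ S, ‖g i (φ i x)‖ ≤ M)
    (hl : ∀ x ∈ S, Tendsto (fun i => g i (φ i x)) atTop (𝓝 (g₀ x))) :
    Tendsto (fun i => ∫ x in φ i '' S, g i x ∂μH[s]) atTop (𝓝 (∫ x in S, g₀ x ∂μH[s])) := by
  have : IsFiniteMeasure ((μH[s] : Measure E).restrict S) := ⟨by simpa using hfin⟩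
  have hid : ∀ i, (∫ x in φ i '' S, g i x ∂μH[s]) =
      ∫ x, g i (φ i x) ∂(((μH[s] : Measure E).restrict (φ i '' S)).map (φ i).symm) := by
    intro i
    have := (φ i).symm.measurableEmbedding.integral_map
      (μ := (μH[s] : Measure E).restrict (φ i '' S)) (fun x => g i (φ i x))
    rw [this]
    simp
  have hval : ∀ i A, MeasurableSet A →
      (((μH[s] : Measure E).restrict (φ i '' S)).map (φ i).symm) A = μH[s] (φ i '' (S ∩ A)) := by
    intro i A hA
    rw [(φ i).symm.measurableEmbedding.map_apply, Measure.restrict_apply]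
    · rw [← (φ i).image_eq_preimage_symm, image_inter (φ i).injective, inter_comm]
    · exact (φ i).symm.measurable hA
  simp_rw [hid]
  have hKs : Tendsto (fun i => K i ^ s) atTop (𝓝 1) := by
    have := (NNReal.continuousAt_rpow_const (x := 1) (y := s) (Or.inl one_ne_zero)).tendsto.comp hK
    simpa [Function.comp_def] using this
  have hcoe : ∀ i, ((K i ^ s : NNReal) : ℝ≥0∞) = (K i : ℝ≥0∞) ^ s := fun i =>
    (ENNReal.coe_rpow_of_nonneg _ hs)
  refine tendsto_integral_of_close ((μH[s] : Measure E).restrict S) _ (fun i => K i ^ s)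
    (fun i => NNReal.rpow_pos (hK0 i)) hKs ?_ ?_ (fun i x => g i (φ i x)) g₀ M hm ?_ ?_
  · intro i
    refine Measure.le_iff.2 fun A hA => ?_
    rw [hval i A hA]
    refine ((h1 i).hausdorffMeasure_image_le hs _).trans ?_
    rw [Measure.smul_apply, Measure.restrict_apply hA, inter_comm, ENNReal.smul_def, hcoe,
      smul_eq_mul]
  · intro i
    refine Measure.le_iff.2 fun A hA => ?_
    rw [Measure.smul_apply, hval i A hA, Measure.restrict_apply hA, ENNReal.smul_def, hcoe,
      smul_eq_mul, inter_comm]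
    have h := (h2 i).hausdorffMeasure_image_le hs (φ i '' (S ∩ A))
    rw [← image_comp] at h
    have h3 : ((φ i).symm ∘ φ i : E → E) = id := by ext x; simp
    rwa [h3, image_id] at h
  · intro i
    exact (ae_restrict_iff' hS.measurableSet).2 (Eventually.of_forall (hb i))
  · exact (ae_restrict_iff' hS.measurableSet).2 (Eventually.of_forall hl)

end Meas

end PartP3

section PartP4
section Field
variable {E : Type*} [NormedAddCommGroup E] [InnerProductSpace ℝ E] [FiniteDimensional ℝ E]

lemma summable_half : Summable (fun k : ℕ => ((1 : ℝ) / 2) ^ (k + 1)) := by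
  simpa [pow_succ] using (summable_geometric_two).mul_right (1 / 2 : ℝ)

lemma tsum_half : ∑' k : ℕ, ((1 : ℝ) / 2) ^ (k + 1) = 1 := by
  simp only [pow_succ]
  rw [tsum_mul_right, tsum_geometric_two]; norm_num

/-- Scaling a bump field. -/
lemma exists_small_scale (h : E → E) (hh : ContDiff ℝ (⊤ : ℕ∞) h) (B : Set E)
    (hB : IsCompact B) (hs : Function.support h ⊆ B) (hc : tsupport h ⊆ B)
    (δ : E → ℝ) (hδc : Continuous δ) (hδ0 : ∀ x, 0 ≤ δ x) (hδ : ∀ x ∈ B, 0 < δ x) (k : ℕ)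
    {η : ℝ} (hη : 0 < η) :
    ∃ c : ℝ, 0 < c ∧ (∀ j ≤ k, ∀ x, ‖iteratedFDeriv ℝ j (fun x => c • h x) x‖ ≤ η) ∧
      (∀ x, ‖fderiv ℝ (fun x => c • h x) x‖ ≤ η) ∧
      (∀ x, ‖c • h x‖ ≤ η * δ x) ∧ (∀ x, ‖fderiv ℝ (fun x => c • h x) x‖ ≤ η * δ x) := by
  have hcs : HasCompactSupport h := hB.of_isClosed_subset (isClosed_tsupport h) hc
  have hb : ∀ j : ℕ, ∃ C : ℝ, ∀ x, ‖iteratedFDeriv ℝ j h x‖ ≤ C := fun j =>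
    (hh.continuous_iteratedFDeriv (by exact_mod_cast le_top)).bounded_above_of_compact_support
      (hcs.iteratedFDeriv j)
  choose C hC using hb
  obtain ⟨C1, hC1⟩ := (hh.continuous_fderiv (by simp)).bounded_above_of_compact_support
    (hcs.fderiv (𝕜 := ℝ))
  obtain ⟨C0, hC0⟩ := hh.continuous.bounded_above_of_compact_support hcs
  obtain ⟨m, hm0, hm⟩ : ∃ m : ℝ, 0 < m ∧ ∀ x ∈ B, m ≤ δ x := by
    rcases B.eq_empty_or_nonempty with rfl | hne
    · exact ⟨1, one_pos, by simp⟩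
    · obtain ⟨x0, hx0, hmin⟩ := hB.exists_isMinOn hne hδc.continuousOn
      exact ⟨δ x0, hδ x0 hx0, fun x hx => hmin hx⟩
  set A : ℝ := 1 + |C0| + |C1| + ∑ j ∈ Finset.range (k + 1), |C j| with hA
  have hsum0 : 0 ≤ ∑ j ∈ Finset.range (k + 1), |C j| := Finset.sum_nonneg fun _ _ => abs_nonneg _
  have hA1 : 0 < A := by positivity
  set c : ℝ := η * min 1 m / A with hcdef
  have hmin0 : 0 < min 1 m := lt_min one_pos hm0
  have hc0 : 0 < c := by positivity
  have hcA : c * A = η * min 1 m := by rw [hcdef]; field_simp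
  have hle1 : η * min 1 m ≤ η := by
    have := min_le_left (1 : ℝ) m
    nlinarith
  have hlem : η * min 1 m ≤ η * m := by
    have := min_le_right (1 : ℝ) m
    gcongr
  have hfd : ∀ x, fderiv ℝ (fun x => c • h x) x = c • fderiv ℝ h x := fun x =>
    fderiv_fun_const_smul (hh.differentiable (by simp) x) c
  have hA0 : C0 ≤ A := by linarith [le_abs_self C0, abs_nonneg C1]
  have hA1' : C1 ≤ A := by linarith [le_abs_self C1, abs_nonneg C0]
  refine ⟨c, hc0, ?_, ?_, ?_, ?_⟩
  · intro j hj x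
    rw [show (fun x => c • h x) = c • h from rfl, iteratedFDeriv_const_smul_apply
      ((hh.of_le (by exact_mod_cast le_top)).contDiffAt), norm_smul, Real.norm_eq_abs, abs_of_pos hc0]
    refine le_trans ?_ hle1
    rw [← hcA]
    gcongr
    refine (hC j x).trans ((le_abs_self _).trans ?_)
    have := Finset.single_le_sum (f := fun j => |C j|) (fun _ _ => abs_nonneg _)
      (Finset.mem_range.2 (Nat.lt_succ_of_le hj))
    linarith [abs_nonneg C0, abs_nonneg C1]
  · intro x
    rw [hfd, norm_smul, Real.norm_eq_abs, abs_of_pos hc0]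
    refine le_trans ?_ hle1
    rw [← hcA]
    gcongr
    exact (hC1 x).trans hA1'
  · intro x
    by_cases hx : x ∈ B
    · rw [norm_smul, Real.norm_eq_abs, abs_of_pos hc0]
      calc c * ‖h x‖ ≤ c * A := by gcongr; exact (hC0 x).trans hA0
        _ ≤ η * m := by rw [hcA]; exact hlem
        _ ≤ η * δ x := by gcongr; exact hm x hx
    · have : h x = 0 := by by_contra h0; exact hx (hs h0)
      rw [this, smul_zero, norm_zero]
      exact mul_nonneg hη.le (hδ0 x)
  · intro x
    rw [hfd]
    by_cases hx : x ∈ B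
    · rw [norm_smul, Real.norm_eq_abs, abs_of_pos hc0]
      calc c * ‖fderiv ℝ h x‖ ≤ c * A := by gcongr; exact (hC1 x).trans hA1'
        _ ≤ η * m := by rw [hcA]; exact hlem
        _ ≤ η * δ x := by gcongr; exact hm x hx
    · have : fderiv ℝ h x = 0 := by
        by_contra h0
        exact hx (hc (support_fderiv_subset ℝ h0))
      rw [this, smul_zero, norm_zero]
      exact mul_nonneg hη.le (hδ0 x)

/-- Existence of a small, smooth, strictly outward field. -/
lemma exists_field (S : Set E) (n : E → E) (hn : ContinuousOn n S) (hn1 : ∀ y ∈ S, ‖n y‖ = 1)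
    (W : Set E) (hW : IsOpen W) (hSW : S ⊆ W) (δ : E → ℝ) (hδc : Continuous δ)
    (hδ0 : ∀ x, 0 ≤ δ x) (hδ : ∀ x ∈ W, 0 < δ x) :
    ∃ X : E → E, ContDiff ℝ (⊤ : ℕ∞) X ∧ (∀ x, ‖X x‖ ≤ δ x) ∧ (∀ x, ‖fderiv ℝ X x‖ ≤ δ x) ∧
      ∀ y ∈ S, X y ≠ 0 ∧ 1 / 2 * ‖X y‖ ≤ ⟪n y, X y⟫ := by
  rcases S.eq_empty_or_nonempty with rfl | hne
  · exact ⟨fun _ => 0, contDiff_const, by simpa using hδ0, by simpa using hδ0, by simp⟩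
  have hr : ∀ p : E, ∃ r : ℝ, p ∈ S → 0 < r ∧ closedBall p r ⊆ W ∧
      ∀ y ∈ S ∩ closedBall p r, 1 / 2 ≤ ⟪n y, n p⟫ := by
    intro p
    by_cases hp : p ∈ S
    · obtain ⟨r1, hr1, h1⟩ := Metric.nhds_basis_closedBall.mem_iff.1 (hW.mem_nhds (hSW hp))
      have hcont : ContinuousWithinAt (fun y => ⟪n y, n p⟫) S p :=
        (hn p hp).inner continuousWithinAt_const
      have hev : ∀ᶠ y in 𝓝[S] p, 1 / 2 < ⟪n y, n p⟫ := by
        apply hcont.eventually_const_lt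
        show 1 / 2 < ⟪n p, n p⟫
        rw [real_inner_self_eq_norm_sq, hn1 p hp]; norm_num
      obtain ⟨r2, hr2, h2⟩ := (nhdsWithin_hasBasis Metric.nhds_basis_closedBall S).mem_iff.1 hev
      refine ⟨min r1 r2, fun _ => ⟨lt_min hr1 hr2,
        (closedBall_subset_closedBall (min_le_left _ _)).trans h1, fun y hy => ?_⟩⟩
      have : y ∈ {y | 1 / 2 < ⟪n y, n p⟫} :=
        h2 ⟨closedBall_subset_closedBall (min_le_right _ _) hy.2, hy.1⟩
      exact le_of_lt this
    · exact ⟨1, fun h => absurd h hp⟩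
  choose r hr using hr
  obtain ⟨T, hTS, hTc, hTcov⟩ := TopologicalSpace.countable_cover_nhdsWithin (s := S)
    (f := fun p => ball p (r p / 2))
    (fun p hp => mem_nhdsWithin_of_mem_nhds (ball_mem_nhds p (half_pos (hr p hp).1)))
  have hTne : T.Nonempty := by
    obtain ⟨x, hx⟩ := hne
    obtain ⟨p, hp, -⟩ := mem_iUnion₂.1 (hTcov hx)
    exact ⟨p, hp⟩
  obtain ⟨p, hp⟩ := hTc.exists_eq_range hTne
  have hpS : ∀ k, p k ∈ S := fun k => hTS (hp ▸ mem_range_self k)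
  let f : ∀ k, ContDiffBump (p k) := fun k =>
    ⟨r (p k) / 2, r (p k), half_pos (hr _ (hpS k)).1, half_lt_self (hr _ (hpS k)).1⟩
  let h : ℕ → E → E := fun k x => f k x • n (p k)
  have hsm : ∀ k, ContDiff ℝ (⊤ : ℕ∞) (h k) := fun k =>
    (f k).contDiff.smul contDiff_const
  have hts : ∀ k, tsupport (h k) ⊆ closedBall (p k) (r (p k)) := by
    intro k
    refine (tsupport_smul_subset_left (f k) (fun _ => n (p k))).trans ?_
    rw [(f k).tsupport_eq]
  have hscale := fun k => exists_small_scale (h k) (hsm k) (closedBall (p k) (r (p k)))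
    (isCompact_closedBall _ _) ((subset_tsupport _).trans (hts k)) (hts k) δ hδc hδ0
    (fun x hx => hδ x ((hr _ (hpS k)).2.1 hx)) k (η := (1 / 2) ^ (k + 1)) (by positivity)
  choose c hc0 hcj hcd hcδ hcdδ using hscale
  let F : ℕ → E → E := fun k x => c k • h k x
  have hF : ∀ k, ContDiff ℝ (⊤ : ℕ∞) (F k) := fun k => (hsm k).const_smul (c k)
  have hsumx : ∀ x, Summable (fun k => ‖F k x‖) := fun x =>
    Summable.of_nonneg_of_le (fun _ => norm_nonneg _) (fun k => hcδ k x)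
      (summable_half.mul_right (δ x))
  have hfd : ∀ x, fderiv ℝ (fun x => ∑' k, F k x) x = ∑' k, fderiv ℝ (F k) x := by
    intro x
    exact fderiv_tsum_apply summable_half (fun k => (hF k).differentiable (by simp))
      (fun k x => hcd k x) (x₀ := 0) (hsumx 0).of_norm x
  refine ⟨fun x => ∑' k, F k x, ?_, ?_, ?_, ?_⟩
  · refine contDiff_tsum_of_eventually (v := fun _ k => (1 / 2 : ℝ) ^ (k + 1)) hF
      (fun _ _ => summable_half) ?_
    intro j _
    rw [Nat.cofinite_eq_atTop]
    filter_upwards [eventually_ge_atTop j] with k hk x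
    exact hcj k j hk x
  · intro x
    refine (norm_tsum_le_tsum_norm (hsumx x)).trans ?_
    refine ((hsumx x).tsum_le_tsum (fun k => hcδ k x) (summable_half.mul_right (δ x))).trans ?_
    rw [tsum_mul_right, tsum_half, one_mul]
  · intro x
    have hs : Summable (fun k => ‖fderiv ℝ (F k) x‖) :=
      Summable.of_nonneg_of_le (fun _ => norm_nonneg _) (fun k => hcdδ k x)
        (summable_half.mul_right (δ x))
    rw [hfd]
    refine (norm_tsum_le_tsum_norm hs).trans ?_
    refine (hs.tsum_le_tsum (fun k => hcdδ k x) (summable_half.mul_right (δ x))).trans ?_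
    rw [tsum_mul_right, tsum_half, one_mul]
  · intro y hy
    have hpt : ∀ k, 1 / 2 * ‖F k y‖ ≤ ⟪n y, F k y⟫ := by
      intro k
      have hFk : F k y = (c k * f k y) • n (p k) := by simp [F, h, smul_smul]
      have hnn : 0 ≤ c k * f k y := mul_nonneg (hc0 k).le (f k).nonneg
      rw [hFk, norm_smul, real_inner_smul_right, hn1 _ (hpS k), Real.norm_eq_abs,
        abs_of_nonneg hnn]
      by_cases hyb : y ∈ closedBall (p k) (r (p k))
      · have := (hr _ (hpS k)).2.2 y ⟨hy, hyb⟩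
        nlinarith
      · have : f k y = 0 := by
          apply (f k).zero_of_le_dist
          rw [mem_closedBall, not_le] at hyb
          exact hyb.le
        simp [this]
    have hinner : ⟪n y, ∑' k, F k y⟫ = ∑' k, ⟪n y, F k y⟫ :=
      (innerSL ℝ (n y)).map_tsum (hsumx y).of_norm
    have hsi : Summable (fun k => ⟪n y, F k y⟫) := (hsumx y).of_norm.mapL (innerSL ℝ (n y))
    have h1 : 1 / 2 * ∑' k, ‖F k y‖ ≤ ⟪n y, ∑' k, F k y⟫ := by
      rw [hinner, ← tsum_mul_left]
      exact ((hsumx y).mul_left _).tsum_le_tsum hpt hsi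
    have hpos : 0 < ∑' k, ‖F k y‖ := by
      obtain ⟨q, hq, hyq⟩ := mem_iUnion₂.1 (hTcov hy)
      rw [hp] at hq
      obtain ⟨k, rfl⟩ := hq
      refine (hsumx y).tsum_pos (fun _ => norm_nonneg _) k ?_
      have hf1 : f k y = 1 := (f k).one_of_mem_closedBall (ball_subset_closedBall hyq)
      have hFk : F k y = c k • n (p k) := by simp [F, h, hf1]
      rw [hFk, norm_smul, hn1 _ (hpS k), mul_one, Real.norm_eq_abs, abs_of_pos (hc0 k)]
      exact hc0 k
    have hle := norm_tsum_le_tsum_norm (hsumx y)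
    refine ⟨?_, by linarith⟩
    intro h0
    simp only at h0
    rw [h0, inner_zero_right] at h1
    linarith

end Field

end PartP4

section PartP5a
theorem dimH_zero_set_le {E' F : Type*} [NormedAddCommGroup E'] [NormedSpace ℝ E']
    [FiniteDimensional ℝ E'] [NormedAddCommGroup F] [NormedSpace ℝ F] [FiniteDimensional ℝ F]
    (g : E' → F) (Z : Set E') (hZ : ∀ p ∈ Z, g p = 0) (n : ℕ)
    (hn : Module.finrank ℝ E' = n + Module.finrank ℝ F)
    (hg : ∀ p ∈ Z, ∃ g' : E' →L[ℝ] F, HasStrictFDerivAt g g' p ∧ Function.Surjective g') :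
    dimH Z ≤ n := by
  by_contra hlt
  push Not at hlt
  obtain ⟨p, hp, hall⟩ := exists_mem_nhdsWithin_lt_dimH_of_lt_dimH hlt
  obtain ⟨g', hg', hsurj⟩ := hg p hp
  obtain ⟨q, hq⟩ := Submodule.exists_isCompl g'.ker
  have hrange : g'.range = ⊤ := LinearMap.range_eq_top.2 hsurj
  let P : E' →L[ℝ] g'.ker := LinearMap.toContinuousLinearMap (Submodule.projectionOnto g'.ker q hq)
  have hPk : P.ker = q := by
    simp [P]
  have hPr : P.range = ⊤ := by
    simp [P]
  have hcomp : IsCompl g'.ker P.ker := by rw [hPk]; exact hq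
  let T : E' ≃L[ℝ] F × g'.ker :=
    ContinuousLinearMap.equivProdOfSurjectiveOfIsCompl g' P hrange hPr hcomp
  have hT : (T : E' →L[ℝ] F × g'.ker) = g'.prod P := rfl
  let Φ : E' → F × g'.ker := fun x => (g x, P x)
  have hΦ : HasStrictFDerivAt Φ (T : E' →L[ℝ] F × g'.ker) p := by
    rw [hT]
    exact hg'.prodMk P.hasStrictFDerivAt
  obtain ⟨s, hps, hso, hs⟩ := hΦ.approximates_deriv_on_open_nhds
  have hanti := hs.antilipschitz (by
    rcases subsingleton_or_nontrivial E' with h | h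
    · left; exact h
    · right
      exact NNReal.half_lt_self (ne_of_gt (inv_pos.2 (T.subsingleton_or_nnnorm_symm_pos.resolve_left (not_subsingleton _)))))
  have hmem : Z ∩ s ∈ 𝓝[Z] p := inter_mem self_mem_nhdsWithin (mem_nhdsWithin_of_mem_nhds (hso.mem_nhds hps))
  have h1 := hall _ hmem
  let A : Set s := Subtype.val ⁻¹' Z
  have hA : Subtype.val '' A = Z ∩ s := by
    rw [Subtype.image_preimage_coe, inter_comm]
  have h2 : dimH (Z ∩ s) = dimH A := by
    rw [← hA]; exact isometry_subtype_coe.dimH_image A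
  have h3 : dimH A ≤ dimH (s.domRestrict Φ '' A) := hanti.le_dimH_image A
  have h4 : s.domRestrict Φ '' A ⊆ range (fun w : g'.ker => ((0 : F), w)) := by
    rintro _ ⟨x, hx, rfl⟩
    exact ⟨P x, Prod.ext (hZ _ hx).symm rfl⟩
  have h5 : dimH (range (fun w : g'.ker => ((0 : F), w))) ≤ Module.finrank ℝ g'.ker := by
    apply ContDiff.dimH_range_le
    exact contDiff_const.prodMk contDiff_id
  have h6 : Module.finrank ℝ g'.ker = n := by
    have := LinearMap.finrank_range_add_finrank_ker (g' : E' →ₗ[ℝ] F)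
    have hr : Module.finrank ℝ (LinearMap.range (g' : E' →ₗ[ℝ] F)) = Module.finrank ℝ F := by
      rw [show LinearMap.range (g' : E' →ₗ[ℝ] F) = ⊤ from hrange]; exact finrank_top ℝ F
    have h7 : Module.finrank ℝ (LinearMap.ker (g' : E' →ₗ[ℝ] F)) = n := by omega
    exact h7
  rw [h6] at h5
  exact absurd h1 (not_lt.2 (h2.le.trans (h3.trans ((dimH_mono h4).trans h5))))

end PartP5a

section PartP5b
variable {E : Type*} [NormedAddCommGroup E] [InnerProductSpace ℝ E] [FiniteDimensional ℝ E]

/-- Parameters `(a, t)` for which tangency occurs in a given pair of charts. -/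
def badSet (X : E → E) (U : Set E) (u : E → ℝ) (V : Set E) (v : E → ℝ) : Set (E × ℝ) :=
  {q | ∃ y ∈ U, ∃ τ μ : ℝ, τ = q.2 * Real.exp ⟪q.1, y⟫ ∧ τ ≠ 0 ∧ y + τ • X y ∈ V ∧
    u y = 0 ∧ v (y + τ • X y) = 0 ∧ ⟪X y, gradient v (y + τ • X y)⟫ ≠ 0 ∧
    gradient v (y + τ • X y) + τ • (ContinuousLinearMap.adjoint (fderiv ℝ X y)
      (gradient v (y + τ • X y)) + ⟪X y, gradient v (y + τ • X y)⟫ • q.1) = μ • gradient u y}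

def badA (X : E → E) (u : E → ℝ) (v : E → ℝ) (z : E × ℝ × ℝ) : E :=
  (z.2.1 * ⟪X z.1, gradient v (z.1 + z.2.1 • X z.1)⟫)⁻¹ •
    (z.2.2 • gradient u z.1 - gradient v (z.1 + z.2.1 • X z.1) -
      z.2.1 • ContinuousLinearMap.adjoint (fderiv ℝ X z.1) (gradient v (z.1 + z.2.1 • X z.1)))

theorem contDiffAt_badA {X : E → E} (hX : ContDiff ℝ (⊤ : ℕ∞) X) {U V : Set E} (hU : IsOpen U)
    (hV : IsOpen V) {u v : E → ℝ} (hu : ContDiffOn ℝ (⊤ : ℕ∞) u U)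
    (hv : ContDiffOn ℝ (⊤ : ℕ∞) v V) {z : E × ℝ × ℝ} (hz : z.1 ∈ U)
    (hzV : z.1 + z.2.1 • X z.1 ∈ V) (h0 : z.2.1 ≠ 0)
    (h1 : ⟪X z.1, gradient v (z.1 + z.2.1 • X z.1)⟫ ≠ 0) :
    ContDiffAt ℝ 1 (badA X u v) z := by
  have h1le : (1 : WithTop ℕ∞) ≤ ((⊤ : ℕ∞) : WithTop ℕ∞) := by exact_mod_cast le_top
  have hX1 : ContDiff ℝ 1 X := hX.of_le h1le
  have hXz : ContDiffAt ℝ 1 (fun z : E × ℝ × ℝ => X z.1) z :=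
    (hX1.comp contDiff_fst).contDiffAt
  have hτ : ContDiffAt ℝ 1 (fun z : E × ℝ × ℝ => z.2.1) z :=
    (contDiff_fst.comp contDiff_snd).contDiffAt
  have hμ : ContDiffAt ℝ 1 (fun z : E × ℝ × ℝ => z.2.2) z :=
    (contDiff_snd.comp contDiff_snd).contDiffAt
  have hp : ContDiffAt ℝ 1 (fun z : E × ℝ × ℝ => z.1 + z.2.1 • X z.1) z :=
    contDiff_fst.contDiffAt.add (hτ.smul hXz)
  have hgv : ContDiffAt ℝ 1 (gradient v) (z.1 + z.2.1 • X z.1) :=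
    ((gradient_contDiffOn hV hv).contDiffAt (hV.mem_nhds hzV)).of_le h1le
  have hgu : ContDiffAt ℝ 1 (gradient u) z.1 :=
    ((gradient_contDiffOn hU hu).contDiffAt (hU.mem_nhds hz)).of_le h1le
  have hgv' : ContDiffAt ℝ 1 (fun z : E × ℝ × ℝ => gradient v (z.1 + z.2.1 • X z.1)) z :=
    ContDiffAt.comp (g := gradient v) z hgv hp
  have hgu' : ContDiffAt ℝ 1 (fun z : E × ℝ × ℝ => gradient u z.1) z :=
    ContDiffAt.comp (g := gradient u) z hgu contDiff_fst.contDiffAt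
  have hDX : ContDiff ℝ 1 (fun y => fderiv ℝ X y) :=
    (hX.fderiv_right (m := ((⊤ : ℕ∞) : WithTop ℕ∞)) (by simp)).of_le h1le
  have hadj : ContDiff ℝ 1 (fun y => ContinuousLinearMap.adjoint (fderiv ℝ X y)) :=
    (LinearIsometryEquiv.contDiff (ContinuousLinearMap.adjoint (𝕜 := ℝ) (E := E) (F := E))).comp hDX
  have hadj' : ContDiffAt ℝ 1 (fun z : E × ℝ × ℝ => ContinuousLinearMap.adjoint (fderiv ℝ X z.1)) z :=
    (hadj.comp contDiff_fst).contDiffAt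
  unfold badA
  refine ((hτ.mul (hXz.inner ℝ hgv')).inv (mul_ne_zero h0 h1)).smul ?_
  exact ((hμ.smul hgu').sub hgv').sub (hτ.smul (hadj'.clm_apply hgv'))

theorem dimH_badSet {X : E → E} (hX : ContDiff ℝ (⊤ : ℕ∞) X) {U V : Set E} (hU : IsOpen U)
    (hV : IsOpen V) {u v : E → ℝ} (hu : ContDiffOn ℝ (⊤ : ℕ∞) u U)
    (hv : ContDiffOn ℝ (⊤ : ℕ∞) v V) (hu0 : ∀ x ∈ U, gradient u x ≠ 0) :
    dimH (badSet X U u V v) ≤ Module.finrank ℝ E := by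
  have h1le : (1 : WithTop ℕ∞) ≤ ((⊤ : ℕ∞) : WithTop ℕ∞) := by exact_mod_cast le_top
  let Z : Set (E × ℝ × ℝ) := {z | z.1 ∈ U ∧ z.1 + z.2.1 • X z.1 ∈ V ∧ u z.1 = 0 ∧
    v (z.1 + z.2.1 • X z.1) = 0 ∧ z.2.1 ≠ 0 ∧ ⟪X z.1, gradient v (z.1 + z.2.1 • X z.1)⟫ ≠ 0}
  let F : E × ℝ × ℝ → E × ℝ := fun z =>
    (badA X u v z, z.2.1 * Real.exp (-⟪badA X u v z, z.1⟫))
  have hsub : badSet X U u V v ⊆ F '' Z := by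
    rintro ⟨a, t⟩ ⟨y, hy, τ, μ, hτ, hτ0, hpV, huy, hvp, hne, heq⟩
    refine ⟨(y, τ, μ), ⟨hy, hpV, huy, hvp, hτ0, hne⟩, ?_⟩
    have ha : badA X u v (y, τ, μ) = a := by
      simp only [badA]
      rw [← heq, smul_add, inv_smul_eq_iff₀ (mul_ne_zero hτ0 hne), smul_smul]
      abel
    simp only [F, ha]
    refine Prod.ext rfl ?_
    simp only at hτ ⊢
    rw [hτ, mul_assoc, ← Real.exp_add]; simp
  have hdZ : dimH Z ≤ (Module.finrank ℝ E : ℕ) := by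
    refine dimH_zero_set_le (fun z : E × ℝ × ℝ => (u z.1, v (z.1 + z.2.1 • X z.1))) Z ?_ _ ?_ ?_
    · rintro z ⟨_, _, h1, h2, _⟩
      simp only [h1, h2]; rfl
    · simp [Module.finrank_prod]
    · rintro z ⟨hz, hzV, _, _, h0, h1⟩
      have hX' : HasStrictFDerivAt X (fderiv ℝ X z.1) z.1 :=
        hX.contDiffAt.hasStrictFDerivAt (by simp)
      have hu' : HasStrictFDerivAt u (fderiv ℝ u z.1) z.1 :=
        (hu.contDiffAt (hU.mem_nhds hz)).hasStrictFDerivAt (by simp)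
      have hv' : HasStrictFDerivAt v (fderiv ℝ v (z.1 + z.2.1 • X z.1)) (z.1 + z.2.1 • X z.1) :=
        (hv.contDiffAt (hV.mem_nhds hzV)).hasStrictFDerivAt (by simp)
      have hfst : HasStrictFDerivAt (fun z : E × ℝ × ℝ => z.1) (ContinuousLinearMap.fst ℝ E (ℝ × ℝ)) z :=
        hasStrictFDerivAt_fst
      have hτ' : HasStrictFDerivAt (fun z : E × ℝ × ℝ => z.2.1)
          ((ContinuousLinearMap.fst ℝ ℝ ℝ).comp (ContinuousLinearMap.snd ℝ E (ℝ × ℝ))) z :=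
        HasStrictFDerivAt.comp z hasStrictFDerivAt_fst hasStrictFDerivAt_snd
      have hXf := HasStrictFDerivAt.comp z hX' hfst
      have hp := hfst.add (hτ'.smul hXf)
      have hg := (HasStrictFDerivAt.comp z hu' hfst).prodMk (HasStrictFDerivAt.comp z hv' hp)
      refine ⟨_, hg, ?_⟩
      rintro ⟨α, β⟩
      have hgu : ∀ w, fderiv ℝ u z.1 w = ⟪gradient u z.1, w⟫ := fun w => by
        simp [gradient]
      have hgv : ∀ w, fderiv ℝ v (z.1 + z.2.1 • X z.1) w
          = ⟪gradient v (z.1 + z.2.1 • X z.1), w⟫ := fun w => by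
        simp [gradient]
      have hne : ‖gradient u z.1‖ ^ 2 ≠ 0 := by
        have := hu0 _ hz; positivity
      let w : E := (α / ‖gradient u z.1‖ ^ 2) • gradient u z.1
      have hw : ⟪gradient u z.1, w⟫ = α := by
        simp only [w, inner_smul_right, real_inner_self_eq_norm_sq]
        exact div_mul_cancel₀ _ hne
      rw [real_inner_comm] at h1
      refine ⟨(w, ((β - ⟪gradient v (z.1 + z.2.1 • X z.1), w + z.2.1 • fderiv ℝ X z.1 w⟫)
        / ⟪gradient v (z.1 + z.2.1 • X z.1), X z.1⟫, 0)), ?_⟩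
      refine Prod.ext ?_ ?_
      · simp [hgu, hw]
      · change fderiv ℝ v (z.1 + z.2.1 • X z.1) (w + (z.2.1 • fderiv ℝ X z.1 w +
          ((β - ⟪gradient v (z.1 + z.2.1 • X z.1), w + z.2.1 • fderiv ℝ X z.1 w⟫)
            / ⟪gradient v (z.1 + z.2.1 • X z.1), X z.1⟫) • X z.1)) = β
        rw [hgv, ← add_assoc, inner_add_right, inner_smul_right, div_mul_cancel₀ _ h1]
        ring
  have hF : ∀ z ∈ Z, ContDiffAt ℝ 1 F z := by
    rintro z ⟨hz, hzV, _, _, h0, h1⟩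
    have hA := contDiffAt_badA hX hU hV hu hv hz hzV h0 h1
    have hτ : ContDiffAt ℝ 1 (fun z : E × ℝ × ℝ => z.2.1) z :=
      (contDiff_fst.comp contDiff_snd).contDiffAt
    exact hA.prodMk (hτ.mul (hA.inner ℝ contDiff_fst.contDiffAt).neg.exp)
  refine (dimH_mono hsub).trans (le_trans ?_ hdZ)
  apply dimH_image_le_of_locally_lipschitzOn
  intro z hz
  obtain ⟨K, t, ht, hK⟩ := (hF z hz).exists_lipschitzOnWith
  exact ⟨K, t, mem_nhdsWithin_of_mem_nhds ht, hK⟩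

theorem volume_badSet [MeasurableSpace E] [BorelSpace E] {X : E → E} (hX : ContDiff ℝ (⊤ : ℕ∞) X) {U V : Set E} (hU : IsOpen U)
    (hV : IsOpen V) {u v : E → ℝ} (hu : ContDiffOn ℝ (⊤ : ℕ∞) u U)
    (hv : ContDiffOn ℝ (⊤ : ℕ∞) v V) (hu0 : ∀ x ∈ U, gradient u x ≠ 0) :
    ((volume : Measure E).prod (volume : Measure ℝ)) (badSet X U u V v) = 0 := by
  have hd := dimH_badSet hX hU hV hu hv hu0
  have hfr : Module.finrank ℝ (E × ℝ) = Module.finrank ℝ E + 1 := by simp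
  have h0 : (μH[Module.finrank ℝ (E × ℝ)] : Measure (E × ℝ)) (badSet X U u V v) = 0 := by
    have : dimH (badSet X U u V v) < ((Module.finrank ℝ (E × ℝ) : NNReal) : ℝ≥0∞) := by
      refine hd.trans_lt ?_
      rw [hfr]
      exact_mod_cast Nat.lt_succ_self _
    have := hausdorffMeasure_of_dimH_lt this
    simpa using this
  have := Measure.isAddLeftInvariant_eq_smul ((volume : Measure E).prod (volume : Measure ℝ))
    (μH[Module.finrank ℝ (E × ℝ)] : Measure (E × ℝ))
  rw [this, Measure.smul_apply, h0, smul_zero]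

end PartP5b

section PartP5c
section Gen
variable {E : Type*} [NormedAddCommGroup E] [InnerProductSpace ℝ E] [FiniteDimensional ℝ E]

theorem inner_ne_zero_aux {T : E →L[ℝ] E} {G H X : E} {μ : ℝ} (hT : ‖T‖ ≤ 1 / 4)
    (heq : G + ContinuousLinearMap.adjoint T G = μ • H)
    (hcone : 1 / 2 * (‖X‖ * ‖H‖) ≤ ⟪H, X⟫) (hG : G ≠ 0) (hX : X ≠ 0) : ⟪X, G⟫ ≠ 0 := by
  intro h0
  have hGp : 0 < ‖G‖ := norm_pos_iff.2 hG
  have hXp : 0 < ‖X‖ := norm_pos_iff.2 hX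
  have h1 : ‖ContinuousLinearMap.adjoint T G‖ ≤ 1 / 4 * ‖G‖ := by
    refine (ContinuousLinearMap.le_opNorm _ _).trans ?_
    rw [LinearIsometryEquiv.norm_map]
    gcongr
  have h2 : 3 / 4 * ‖G‖ ≤ |μ| * ‖H‖ := by
    have h3 : ‖G‖ ≤ ‖G + ContinuousLinearMap.adjoint T G‖ + ‖ContinuousLinearMap.adjoint T G‖ := by
      simpa using norm_sub_le (G + ContinuousLinearMap.adjoint T G) (ContinuousLinearMap.adjoint T G)
    rw [heq, norm_smul, Real.norm_eq_abs] at h3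
    linarith
  have h3 : ⟪G + ContinuousLinearMap.adjoint T G, X⟫ = ⟪G, T X⟫ := by
    rw [inner_add_left, ContinuousLinearMap.adjoint_inner_left, real_inner_comm, h0, zero_add]
  have h4 : |⟪G, T X⟫| ≤ 1 / 4 * (‖G‖ * ‖X‖) := by
    refine (abs_real_inner_le_norm _ _).trans ?_
    have := (T.le_opNorm X).trans (mul_le_mul_of_nonneg_right hT (norm_nonneg X))
    nlinarith
  rw [← h3, heq, inner_smul_left, abs_mul] at h4
  simp only [conj_trivial] at h4
  have h5 : |μ| * (1 / 2 * (‖X‖ * ‖H‖)) ≤ |μ| * |⟪H, X⟫| :=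
    mul_le_mul_of_nonneg_left (hcone.trans (le_abs_self _)) (abs_nonneg _)
  nlinarith [mul_pos hGp hXp]

/-- The twisted field. -/
def twist (X : E → E) (a : E) (x : E) : E := Real.exp ⟪a, x⟫ • X x

theorem contDiff_twist {X : E → E} (hX : ContDiff ℝ (⊤ : ℕ∞) X) (a : E) :
    ContDiff ℝ (⊤ : ℕ∞) (twist X a) :=
  ((contDiff_const.inner ℝ contDiff_id).exp).smul hX

theorem fderiv_twist {X : E → E} (hX : ContDiff ℝ (⊤ : ℕ∞) X) (a y h : E) :
    fderiv ℝ (twist X a) y h = Real.exp ⟪a, y⟫ • (fderiv ℝ X y h + ⟪a, h⟫ • X y) := by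
  have hX' : HasFDerivAt X (fderiv ℝ X y) y := (hX.differentiable (by simp) y).hasFDerivAt
  have h1 : HasFDerivAt (fun x => ⟪a, x⟫) (innerSL ℝ a) y := (innerSL ℝ a).hasFDerivAt
  have h2 : HasFDerivAt (twist X a) _ y := h1.exp.smul hX'
  rw [h2.fderiv]
  simp [smul_smul]

theorem adjoint_fderiv_twist {X : E → E} (hX : ContDiff ℝ (⊤ : ℕ∞) X) (a y z : E) :
    ContinuousLinearMap.adjoint (fderiv ℝ (twist X a) y) z = Real.exp ⟪a, y⟫ •
      (ContinuousLinearMap.adjoint (fderiv ℝ X y) z + ⟪X y, z⟫ • a) := by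
  refine ext_inner_right ℝ fun h => ?_
  rw [ContinuousLinearMap.adjoint_inner_left, fderiv_twist hX, inner_smul_right, inner_smul_left,
    inner_add_right, inner_add_left, inner_smul_right, inner_smul_left,
    ContinuousLinearMap.adjoint_inner_left, real_inner_comm (X y) z]
  simp only [conj_trivial]
  ring

theorem twist_exp_le {a x : E} (ha : ‖a‖ ≤ 1) : Real.exp ⟪a, x⟫ * Real.exp (-‖x‖) ≤ 1 := by
  rw [← Real.exp_add]
  refine Real.exp_le_one_iff.2 ?_
  have := real_inner_le_norm a x
  nlinarith [norm_nonneg x]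

theorem norm_twist_le {X : E → E} {a : E} (ha : ‖a‖ ≤ 1) {c : ℝ} {x : E}
    (hb : ‖X x‖ ≤ c * Real.exp (-‖x‖)) (hc : 0 ≤ c) : ‖twist X a x‖ ≤ c := by
  rw [twist, norm_smul, Real.norm_eq_abs, abs_of_pos (Real.exp_pos _)]
  have := twist_exp_le (x := x) ha
  calc Real.exp ⟪a, x⟫ * ‖X x‖ ≤ Real.exp ⟪a, x⟫ * (c * Real.exp (-‖x‖)) := by gcongr
    _ = c * (Real.exp ⟪a, x⟫ * Real.exp (-‖x‖)) := by ring
    _ ≤ c * 1 := by gcongr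
    _ = c := mul_one c

theorem norm_fderiv_twist_le {X : E → E} (hX : ContDiff ℝ (⊤ : ℕ∞) X) {a : E} (ha : ‖a‖ ≤ 1)
    {x : E} (hb : ‖X x‖ ≤ 1 / 8 * Real.exp (-‖x‖))
    (hb' : ‖fderiv ℝ X x‖ ≤ 1 / 8 * Real.exp (-‖x‖)) : ‖fderiv ℝ (twist X a) x‖ ≤ 1 / 4 := by
  refine ContinuousLinearMap.opNorm_le_bound _ (by norm_num) fun h => ?_
  rw [fderiv_twist hX, norm_smul, Real.norm_eq_abs, abs_of_pos (Real.exp_pos _)]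
  have h0 := twist_exp_le (x := x) ha
  have h1 : ‖fderiv ℝ X x h‖ ≤ 1 / 8 * Real.exp (-‖x‖) * ‖h‖ :=
    ((fderiv ℝ X x).le_opNorm h).trans (by gcongr)
  have h2 : ‖⟪a, h⟫ • X x‖ ≤ 1 / 8 * Real.exp (-‖x‖) * ‖h‖ := by
    rw [norm_smul]
    have : ‖⟪a, h⟫‖ ≤ ‖h‖ := (norm_inner_le_norm a h).trans (by nlinarith [norm_nonneg h])
    calc ‖⟪a, h⟫‖ * ‖X x‖ ≤ ‖h‖ * (1 / 8 * Real.exp (-‖x‖)) := by gcongr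
      _ = _ := by ring
  have h3 := (norm_add_le (fderiv ℝ X x h) (⟪a, h⟫ • X x)).trans (add_le_add h1 h2)
  calc Real.exp ⟪a, x⟫ * ‖fderiv ℝ X x h + ⟪a, h⟫ • X x‖
      ≤ Real.exp ⟪a, x⟫ * (1 / 8 * Real.exp (-‖x‖) * ‖h‖ + 1 / 8 * Real.exp (-‖x‖) * ‖h‖) := by
        gcongr
    _ = (Real.exp ⟪a, x⟫ * Real.exp (-‖x‖)) * (1 / 4 * ‖h‖) := by ring
    _ ≤ 1 * (1 / 4 * ‖h‖) := by gcongr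
    _ = _ := one_mul _

end Gen



theorem bad_of_not_transverse {d : ℕ} (D₁ D₂ : RegularDomain d)
    {X : EuclideanSpace ℝ (Fin d) → EuclideanSpace ℝ (Fin d)} (hX : ContDiff ℝ (⊤ : ℕ∞) X)
    (hcone : ∀ y ∈ frontier D₂.carrier, X y ≠ 0 ∧ 1 / 2 * ‖X y‖ ≤ ⟪D₂.normal y, X y⟫)
    (hDX : ∀ x, ‖fderiv ℝ X x‖ ≤ 1 / 8 * Real.exp (-‖x‖))
    {a : EuclideanSpace ℝ (Fin d)} (ha : ‖a‖ ≤ 1) {t : ℝ} (ht : |t| ≤ 1) (ht0 : t ≠ 0)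
    (φ : EuclideanSpace ℝ (Fin d) ≃ₜ EuclideanSpace ℝ (Fin d))
    (hφ : ContDiff ℝ (⊤ : ℕ∞) φ) (hφs : ContDiff ℝ (⊤ : ℕ∞) φ.symm)
    (hφe : ∀ x, φ x = x + t • twist X a x)
    {y : EuclideanSpace ℝ (Fin d)} (hy : y ∈ frontier D₂.carrier)
    (hp : φ y ∈ frontier D₁.carrier)
    (hnot : ¬ LinearIndependent ℝ ![(D₂.image φ hφ hφs).normal (φ y), D₁.normal (φ y)])
    {U V : Set (EuclideanSpace ℝ (Fin d))} {u v : EuclideanSpace ℝ (Fin d) → ℝ}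
    (hyU : y ∈ U) (hpV : φ y ∈ V) (hgu : gradient u y ≠ 0) (hgv : gradient v (φ y) ≠ 0)
    (hu : u y = 0) (hv : v (φ y) = 0)
    (hn : D₂.normal y = ‖gradient u y‖⁻¹ • gradient u y)
    (hn1 : D₁.normal (φ y) = ‖gradient v (φ y)‖⁻¹ • gradient v (φ y)) :
    (a, t) ∈ badSet X U u V v := by
  have hGu : 0 < ‖gradient u y‖ := norm_pos_iff.2 hgu
  have hGv : 0 < ‖gradient v (φ y)‖ := norm_pos_iff.2 hgv
  set τ : ℝ := t * Real.exp ⟪a, y⟫ with hτ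
  have hφy : φ y = y + τ • X y := by rw [hφe, twist, smul_smul]
  have hpf : φ y ∈ frontier (D₂.image φ hφ hφs).carrier := by
    rw [RegularDomain.frontier_image]; exact mem_image_of_mem _ hy
  have hn0 : (D₂.image φ hφ hφs).normal (φ y) ≠ 0 := by
    have := (D₂.image φ hφ hφs).norm_normal hpf
    intro h0
    rw [h0] at this; simp at this
  rw [LinearIndependent.pair_iff' hn0] at hnot
  push Not at hnot
  obtain ⟨c, hc⟩ := hnot
  have himn : (D₂.image φ hφ hφs).normal (φ y)
    = ‖pushNormal D₂ φ (φ y)‖⁻¹ • pushNormal D₂ φ (φ y) := rfl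
  have hadj := adjoint_pushNormal D₂ φ hφ hφs y
  set w := pushNormal D₂ φ (φ y) with hw
  have hG : gradient v (φ y) = (‖gradient v (φ y)‖ * c * ‖w‖⁻¹) • w := by
    have : gradient v (φ y) = ‖gradient v (φ y)‖ • D₁.normal (φ y) := by
      rw [hn1, smul_smul, mul_inv_cancel₀ hGv.ne', one_smul]
    rw [← hc, himn, smul_smul, smul_smul] at this
    exact this
  have hadjG : ContinuousLinearMap.adjoint (fderiv ℝ φ y) (gradient v (φ y))
      = (‖gradient v (φ y)‖ * c * ‖w‖⁻¹ * ‖gradient u y‖⁻¹) • gradient u y := by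
    conv_lhs => rw [hG]
    rw [map_smul, hadj, hn, smul_smul]
  set μ := ‖gradient v (φ y)‖ * c * ‖w‖⁻¹ * ‖gradient u y‖⁻¹
  have hfd : fderiv ℝ φ y = ContinuousLinearMap.id ℝ _ + t • fderiv ℝ (twist X a) y := by
    have : (φ : EuclideanSpace ℝ (Fin d) → EuclideanSpace ℝ (Fin d)) = fun x => x + t • twist X a x := funext hφe
    rw [this]
    have h1 : HasFDerivAt (twist X a) (fderiv ℝ (twist X a) y) y :=
      ((contDiff_twist hX a).differentiable (by simp) y).hasFDerivAt
    exact ((hasFDerivAt_id y).add (h1.const_smul t)).fderiv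
  have hexp : gradient v (φ y) + τ • (ContinuousLinearMap.adjoint (fderiv ℝ X y)
      (gradient v (φ y)) + ⟪X y, gradient v (φ y)⟫ • a) = μ • gradient u y := by
    rw [← hadjG, hfd, map_add, map_smulₛₗ, add_apply, smul_apply, adjoint_fderiv_twist hX, smul_smul]
    have hid : ContinuousLinearMap.adjoint (ContinuousLinearMap.id ℝ (EuclideanSpace ℝ (Fin d)))
        (gradient v (φ y)) = gradient v (φ y) :=
      ext_inner_right ℝ fun h => by
        rw [ContinuousLinearMap.adjoint_inner_left, ContinuousLinearMap.id_apply]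
    rw [hid]
    simp [hτ]
  have hcy := hcone y hy
  have hne : ⟪X y, gradient v (φ y)⟫ ≠ 0 := by
    intro h0
    have hT : ‖τ • fderiv ℝ X y‖ ≤ 1 / 4 := by
      rw [norm_smul, Real.norm_eq_abs, hτ, abs_mul, abs_of_pos (Real.exp_pos _)]
      calc |t| * Real.exp ⟪a, y⟫ * ‖fderiv ℝ X y‖
          ≤ 1 * Real.exp ⟪a, y⟫ * (1 / 8 * Real.exp (-‖y‖)) := by gcongr; exact hDX y
        _ = 1 / 8 * (Real.exp ⟪a, y⟫ * Real.exp (-‖y‖)) := by ring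
        _ ≤ 1 / 8 * 1 := by gcongr; exact twist_exp_le ha
        _ ≤ 1 / 4 := by norm_num
    refine inner_ne_zero_aux hT (G := gradient v (φ y)) (H := gradient u y) (X := X y) (μ := μ)
      ?_ ?_ hgv hcy.1 h0
    · rw [← hexp, h0, zero_smul, add_zero, map_smulₛₗ, smul_apply]
      simp
    · have h2 := hcy.2
      rw [hn, inner_smul_left] at h2
      simp only [conj_trivial] at h2
      rw [inv_mul_eq_div, le_div_iff₀ hGu] at h2
      linarith
  rw [hφy] at hpV hv hne hexp
  exact ⟨y, hyU, τ, μ, rfl, mul_ne_zero ht0 (Real.exp_pos _).ne', hpV, hu, hv, hne, hexp⟩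

theorem exists_good_param {d : ℕ} (D₁ D₂ : RegularDomain d)
    {X : EuclideanSpace ℝ (Fin d) → EuclideanSpace ℝ (Fin d)} (hX : ContDiff ℝ (⊤ : ℕ∞) X)
    (hcone : ∀ y ∈ frontier D₂.carrier, X y ≠ 0 ∧ 1 / 2 * ‖X y‖ ≤ ⟪D₂.normal y, X y⟫)
    (hDX : ∀ x, ‖fderiv ℝ X x‖ ≤ 1 / 8 * Real.exp (-‖x‖)) :
    ∃ a : EuclideanSpace ℝ (Fin d), ‖a‖ ≤ 1 ∧ ∀ᵐ t : ℝ, |t| ≤ 1 → t ≠ 0 →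
      ∀ (φ : EuclideanSpace ℝ (Fin d) ≃ₜ EuclideanSpace ℝ (Fin d))
      (hφ : ContDiff ℝ (⊤ : ℕ∞) φ) (hφs : ContDiff ℝ (⊤ : ℕ∞) φ.symm),
      (∀ x, φ x = x + t • twist X a x) →
      TransverseBoundaries (D₂.image φ hφ hφs) D₁ := by
  have hc2 := fun p : frontier D₂.carrier => D₂.chart p.2
  have hc1 := fun p : frontier D₁.carrier => D₁.chart p.2
  choose U hUo hpU u hu hgu _ hnu using hc2
  choose V hVo hpV v hv hgv _ hnv using hc1
  obtain ⟨T₂, hT₂c, hT₂⟩ := TopologicalSpace.countable_cover_nhds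
    (f := fun p : frontier D₂.carrier => Subtype.val ⁻¹' U p)
    (fun p => ((hUo p).preimage continuous_subtype_val).mem_nhds (hpU p))
  obtain ⟨T₁, hT₁c, hT₁⟩ := TopologicalSpace.countable_cover_nhds
    (f := fun p : frontier D₁.carrier => Subtype.val ⁻¹' V p)
    (fun p => ((hVo p).preimage continuous_subtype_val).mem_nhds (hpV p))
  let B : Set (EuclideanSpace ℝ (Fin d) × ℝ) :=
    ⋃ p ∈ T₂, ⋃ q ∈ T₁, badSet X (U p) (u p) (V q) (v q)
  have hB : ((volume : Measure (EuclideanSpace ℝ (Fin d))).prod (volume : Measure ℝ)) B = 0 := by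
    refine (measure_biUnion_null_iff hT₂c).2 fun p _ => (measure_biUnion_null_iff hT₁c).2 fun q _ => ?_
    exact volume_badSet hX (hUo p) (hVo q) (hu p) (hv q) (hgu p)
  have hae : ∀ᵐ z ∂((volume : Measure (EuclideanSpace ℝ (Fin d))).prod (volume : Measure ℝ)),
      z ∉ B := measure_eq_zero_iff_ae_notMem.1 hB
  have hae2 := Measure.ae_ae_of_ae_prod hae
  have hne : ∃ a ∈ ball (0 : EuclideanSpace ℝ (Fin d)) 1, ∀ᵐ t : ℝ, (a, t) ∉ B := by
    by_contra hcon
    push Not at hcon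
    have h0 : volume (ball (0 : EuclideanSpace ℝ (Fin d)) 1) = 0 :=
      measure_mono_null (fun a ha => hcon a ha) hae2
    exact (measure_ball_pos volume _ one_pos).ne' h0
  obtain ⟨a, ha, hat⟩ := hne
  have ha1 : ‖a‖ ≤ 1 := (mem_ball_zero_iff.1 ha).le
  refine ⟨a, ha1, ?_⟩
  filter_upwards [hat] with t htB ht ht0 φ hφ hφs hφe
  rintro p ⟨hp2, hp1⟩
  rw [RegularDomain.frontier_image] at hp2
  obtain ⟨y, hy, rfl⟩ := hp2
  by_contra hnot
  apply htB
  have hyT : (⟨y, hy⟩ : frontier D₂.carrier) ∈ ⋃ x ∈ T₂, Subtype.val ⁻¹' U x := hT₂ ▸ mem_univ _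
  have hpT : (⟨φ y, hp1⟩ : frontier D₁.carrier) ∈ ⋃ x ∈ T₁, Subtype.val ⁻¹' V x := hT₁ ▸ mem_univ _
  simp only [mem_iUnion] at hyT hpT
  obtain ⟨p, hp, hyU⟩ := hyT
  obtain ⟨q, hq, hqV⟩ := hpT
  have hyU' : y ∈ U p := hyU
  have hqV' : φ y ∈ V q := hqV
  refine mem_biUnion hp (mem_biUnion hq ?_)
  exact bad_of_not_transverse D₁ D₂ hX hcone hDX ha1 ht ht0 φ hφ hφs hφe hy hp1 hnot hyU' hqV'
    (hgu p y hyU') (hgv q _ hqV') (hnu p y ⟨hy, hyU'⟩).1 (hnv q _ ⟨hp1, hqV'⟩).1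
    (hnu p y ⟨hy, hyU'⟩).2 (hnv q _ ⟨hp1, hqV'⟩).2

end PartP5c

section PartP6
/-- Everything we need to know about the deformation field. -/
structure GoodField {d : ℕ} (D₁ D₂ : RegularDomain d) (W : Set (EuclideanSpace ℝ (Fin d)))
    (Y : EuclideanSpace ℝ (Fin d) → EuclideanSpace ℝ (Fin d)) : Prop where
  smooth : ContDiff ℝ (⊤ : ℕ∞) Y
  le_one : ∀ x, ‖Y x‖ ≤ 1
  fderiv_le : ∀ x, ‖fderiv ℝ Y x‖ ≤ 1 / 4
  cone : ∀ y ∈ frontier D₂.carrier, Y y ≠ 0 ∧ 1 / 2 * ‖Y y‖ ≤ ⟪D₂.normal y, Y y⟫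
  stay : ∀ y ∈ frontier D₂.carrier, ∀ t : ℝ, |t| ≤ 1 → y + t • Y y ∈ W
  transverse : ∀ᵐ t : ℝ, |t| ≤ 1 → t ≠ 0 →
      ∀ (φ : EuclideanSpace ℝ (Fin d) ≃ₜ EuclideanSpace ℝ (Fin d))
      (hφ : ContDiff ℝ (⊤ : ℕ∞) φ) (hφs : ContDiff ℝ (⊤ : ℕ∞) φ.symm),
      (∀ x, φ x = x + t • Y x) → TransverseBoundaries (D₂.image φ hφ hφs) D₁

theorem exists_radius {E : Type*} [NormedAddCommGroup E] {W : Set E} (hW : IsOpen W) :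
    ∃ k : E → ℝ, Continuous k ∧ (∀ x, 0 ≤ k x) ∧ (∀ x, k x ≤ 1) ∧ (∀ x ∈ W, 0 < k x) ∧
      ∀ x ∈ W, ∀ z, ‖z - x‖ < k x → z ∈ W := by
  rcases (Wᶜ).eq_empty_or_nonempty with h | h
  · refine ⟨fun _ => 1, continuous_const, fun _ => zero_le_one, fun _ => le_rfl,
      fun _ _ => one_pos, fun _ _ z _ => ?_⟩
    rw [compl_empty_iff] at h
    rw [h]; exact mem_univ _
  · refine ⟨fun x => min (infDist x Wᶜ) 1, (continuous_infDist_pt _).min continuous_const,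
      fun x => le_min infDist_nonneg zero_le_one, fun x => min_le_right _ _, fun x hx => ?_,
      fun x hx z hz => ?_⟩
    · refine lt_min ((hW.isClosed_compl.notMem_iff_infDist_pos h).1 fun hc => hc hx) one_pos
    · by_contra hzW
      have h1 := infDist_le_dist_of_mem (x := x) (show z ∈ Wᶜ from hzW)
      have h2 := lt_of_lt_of_le hz (min_le_left _ _)
      rw [dist_comm, dist_eq_norm] at h1
      linarith

theorem exists_goodField {d : ℕ} (D₁ D₂ : RegularDomain d)
    {W : Set (EuclideanSpace ℝ (Fin d))} (hW : IsOpen W) (hDW : D₂.carrier ⊆ W) :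
    ∃ Y, GoodField D₁ D₂ W Y := by
  obtain ⟨k, hkc, hk0, hk1, hkW, hk⟩ := exists_radius hW
  have hfW : frontier D₂.carrier ⊆ W := D₂.isClosed.frontier_subset.trans hDW
  obtain ⟨X, hX, hXb, hDX, hcone⟩ := exists_field (frontier D₂.carrier) D₂.normal
    D₂.continuousOn_normal (fun y hy => D₂.norm_normal hy) W hW hfW
    (fun x => (1 / 8 * k x) * Real.exp (-‖x‖))
    ((continuous_const.mul hkc).mul (Real.continuous_exp.comp continuous_norm.neg))
    (fun x => mul_nonneg (mul_nonneg (by norm_num) (hk0 x)) (Real.exp_pos _).le)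
    (fun x hx => mul_pos (mul_pos (by norm_num) (hkW x hx)) (Real.exp_pos _))
  have hle : ∀ x : EuclideanSpace ℝ (Fin d),
      (1 / 8 * k x) * Real.exp (-‖x‖) ≤ 1 / 8 * Real.exp (-‖x‖) := by
    intro x
    have := hk1 x
    gcongr
    linarith
  obtain ⟨a, ha, hat⟩ := exists_good_param D₁ D₂ hX hcone (fun x => (hDX x).trans (hle x))
  have hYk : ∀ x, ‖twist X a x‖ ≤ 1 / 8 * k x := fun x =>
    norm_twist_le ha (hXb x) (mul_nonneg (by norm_num) (hk0 x))
  refine ⟨twist X a, contDiff_twist hX a, fun x => ?_, fun x => ?_, fun y hy => ⟨?_, ?_⟩,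
    fun y hy t ht => ?_, hat⟩
  · have := hYk x
    have := hk1 x
    linarith
  · exact norm_fderiv_twist_le hX ha ((hXb x).trans (hle x)) ((hDX x).trans (hle x))
  · exact smul_ne_zero (Real.exp_pos _).ne' (hcone y hy).1
  · have := (hcone y hy).2
    rw [twist, norm_smul, inner_smul_right, Real.norm_eq_abs, abs_of_pos (Real.exp_pos _)]
    have h2 := mul_le_mul_of_nonneg_left this (Real.exp_pos ⟪a, y⟫).le
    linarith
  · refine hk y (hfW hy) _ ?_
    rw [add_sub_cancel_left, norm_smul, Real.norm_eq_abs]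
    have h1 := hYk y
    have h2 := hkW y (hfW hy)
    nlinarith [norm_nonneg (twist X a y), abs_nonneg t]

theorem GoodField.nested {d : ℕ} {D₁ D₂ : RegularDomain d} {W : Set (EuclideanSpace ℝ (Fin d))}
    {Y : EuclideanSpace ℝ (Fin d) → EuclideanSpace ℝ (Fin d)} (h : GoodField D₁ D₂ W Y)
    {s t : ℝ} (hs : -1 ≤ s) (hst : s < t) (ht : t ≤ 1) {x y : EuclideanSpace ℝ (Fin d)}
    (hx : x ∈ D₂.carrier) (hxy : y + t • Y y = x + s • Y x) : y ∈ interior D₂.carrier := by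
  refine pert_nested D₂.isClosed h.smooth h.fderiv_le (fun y hy => ⟨(h.cone y hy).1, ?_⟩) hs hst ht
    hx hxy
  obtain ⟨U, hU, hyU, u, hu, hg, hDU, hn⟩ := D₂.chart hy
  refine ⟨U, hU, hyU, u, gradient u y, hg y hyU, hasGradientAt_of_contDiffOn hU hu hyU,
    (hn y ⟨hy, hyU⟩).1, hDU, ?_⟩
  have h2 := (h.cone y hy).2
  have hGu : 0 < ‖gradient u y‖ := norm_pos_iff.2 (hg y hyU)
  rw [(hn y ⟨hy, hyU⟩).2, inner_smul_left] at h2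
  simp only [conj_trivial] at h2
  rw [inv_mul_eq_div, le_div_iff₀ hGu] at h2
  linarith

theorem conv_all {d : ℕ} (hd : 1 ≤ d) (D₁ D₂ : RegularDomain d)
    (harea : μH[(d : ℝ) - 1] (frontier D₂.carrier) < ⊤)
    {W : Set (EuclideanSpace ℝ (Fin d))} (hW : IsOpen W) (hD₂W : D₂.carrier ⊆ W)
    (f : EuclideanSpace ℝ (Fin d) → EuclideanSpace ℝ (Fin d))
    (hf : ContinuousOn f W)
    (M : ℝ) (hM : ∀ x ∈ W, ‖f x‖ ≤ M)
    {Y : EuclideanSpace ℝ (Fin d) → EuclideanSpace ℝ (Fin d)} (h : GoodField D₁ D₂ W Y)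
    (t : ℕ → ℝ) (ht : ∀ i, |t i| ≤ 1) (ht0 : Tendsto t atTop (𝓝 0))
    (φ : ℕ → EuclideanSpace ℝ (Fin d) ≃ₜ EuclideanSpace ℝ (Fin d))
    (hφe : ∀ i x, φ i x = x + t i • Y x)
    (hφ : ∀ i, ContDiff ℝ (⊤ : ℕ∞) (φ i)) (hφs : ∀ i, ContDiff ℝ (⊤ : ℕ∞) (φ i).symm) :
    Tendsto (fun i => volume (D₂.image (φ i) (hφ i) (hφs i)).carrier) atTop
        (nhds (volume D₂.carrier)) ∧
      Tendsto (fun i => μH[(d : ℝ) - 1] (frontier (D₂.image (φ i) (hφ i) (hφs i)).carrier)) atTop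
        (nhds (μH[(d : ℝ) - 1] (frontier D₂.carrier))) ∧
      Tendsto
        (fun i => ∫ x in frontier (D₂.image (φ i) (hφ i) (hφs i)).carrier,
          ⟪f x, (D₂.image (φ i) (hφ i) (hφs i)).normal x⟫ ∂μH[(d : ℝ) - 1])
        atTop
        (nhds (∫ x in frontier D₂.carrier, ⟪f x, D₂.normal x⟫ ∂μH[(d : ℝ) - 1])) := by
  have hfW : frontier D₂.carrier ⊆ W := D₂.isClosed.frontier_subset.trans hD₂W
  let K : ℕ → NNReal := fun i => 1 + ‖t i‖₊
  have hK0 : ∀ i, 0 < K i := fun i => by positivity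
  have hK : Tendsto K atTop (𝓝 1) := by
    have h1 : Tendsto (fun i => ‖t i‖₊) atTop (𝓝 0) := by simpa using ht0.nnnorm
    simpa [K] using h1.const_add (1 : NNReal)
  have hKc : ∀ i, (K i : ℝ) = 1 + |t i| := fun i => by simp [K]
  have hdiff : ∀ i x y, ‖(φ i x - φ i y) - (x - y)‖ ≤ |t i| / 4 * ‖x - y‖ := by
    intro i x y
    have : (φ i x - φ i y) - (x - y) = t i • (Y x - Y y) := by
      rw [hφe, hφe, smul_sub]; abel
    rw [this, norm_smul, Real.norm_eq_abs]
    have := mul_le_mul_of_nonneg_left (lipschitz_of_fderiv h.smooth h.fderiv_le x y)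
      (abs_nonneg (t i))
    linarith
  have h1 : ∀ i, LipschitzWith (K i) (φ i) := by
    intro i
    refine LipschitzWith.of_dist_le_mul fun x y => ?_
    rw [dist_eq_norm, dist_eq_norm, hKc]
    have h2 := hdiff i x y
    have h3 := norm_add_le ((φ i x - φ i y) - (x - y)) (x - y)
    rw [sub_add_cancel] at h3
    nlinarith [mul_nonneg (abs_nonneg (t i)) (norm_nonneg (x - y))]
  have h2 : ∀ i, LipschitzWith (K i) (φ i).symm := by
    intro i
    refine LipschitzWith.of_dist_le_mul fun x' y' => ?_
    obtain ⟨x, rfl⟩ := (φ i).surjective x'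
    obtain ⟨y, rfl⟩ := (φ i).surjective y'
    rw [(φ i).symm_apply_apply, (φ i).symm_apply_apply, dist_eq_norm, dist_eq_norm, hKc]
    have h2 := hdiff i x y
    have h3 := norm_sub_le (φ i x - φ i y) ((φ i x - φ i y) - (x - y))
    rw [sub_sub_cancel] at h3
    have h4 : (1 - |t i| / 4) * ‖x - y‖ ≤ ‖φ i x - φ i y‖ := by linarith
    have h5 : 1 ≤ (1 + |t i|) * (1 - |t i| / 4) := by nlinarith [abs_nonneg (t i), ht i]
    calc ‖x - y‖ ≤ ((1 + |t i|) * (1 - |t i| / 4)) * ‖x - y‖ :=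
          le_mul_of_one_le_left (norm_nonneg _) h5
      _ = (1 + |t i|) * ((1 - |t i| / 4) * ‖x - y‖) := by ring
      _ ≤ _ := by gcongr
  have hs : (0 : ℝ) ≤ (d : ℝ) - 1 := by
    have : (1 : ℝ) ≤ d := by exact_mod_cast hd
    linarith
  have hfr : ∀ i, frontier (D₂.image (φ i) (hφ i) (hφs i)).carrier = φ i '' frontier D₂.carrier :=
    fun i => D₂.frontier_image (φ i) (hφ i) (hφs i)
  refine ⟨?_, ?_, ?_⟩
  · have hv := Measure.isAddLeftInvariant_eq_smul (volume : Measure (EuclideanSpace ℝ (Fin d)))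
      (μH[Module.finrank ℝ (EuclideanSpace ℝ (Fin d))] : Measure (EuclideanSpace ℝ (Fin d)))
    have h3 := tendsto_hausdorff_image φ K hK h1 h2
      (s := (Module.finrank ℝ (EuclideanSpace ℝ (Fin d)) : ℝ)) (Nat.cast_nonneg _) D₂.carrier
    rw [hv]
    simp only [Measure.smul_apply]
    exact ENNReal.Tendsto.const_mul h3 (Or.inr ENNReal.coe_ne_top)
  · simp only [hfr]
    exact tendsto_hausdorff_image φ K hK h1 h2 hs _
  · simp only [hfr]
    have hφS : ∀ i, ∀ y ∈ frontier D₂.carrier, φ i y ∈ W := fun i y hy => by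
      rw [hφe]; exact h.stay y hy _ (ht i)
    have hφF : ∀ i, ∀ y ∈ frontier D₂.carrier,
        φ i y ∈ frontier (D₂.image (φ i) (hφ i) (hφs i)).carrier := fun i y hy => by
      rw [hfr]; exact mem_image_of_mem _ hy
    refine tendsto_surface_integral φ K hK0 hK h1 h2 hs (frontier D₂.carrier) isClosed_frontier harea
      (fun i x => ⟪f x, (D₂.image (φ i) (hφ i) (hφs i)).normal x⟫)
      (fun x => ⟪f x, D₂.normal x⟫) M ?_ ?_ ?_
    · intro i
      refine ContinuousOn.aestronglyMeasurable ?_ isClosed_frontier.measurableSet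
      have c1 : ContinuousOn (fun x => f (φ i x)) (frontier D₂.carrier) :=
        hf.comp (φ i).continuous.continuousOn (hφS i)
      have c2 : ContinuousOn (fun x => (D₂.image (φ i) (hφ i) (hφs i)).normal (φ i x))
          (frontier D₂.carrier) :=
        (D₂.image (φ i) (hφ i) (hφs i)).continuousOn_normal.comp (φ i).continuous.continuousOn (hφF i)
      exact c1.inner c2
    · intro i x hx
      refine (norm_inner_le_norm _ _).trans ?_
      rw [(D₂.image (φ i) (hφ i) (hφs i)).norm_normal (hφF i x hx), mul_one]
      exact hM _ (hφS i x hx)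
    · intro y hy
      have hn1 := D₂.norm_normal hy
      have hφy : Tendsto (fun i => φ i y) atTop (𝓝 y) := by
        simp only [hφe]
        simpa using tendsto_const_nhds.add (ht0.smul_const (Y y))
      have hfy : Tendsto (fun i => f (φ i y)) atTop (𝓝 (f y)) :=
        ((hf.continuousAt (hW.mem_nhds (hfW hy))).tendsto).comp hφy
      refine Tendsto.inner hfy ?_
      have hbd : ∀ i, ‖pushNormal D₂ (φ i) (φ i y) - D₂.normal y‖ ≤ |t i| := by
        intro i
        have hadj := adjoint_pushNormal D₂ (φ i) (hφ i) (hφs i) y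
        set w := pushNormal D₂ (φ i) (φ i y)
        have hfd : fderiv ℝ (φ i) y = ContinuousLinearMap.id ℝ _ + t i • fderiv ℝ Y y := by
          have : (φ i : EuclideanSpace ℝ (Fin d) → EuclideanSpace ℝ (Fin d))
            = fun x => x + t i • Y x := funext (hφe i)
          rw [this]
          have h1 : HasFDerivAt Y (fderiv ℝ Y y) y :=
            (h.smooth.differentiable (by simp) y).hasFDerivAt
          exact ((hasFDerivAt_id y).add (h1.const_smul (t i))).fderiv
        have hid : ContinuousLinearMap.adjoint (ContinuousLinearMap.id ℝ (EuclideanSpace ℝ (Fin d)))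
            w = w :=
          ext_inner_right ℝ fun h => by
            rw [ContinuousLinearMap.adjoint_inner_left, ContinuousLinearMap.id_apply]
        rw [hfd, map_add, map_smulₛₗ, add_apply, smul_apply, hid] at hadj
        simp only [conj_trivial] at hadj
        have hb1 : ‖t i • ContinuousLinearMap.adjoint (fderiv ℝ Y y) w‖ ≤ |t i| / 4 * ‖w‖ := by
          rw [norm_smul, Real.norm_eq_abs]
          have := (ContinuousLinearMap.adjoint (fderiv ℝ Y y)).le_opNorm w
          rw [LinearIsometryEquiv.norm_map] at this
          have h3 : ‖ContinuousLinearMap.adjoint (fderiv ℝ Y y) w‖ ≤ 1 / 4 * ‖w‖ :=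
            this.trans (mul_le_mul_of_nonneg_right (h.fderiv_le y) (norm_nonneg _))
          have := mul_le_mul_of_nonneg_left h3 (abs_nonneg (t i))
          linarith
        have hwn : w - D₂.normal y = -(t i • ContinuousLinearMap.adjoint (fderiv ℝ Y y) w) := by
          rw [← hadj]; abel
        have hw2 : ‖w‖ ≤ 2 := by
          have h3 := norm_add_le (w - D₂.normal y) (D₂.normal y)
          rw [sub_add_cancel, hwn, norm_neg, hn1] at h3
          have h4 := mul_le_mul_of_nonneg_right (ht i) (norm_nonneg w)
          nlinarith
        rw [hwn, norm_neg]
        nlinarith [abs_nonneg (t i)]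
      have hw : Tendsto (fun i => pushNormal D₂ (φ i) (φ i y)) atTop (𝓝 (D₂.normal y)) := by
        rw [tendsto_iff_norm_sub_tendsto_zero]
        refine squeeze_zero (fun _ => norm_nonneg _) hbd ?_
        simpa using ht0.abs
      have h3 : Tendsto (fun i => ‖pushNormal D₂ (φ i) (φ i y)‖⁻¹ • pushNormal D₂ (φ i) (φ i y)) atTop
          (𝓝 (‖D₂.normal y‖⁻¹ • D₂.normal y)) :=
        (hw.norm.inv₀ (by rw [hn1]; exact one_ne_zero)).smul hw
      rw [hn1, inv_one, one_smul] at h3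
      exact h3

end PartP6

section PartP7
theorem exists_mem_Ioo_of_ae {p : ℝ → Prop} (h : ∀ᵐ t : ℝ, p t) {a b : ℝ} (hab : a < b) :
    ∃ t ∈ Ioo a b, p t := by
  by_contra hcon
  push Not at hcon
  have h0 : volume (Ioo a b) = 0 := measure_mono_null (fun t ht => hcon t ht) h
  rw [Real.volume_Ioo, ENNReal.ofReal_eq_zero] at h0
  linarith

theorem GoodField.exists_family {d : ℕ} {D₁ D₂ : RegularDomain d}
    {W : Set (EuclideanSpace ℝ (Fin d))}
    {Y : EuclideanSpace ℝ (Fin d) → EuclideanSpace ℝ (Fin d)} (h : GoodField D₁ D₂ W Y)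
    (t : ℕ → ℝ) (ht : ∀ i, |t i| ≤ 1) :
    ∃ φ : ℕ → EuclideanSpace ℝ (Fin d) ≃ₜ EuclideanSpace ℝ (Fin d),
      (∀ i x, φ i x = x + t i • Y x) ∧ (∀ i, ContDiff ℝ (⊤ : ℕ∞) (φ i)) ∧
      ∀ i, ContDiff ℝ (⊤ : ℕ∞) (φ i).symm := by
  choose φ h1 h2 h3 using fun i => exists_pert_homeo h.smooth h.fderiv_le (ht i)
  exact ⟨φ, h1, h2, h3⟩

theorem approximation_pos {d : ℕ} (hd : 1 ≤ d) (D₁ D₂ : RegularDomain d)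
    (harea : μH[(d : ℝ) - 1] (frontier D₂.carrier) < ⊤)
    (W : Set (EuclideanSpace ℝ (Fin d))) (hW : IsOpen W) (hD₂W : D₂.carrier ⊆ W)
    (f : EuclideanSpace ℝ (Fin d) → EuclideanSpace ℝ (Fin d))
    (hf : ContDiffOn ℝ (⊤ : ℕ∞) f W)
    (M : ℝ) (hM : ∀ x ∈ W, ‖f x‖ ≤ M) :
    (∃ D2i : ℕ → RegularDomain d,
      (∀ i, TransverseBoundaries (D2i i) D₁) ∧
      Filter.Tendsto (fun i => volume (D2i i).carrier) Filter.atTop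
        (nhds (volume D₂.carrier)) ∧
      Filter.Tendsto (fun i => μH[(d : ℝ) - 1] (frontier (D2i i).carrier)) Filter.atTop
        (nhds (μH[(d : ℝ) - 1] (frontier D₂.carrier))) ∧
      Filter.Tendsto
        (fun i => ∫ x in frontier (D2i i).carrier, ⟪f x, (D2i i).normal x⟫ ∂μH[(d : ℝ) - 1])
        Filter.atTop
        (nhds (∫ x in frontier D₂.carrier, ⟪f x, D₂.normal x⟫ ∂μH[(d : ℝ) - 1])) ∧
      Antitone (fun i => (D2i i).carrier) ∧ (⋂ i, (D2i i).carrier) = D₂.carrier) ∧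
    (∃ D2i : ℕ → RegularDomain d,
      (∀ i, TransverseBoundaries (D2i i) D₁) ∧
      Filter.Tendsto (fun i => volume (D2i i).carrier) Filter.atTop
        (nhds (volume D₂.carrier)) ∧
      Filter.Tendsto (fun i => μH[(d : ℝ) - 1] (frontier (D2i i).carrier)) Filter.atTop
        (nhds (μH[(d : ℝ) - 1] (frontier D₂.carrier))) ∧
      Filter.Tendsto
        (fun i => ∫ x in frontier (D2i i).carrier, ⟪f x, (D2i i).normal x⟫ ∂μH[(d : ℝ) - 1])
        Filter.atTop
        (nhds (∫ x in frontier D₂.carrier, ⟪f x, D₂.normal x⟫ ∂μH[(d : ℝ) - 1])) ∧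
      Monotone (fun i => (D2i i).carrier) ∧ (⋃ i, (D2i i).carrier) = interior D₂.carrier) := by
  obtain ⟨Y, hY⟩ := exists_goodField D₁ D₂ hW hD₂W
  have hlim : Tendsto (fun i : ℕ => 1 / ((i : ℝ) + 1)) atTop (𝓝 0) :=
    tendsto_one_div_add_atTop_nhds_zero_nat
  have hpos2 : ∀ i : ℕ, 0 < 1 / ((i : ℝ) + 2) := fun i => by positivity
  have hle1 : ∀ i : ℕ, 1 / ((i : ℝ) + 1) ≤ 1 := fun i => by
    rw [div_le_one (by positivity)]
    have : (0 : ℝ) ≤ i := Nat.cast_nonneg i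
    linarith
  have hlt : ∀ i : ℕ, 1 / ((i : ℝ) + 2) < 1 / ((i : ℝ) + 1) := fun i => by
    apply one_div_lt_one_div_of_lt
    · positivity
    · linarith
  have hsucc : ∀ i : ℕ, 1 / (((i + 1 : ℕ) : ℝ) + 1) = 1 / ((i : ℝ) + 2) := fun i => by
    push_cast; congr 1; ring
  constructor
  · choose t htI htg using fun i : ℕ => exists_mem_Ioo_of_ae hY.transverse (hlt i)
    have htp : ∀ i, 0 < t i := fun i => (hpos2 i).trans (htI i).1
    have hta : ∀ i, |t i| ≤ 1 := fun i => by
      rw [abs_of_pos (htp i)]; exact (htI i).2.le.trans (hle1 i)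
    have ht0 : Tendsto t atTop (𝓝 0) :=
      squeeze_zero (fun i => (htp i).le) (fun i => (htI i).2.le) hlim
    have hts : ∀ i, t (i + 1) < t i := fun i => by
      have := (htI (i + 1)).2
      rw [hsucc] at this
      exact this.trans (htI i).1
    obtain ⟨φ, hφe, hφ, hφs⟩ := hY.exists_family t hta
    obtain ⟨c1, c2, c3⟩ := conv_all hd D₁ D₂ harea hW hD₂W f hf.continuousOn M hM hY t hta ht0 φ hφe
      hφ hφs
    refine ⟨fun i => D₂.image (φ i) (hφ i) (hφs i),
      fun i => htg i (hta i) (htp i).ne' (φ i) (hφ i) (hφs i) (hφe i), c1, c2, c3, ?_, ?_⟩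
    · refine antitone_nat_of_succ_le fun i => ?_
      rintro _ ⟨x, hx, rfl⟩
      refine ⟨(φ i).symm (φ (i + 1) x), ?_, (φ i).apply_symm_apply _⟩
      refine interior_subset (hY.nested (s := t (i + 1)) (t := t i) (x := x)
        (by linarith [htp (i + 1)]) (hts i) (le_of_abs_le (hta i)) hx ?_)
      rw [← hφe, ← hφe, (φ i).apply_symm_apply]
    · refine Subset.antisymm (fun x hx => ?_) (subset_iInter fun i x hx => ?_)
      · rw [mem_iInter] at hx
        choose y hy hyx using hx
        refine D₂.isClosed.mem_of_tendsto (f := y) (b := atTop) ?_ (Eventually.of_forall hy)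
        rw [tendsto_iff_norm_sub_tendsto_zero]
        refine squeeze_zero (fun _ => norm_nonneg _) (fun i => ?_) ht0
        rw [← hyx i, hφe, sub_add_cancel_left, norm_neg, norm_smul, Real.norm_eq_abs,
          abs_of_pos (htp i)]
        exact mul_le_of_le_one_right (htp i).le (hY.le_one _)
      · refine ⟨(φ i).symm x, ?_, (φ i).apply_symm_apply _⟩
        refine interior_subset (hY.nested (s := 0) (t := t i) (x := x)
          (by norm_num) (htp i) (le_of_abs_le (hta i)) hx ?_)
        rw [← hφe, (φ i).apply_symm_apply, zero_smul, add_zero]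
  · choose t htI htg using fun i : ℕ => exists_mem_Ioo_of_ae hY.transverse (neg_lt_neg (hlt i))
    have htp : ∀ i, t i < 0 := fun i => (htI i).2.trans (neg_neg_of_pos (hpos2 i))
    have htb : ∀ i, |t i| ≤ 1 / ((i : ℝ) + 1) := fun i => by
      rw [abs_of_neg (htp i)]
      linarith [(htI i).1]
    have hta : ∀ i, |t i| ≤ 1 := fun i => (htb i).trans (hle1 i)
    have ht0 : Tendsto t atTop (𝓝 0) :=
      squeeze_zero_norm (fun i => by rw [Real.norm_eq_abs]; exact htb i) hlim
    have hts : ∀ i, t i < t (i + 1) := fun i => by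
      have := (htI (i + 1)).1
      rw [hsucc] at this
      exact (htI i).2.trans this
    obtain ⟨φ, hφe, hφ, hφs⟩ := hY.exists_family t hta
    obtain ⟨c1, c2, c3⟩ := conv_all hd D₁ D₂ harea hW hD₂W f hf.continuousOn M hM hY t hta ht0 φ hφe
      hφ hφs
    refine ⟨fun i => D₂.image (φ i) (hφ i) (hφs i),
      fun i => htg i (hta i) (htp i).ne (φ i) (hφ i) (hφs i) (hφe i), c1, c2, c3, ?_, ?_⟩
    · refine monotone_nat_of_le_succ fun i => ?_
      rintro _ ⟨x, hx, rfl⟩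
      refine ⟨(φ (i + 1)).symm (φ i x), ?_, (φ (i + 1)).apply_symm_apply _⟩
      refine interior_subset (hY.nested (s := t i) (t := t (i + 1)) (x := x)
        (neg_le_of_abs_le (hta i)) (hts i) (le_of_abs_le (hta _)) hx ?_)
      rw [← hφe, ← hφe, (φ (i + 1)).apply_symm_apply]
    · refine Subset.antisymm (iUnion_subset fun i => ?_) (fun x hx => ?_)
      · rintro _ ⟨x, hx, rfl⟩
        refine hY.nested (s := t i) (t := 0) (x := x) (neg_le_of_abs_le (hta i)) (htp i)
          zero_le_one hx ?_
        rw [← hφe, zero_smul, add_zero]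
      · have hlimx : Tendsto (fun i => (φ i).symm x) atTop (𝓝 x) := by
          rw [tendsto_iff_norm_sub_tendsto_zero]
          refine squeeze_zero (fun _ => norm_nonneg _) (fun i => ?_)
            (by simpa using ht0.abs : Tendsto (fun i => |t i|) atTop (𝓝 0))
          have h1 := hφe i ((φ i).symm x)
          rw [(φ i).apply_symm_apply] at h1
          have h2 : (φ i).symm x - x = -(t i • Y ((φ i).symm x)) := by
            generalize (φ i).symm x = z at h1 ⊢
            rw [h1]
            simp
          rw [h2, norm_neg, norm_smul, Real.norm_eq_abs]
          exact mul_le_of_le_one_right (abs_nonneg _) (hY.le_one _)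
        obtain ⟨i, hi⟩ := (hlimx.eventually (isOpen_interior.mem_nhds hx)).exists
        exact mem_iUnion.2 ⟨i, (φ i).symm x, interior_subset hi, (φ i).apply_symm_apply _⟩

theorem approximation_zero (D₁ D₂ : RegularDomain 0) :
    TransverseBoundaries D₂ D₁ ∧ interior D₂.carrier = D₂.carrier := by
  have h : interior D₂.carrier = D₂.carrier := (isOpen_discrete _).interior_eq
  refine ⟨?_, h⟩
  rintro p ⟨hp, _⟩
  exact absurd (h.symm.subset (D₂.isClosed.frontier_subset hp)) hp.2

end PartP7

/-- **Approximation proposition.**  Let `D₁, D₂ ⊆ ℝ^d` be regular domains with `D₁ ∩ D₂`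
compact and `D₂` of finite volume and surface area, and let `f` be a smooth bounded vector
field on a neighborhood `W` of `D₂`.  Then there is a sequence of regular domains `D_{2,i}`
with boundaries transverse to `∂D₁` such that `Vol(D_{2,i}) → Vol(D₂)`,
`Area(∂D_{2,i}) → Area(∂D₂)` and `∫_{∂D_{2,i}} f·n dA → ∫_{∂D₂} f·n dA`; moreover the
sequence can be chosen decreasing with intersection `D₂`, or increasing with union the
interior of `D₂`. -/
theorem approximation_transverse (d : ℕ) (D₁ D₂ : RegularDomain d)
    (hcompact : IsCompact (D₁.carrier ∩ D₂.carrier))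
    (hvol : volume D₂.carrier < ⊤)
    (harea : μH[(d : ℝ) - 1] (frontier D₂.carrier) < ⊤)
    (W : Set (EuclideanSpace ℝ (Fin d))) (hW : IsOpen W) (hD₂W : D₂.carrier ⊆ W)
    (f : EuclideanSpace ℝ (Fin d) → EuclideanSpace ℝ (Fin d))
    (hf : ContDiffOn ℝ (⊤ : ℕ∞) f W)
    (M : ℝ) (hM : ∀ x ∈ W, ‖f x‖ ≤ M) :
    (∃ D2i : ℕ → RegularDomain d,
      (∀ i, TransverseBoundaries (D2i i) D₁) ∧
      Filter.Tendsto (fun i => volume (D2i i).carrier) Filter.atTop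
        (nhds (volume D₂.carrier)) ∧
      Filter.Tendsto (fun i => μH[(d : ℝ) - 1] (frontier (D2i i).carrier)) Filter.atTop
        (nhds (μH[(d : ℝ) - 1] (frontier D₂.carrier))) ∧
      Filter.Tendsto
        (fun i => ∫ x in frontier (D2i i).carrier, ⟪f x, (D2i i).normal x⟫ ∂μH[(d : ℝ) - 1])
        Filter.atTop
        (nhds (∫ x in frontier D₂.carrier, ⟪f x, D₂.normal x⟫ ∂μH[(d : ℝ) - 1])) ∧
      Antitone (fun i => (D2i i).carrier) ∧ (⋂ i, (D2i i).carrier) = D₂.carrier) ∧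
    (∃ D2i : ℕ → RegularDomain d,
      (∀ i, TransverseBoundaries (D2i i) D₁) ∧
      Filter.Tendsto (fun i => volume (D2i i).carrier) Filter.atTop
        (nhds (volume D₂.carrier)) ∧
      Filter.Tendsto (fun i => μH[(d : ℝ) - 1] (frontier (D2i i).carrier)) Filter.atTop
        (nhds (μH[(d : ℝ) - 1] (frontier D₂.carrier))) ∧
      Filter.Tendsto
        (fun i => ∫ x in frontier (D2i i).carrier, ⟪f x, (D2i i).normal x⟫ ∂μH[(d : ℝ) - 1])
        Filter.atTop
        (nhds (∫ x in frontier D₂.carrier, ⟪f x, D₂.normal x⟫ ∂μH[(d : ℝ) - 1])) ∧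
      Monotone (fun i => (D2i i).carrier) ∧ (⋃ i, (D2i i).carrier) = interior D₂.carrier) := by
  rcases Nat.eq_zero_or_pos d with rfl | hd
  · obtain ⟨h1, h2⟩ := approximation_zero D₁ D₂
    refine ⟨⟨fun _ => D₂, fun _ => h1, tendsto_const_nhds, tendsto_const_nhds,
      tendsto_const_nhds, antitone_const, iInter_const _⟩, ⟨fun _ => D₂, fun _ => h1,
      tendsto_const_nhds, tendsto_const_nhds, tendsto_const_nhds, monotone_const, ?_⟩⟩
    rw [h2]; exact iUnion_const _
  · exact approximation_pos hd D₁ D₂ harea W hW hD₂W f hf M hM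

end
end

section
/- Let (Dᵢ)_{i≥1} be a sequence of compact regular domains in ℝ^d with Area(∂Dᵢ) → ∞, and let μᵢ ∈ P(ℝ^d × S^{d−1}) be the empirical measure of ∂Dᵢ. Suppose the μᵢ converge weakly to a probability measure μ₀, and let μ₀(dx, dn) = p₀(dx) μ₀^x(dn) be the disintegration of μ₀ with respect to its marginal p₀ on ℝ^d. Then for p₀-almost every x, the barycenter h(x) = ∫_{S^{d−1}} n μ₀^x(dn) equals 0. -/
open MeasureTheory Metric Set Filter
open scoped RealInnerProductSpace ENNReal Topology

noncomputable section

open ProbabilityTheory in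
/-- The *empirical measure* of the boundary hypersurface `∂D` of a regular domain `D ⊆ ℝ^d`
(with its outward unit normal field `n`): the probability measure on `ℝ^d × ℝ^d` (supported on
`ℝ^d × S^{d-1}`) given by `μ(U × V) = (1/Area(∂D)) ∫_{∂D ∩ U} χ_V(n(x)) dA(x)`, i.e. the
normalized pushforward of the surface measure on `∂D` under `x ↦ (x, n(x))`. -/
def empiricalMeasure {d : ℕ} (D : RegularDomain d) :
    Measure (EuclideanSpace ℝ (Fin d) × EuclideanSpace ℝ (Fin d)) :=
  (μH[(d : ℝ) - 1] (frontier D.carrier))⁻¹ •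
    Measure.map (fun x => (x, D.normal x))
      ((μH[(d : ℝ) - 1] : Measure (EuclideanSpace ℝ (Fin d))).restrict (frontier D.carrier))

/-- Linear coordinates adapted to a hyperplane `e^⊥` and a transversal direction `w`. -/
lemma bv_coords (m : ℕ) : ∃ C : NNReal, ∀ e w : EuclideanSpace ℝ (Fin (m+1)), ‖e‖ = 1 →
    0 < ⟪e, w⟫ →
    ∃ M : (EuclideanSpace ℝ (Fin m) × ℝ) ≃L[ℝ] EuclideanSpace ℝ (Fin (m+1)),
      (∀ y, ‖M (y, 0)‖ = ‖y‖) ∧ (∀ y t, M (y, t) = M (y, 0) + t • w) ∧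
      (∀ y, ⟪e, M (y, 0)⟫ = 0) ∧
      Measure.map M ((μH[(m : ℝ)] : Measure (EuclideanSpace ℝ (Fin m))).prod volume) =
        ENNReal.ofReal (C * ⟪e, w⟫⁻¹) • (volume : Measure (EuclideanSpace ℝ (Fin (m+1)))) := by
  have hH : Measure.IsAddHaarMeasure (μH[(m : ℝ)] : Measure (EuclideanSpace ℝ (Fin m))) := by
    have := isAddHaarMeasure_hausdorffMeasure (E := EuclideanSpace ℝ (Fin m))
    simpa using this
  have hC := Measure.isAddLeftInvariant_eq_smul
    (μH[(m : ℝ)] : Measure (EuclideanSpace ℝ (Fin m))) volume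
  set C := Measure.addHaarScalarFactor (μH[(m : ℝ)] : Measure (EuclideanSpace ℝ (Fin m))) volume
  refine ⟨C, fun e w he hw => ?_⟩
  have he0 : e ≠ 0 := by rintro rfl; simp at he
  have hfact : Fact (Module.finrank ℝ (EuclideanSpace ℝ (Fin (m+1))) = m + 1) := ⟨by simp⟩
  let T : EuclideanSpace ℝ (Fin m) →ₗᵢ[ℝ] EuclideanSpace ℝ (Fin (m+1)) :=
    (Submodule.orthogonal (ℝ ∙ e)).subtypeₗᵢ.comp
      (OrthonormalBasis.fromOrthogonalSpanSingleton (𝕜 := ℝ) m he0).repr.symm.toLinearIsometry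
  have hTe : ∀ y, ⟪e, T y⟫ = 0 := by
    intro y
    have := ((OrthonormalBasis.fromOrthogonalSpanSingleton (𝕜 := ℝ) m he0).repr.symm y).2
    rw [Submodule.mem_orthogonal_singleton_iff_inner_right] at this
    exact this
  let Φ₀ : WithLp 2 (EuclideanSpace ℝ (Fin m) × ℝ) →ₗ[ℝ] EuclideanSpace ℝ (Fin (m+1)) :=
    { toFun := fun z => T z.fst + z.snd • e
      map_add' := by intro a b; simp [add_smul]; abel
      map_smul' := by intro a b; simp [smul_smul] }
  let Φ₁ : WithLp 2 (EuclideanSpace ℝ (Fin m) × ℝ) →ₗᵢ[ℝ] EuclideanSpace ℝ (Fin (m+1)) :=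
    { Φ₀ with
      norm_map' := by
        intro z
        have h1 : ‖T z.fst + z.snd • e‖ ^ 2 = ‖z‖ ^ 2 := by
          rw [norm_add_sq_real, WithLp.prod_norm_sq_eq_of_L2, inner_smul_right, real_inner_comm,
            hTe, norm_smul, he, T.norm_map]
          simp
        exact (sq_eq_sq₀ (norm_nonneg _) (norm_nonneg _)).1 h1 }
  have hfr : Module.finrank ℝ (WithLp 2 (EuclideanSpace ℝ (Fin m) × ℝ)) =
      Module.finrank ℝ (EuclideanSpace ℝ (Fin (m+1))) := by
    rw [(WithLp.linearEquiv 2 ℝ (EuclideanSpace ℝ (Fin m) × ℝ)).finrank_eq]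
    simp
  let Φ := Φ₁.toLinearIsometryEquiv hfr
  let A₀ : EuclideanSpace ℝ (Fin (m+1)) →ₗ[ℝ] EuclideanSpace ℝ (Fin (m+1)) :=
    LinearMap.transvection (innerₛₗ ℝ e) (w - e)
  have hA : LinearMap.det A₀ = ⟪e, w⟫ := by
    simp only [A₀]
    rw [LinearMap.transvection.det]
    simp [inner_sub_right, he]
  have hA0 : LinearMap.det A₀ ≠ 0 := by rw [hA]; exact hw.ne'
  let A := (LinearMap.equivOfDetNeZero A₀ hA0).toContinuousLinearEquiv
  let M : (EuclideanSpace ℝ (Fin m) × ℝ) ≃L[ℝ] EuclideanSpace ℝ (Fin (m+1)) :=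
    ((WithLp.prodContinuousLinearEquiv 2 ℝ (EuclideanSpace ℝ (Fin m)) ℝ).symm.trans
      Φ.toContinuousLinearEquiv).trans A
  have hM : ∀ y t, M (y, t) = T y + t • w := by
    intro y t
    have : M (y, t) = A₀ (T y + t • e) := rfl
    rw [this]
    simp only [A₀, LinearMap.transvection.apply, innerₛₗ_apply_apply, inner_add_right, hTe,
      inner_smul_right, real_inner_self_eq_norm_sq, he]
    module
  have hM0 : ∀ y, M (y, 0) = T y := by intro y; simp [hM]
  refine ⟨M, ?_, ?_, ?_, ?_⟩
  · intro y; rw [hM0, T.norm_map]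
  · intro y t; rw [hM0, hM]
  · intro y; rw [hM0, hTe]
  · have h1 : Measure.map M
        ((volume : Measure (EuclideanSpace ℝ (Fin m))).prod (volume : Measure ℝ)) =
        ENNReal.ofReal (⟪e, w⟫⁻¹) • volume := by
      have h2 := (Φ.measurePreserving).comp (WithLp.volume_preserving_toLp (EuclideanSpace ℝ (Fin m)) ℝ)
      have h3 := Measure.map_linearMap_addHaar_eq_smul_addHaar
        (volume : Measure (EuclideanSpace ℝ (Fin (m+1)))) hA0
      rw [hA, abs_of_pos (inv_pos.2 hw), ← h2.map_eq, Measure.map_map ?_ h2.measurable] at h3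
      · rw [h2.map_eq] at h3
        exact h3
      · exact A.continuous.measurable
    rw [hC, Measure.prod_smul_left, Measure.map_smul, h1, ENNReal.ofReal_mul (NNReal.coe_nonneg C)]
    rw [← smul_smul]
    rw [ENNReal.ofReal_coe_nnreal]
    rfl

lemma bv_frontier_iff {d : ℕ} (D : RegularDomain d) {U : Set (EuclideanSpace ℝ (Fin d))}
    (hU : IsOpen U) {u : EuclideanSpace ℝ (Fin d) → ℝ} (hu : ContDiffOn ℝ (⊤ : ℕ∞) u U)
    (hg : ∀ x ∈ U, gradient u x ≠ 0) (hD : D.carrier ∩ U = {x ∈ U | u x ≤ 0})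
    {x : EuclideanSpace ℝ (Fin d)} (hx : x ∈ U) : x ∈ frontier D.carrier ↔ u x = 0 := by
  have hmem : ∀ y ∈ U, (y ∈ D.carrier ↔ u y ≤ 0) := by
    intro y hy
    have : y ∈ D.carrier ∩ U ↔ y ∈ {x ∈ U | u x ≤ 0} := by rw [hD]
    simpa [hy] using this
  have hc : ContinuousAt u x := hu.continuousOn.continuousAt (hU.mem_nhds hx)
  rw [D.isClosed.frontier_eq, Set.mem_sdiff, hmem x hx]
  constructor
  · rintro ⟨h1, h2⟩
    by_contra h3
    have h4 : u x < 0 := lt_of_le_of_ne h1 h3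
    apply h2
    rw [mem_interior_iff_mem_nhds]
    filter_upwards [hc.eventually_lt_const h4, hU.mem_nhds hx] with y hy hyU
    exact (hmem y hyU).2 hy.le
  · intro h
    refine ⟨h.le, fun h2 => hg x hx ?_⟩
    rw [mem_interior_iff_mem_nhds] at h2
    have hmax : IsLocalMax u x := by
      filter_upwards [h2, hU.mem_nhds hx] with y hy hyU
      rw [h]; exact (hmem y hyU).1 hy
    simp [gradient, hmax.fderiv_eq_zero]

lemma bv_normal {d : ℕ} (D : RegularDomain d) :
    ContinuousOn D.normal (frontier D.carrier) ∧ ∀ x ∈ frontier D.carrier, ‖D.normal x‖ = 1 := by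
  refine ⟨fun p hp => ?_, fun p hp => ?_⟩
  · obtain ⟨U, hU, hpU, u, hu, hg, hD, hn⟩ := D.regular p hp
    have h1 : ContinuousAt (gradient u) p := by
      have : ContinuousAt (fderiv ℝ u) p :=
        (hu.continuousOn_fderiv_of_isOpen hU (by simp)).continuousAt (hU.mem_nhds hpU)
      exact (LinearIsometryEquiv.continuous _).continuousAt.comp this
    have h2 : ContinuousAt (fun x => ‖gradient u x‖⁻¹ • gradient u x) p :=
      (h1.norm.inv₀ (norm_ne_zero_iff.2 (hg p hpU))).smul h1
    refine h2.continuousWithinAt.congr_of_eventuallyEq ?_ (hn p ⟨hp, hpU⟩)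
    filter_upwards [self_mem_nhdsWithin, mem_nhdsWithin_of_mem_nhds (hU.mem_nhds hpU)] with x hx hxU
    exact hn x ⟨hx, hxU⟩
  · obtain ⟨U, hU, hpU, u, hu, hg, hD, hn⟩ := D.regular p hp
    rw [hn p ⟨hp, hpU⟩, norm_smul, norm_inv, norm_norm]
    exact inv_mul_cancel₀ (norm_ne_zero_iff.2 (hg p hpU))

/-- Local geometry near a boundary point. -/
lemma bv_local {d : ℕ} (D : RegularDomain d) {p w : EuclideanSpace ℝ (Fin d)}
    (hp : p ∈ frontier D.carrier) (hw : 0 < ⟪D.normal p, w⟫) {δ : ℝ} (hδ : 0 < δ) :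
    ∃ r > 0, ∃ u : EuclideanSpace ℝ (Fin d) → ℝ,
      ContinuousOn u (closedBall p r) ∧
      (∀ x ∈ closedBall p r, (x ∈ D.carrier ↔ u x ≤ 0)) ∧
      (∀ x ∈ closedBall p r, (x ∈ frontier D.carrier ↔ u x = 0)) ∧
      (∀ x ∈ closedBall p r, ∀ s : ℝ, 0 < s → x + s • w ∈ closedBall p r → u x < u (x + s • w)) ∧
      (∀ x ∈ frontier D.carrier ∩ closedBall p r, ∀ x' ∈ frontier D.carrier ∩ closedBall p r,
        |⟪D.normal p, x - x'⟫| ≤ δ * ‖x - x'‖) ∧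
      (∀ x ∈ frontier D.carrier ∩ closedBall p r, ‖D.normal x - D.normal p‖ ≤ δ) := by
  obtain ⟨U, hU, hpU, u, hu, hg, hD, hn⟩ := D.regular p hp
  have hgp : 0 < ‖gradient u p‖ := norm_pos_iff.2 (hg p hpU)
  set g := gradient u p with hgdef
  have hnp : D.normal p = ‖g‖⁻¹ • g := hn p ⟨hp, hpU⟩
  have hge : g = ‖g‖ • D.normal p := by
    rw [hnp, smul_smul, mul_inv_cancel₀ hgp.ne', one_smul]
  have hin : ∀ v, ⟪g, v⟫ = ‖g‖ * ⟪D.normal p, v⟫ := by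
    intro v
    conv_lhs => rw [hge, real_inner_smul_left]
  have hmem : ∀ y ∈ U, (y ∈ D.carrier ↔ u y ≤ 0) := by
    intro y hy
    have : y ∈ D.carrier ∩ U ↔ y ∈ {x ∈ U | u x ≤ 0} := by rw [hD]
    simpa [hy] using this
  have hw0 : 0 < ‖w‖ := by
    rw [norm_pos_iff]; rintro rfl; simp at hw
  have hs : HasStrictFDerivAt u (fderiv ℝ u p) p :=
    (hu.contDiffAt (hU.mem_nhds hpU)).hasStrictFDerivAt (by simp)
  have hfd : ∀ v, fderiv ℝ u p v = ⟪g, v⟫ := by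
    intro v
    rw [hgdef, gradient, InnerProductSpace.toDual_symm_apply]
  let c : ℝ := min (δ * ‖g‖) (‖g‖ * ⟪D.normal p, w⟫ / (2 * ‖w‖))
  have hc : 0 < c := by positivity
  obtain ⟨V, hV, hVa⟩ := hs.approximates_deriv_on_nhds (c := ⟨c, hc.le⟩) (Or.inr hc)
  have hcn := (bv_normal D).1 p hp
  have hev : ∀ᶠ x in 𝓝 p, x ∈ V ∧ x ∈ U ∧ (x ∈ frontier D.carrier → ‖D.normal x - D.normal p‖ ≤ δ) := by
    have h3 : ∀ᶠ x in 𝓝[frontier D.carrier] p, dist (D.normal x) (D.normal p) ≤ δ := by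
      filter_upwards [hcn.eventually (Metric.ball_mem_nhds _ hδ)] with x hx
      exact le_of_lt hx
    rw [eventually_nhdsWithin_iff] at h3
    filter_upwards [hV, hU.mem_nhds hpU, h3] with x h1 h2 h3
    exact ⟨h1, h2, fun h => by rw [← dist_eq_norm]; exact h3 h⟩
  obtain ⟨r, hr, hrB⟩ := Metric.nhds_basis_closedBall.eventually_iff.1 hev
  have hfr : ∀ x ∈ closedBall p r, (x ∈ frontier D.carrier ↔ u x = 0) := fun x hx =>
    bv_frontier_iff D hU hu hg hD (hrB hx).2.1
  have happ : ∀ x ∈ closedBall p r, ∀ x' ∈ closedBall p r,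
      |u x - u x' - ⟪g, x - x'⟫| ≤ c * ‖x - x'‖ := by
    intro x hx x' hx'
    have := hVa x (hrB hx).1 x' (hrB hx').1
    rwa [hfd, Real.norm_eq_abs] at this
  refine ⟨r, hr, u, hu.continuousOn.mono fun x hx => (hrB hx).2.1,
    fun x hx => hmem x (hrB hx).2.1, hfr, ?_, ?_, fun x hx => (hrB hx.2).2.2 hx.1⟩
  · intro x hx s hs hx'
    have h1 := happ _ hx' _ hx
    rw [add_sub_cancel_left, inner_smul_right, hin, norm_smul, Real.norm_of_nonneg hs.le] at h1
    have h2 : c * ‖w‖ ≤ ‖g‖ * ⟪D.normal p, w⟫ / 2 := by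
      calc c * ‖w‖ ≤ (‖g‖ * ⟪D.normal p, w⟫ / (2 * ‖w‖)) * ‖w‖ := by
            gcongr; exact min_le_right _ _
        _ = _ := by field_simp
    have h3 := (abs_le.1 h1).1
    have h4 : 0 < s * (‖g‖ * ⟪D.normal p, w⟫) := by positivity
    have h5 := mul_le_mul_of_nonneg_left h2 hs.le
    nlinarith
  · intro x hx x' hx'
    have h1 := happ _ hx.2 _ hx'.2
    rw [(hfr x hx.2).1 hx.1, (hfr x' hx'.2).1 hx'.1, hin, sub_self, zero_sub, abs_neg, abs_mul,
      abs_norm] at h1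
    have h2 : c * ‖x - x'‖ ≤ δ * ‖g‖ * ‖x - x'‖ := by
      gcongr; exact min_le_left _ _
    have h3 : ‖g‖ * |⟪D.normal p, x - x'⟫| ≤ ‖g‖ * (δ * ‖x - x'‖) := by linarith
    exact le_of_mul_le_mul_left h3 hgp

lemma bv_line {h v : ℝ → ℝ} (hh : ContDiff ℝ 1 h) (hc : HasCompactSupport h) {J S : Set ℝ}
    (hJ : J.OrdConnected) (hv : ContinuousOn v J) (hm : StrictMonoOn v J)
    (hS : ∀ t ∈ J, (t ∈ S ↔ v t ≤ 0)) (h0 : ∀ t ∉ J, deriv h t = 0) :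
    (∀ t₀ ∈ J, v t₀ = 0 → ∫ t, S.indicator (deriv h) t = h t₀) ∧
    ((∀ t ∈ J, v t ≠ 0) → ∫ t, S.indicator (deriv h) t = 0) := by
  constructor
  · intro t₀ ht₀ hvt
    rw [← hc.integral_Iic_deriv_eq hh t₀, ← integral_indicator measurableSet_Iic]
    congr 1
    ext t
    by_cases ht : t ∈ J
    · have : t ∈ S ↔ t ∈ Iic t₀ := by
        rw [hS t ht, ← hvt, hm.le_iff_le ht ht₀, mem_Iic]
      simp [indicator, this]
    · simp [indicator, h0 t ht]
  · intro hne
    have hpc : IsPreconnected J := hJ.isPreconnected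
    have hintg : ∫ t, deriv h t = 0 := by
      refine (integral_of_hasDerivAt_of_tendsto (f := h) (m := 0) (n := 0)
        (fun x => (hh.differentiable one_ne_zero x).hasDerivAt) ?_ ?_ ?_).trans (sub_zero 0)
      · exact (hh.continuous_deriv le_rfl).integrable_of_hasCompactSupport hc.deriv
      · rw [hasCompactSupport_iff_eventuallyEq, Filter.coclosedCompact_eq_cocompact] at hc
        exact hc.filter_mono _root_.atBot_le_cocompact |>.tendsto
      · rw [hasCompactSupport_iff_eventuallyEq, Filter.coclosedCompact_eq_cocompact] at hc
        exact hc.filter_mono _root_.atTop_le_cocompact |>.tendsto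
    by_cases hneg : ∃ s ∈ J, v s < 0
    · obtain ⟨s, hs, hvs⟩ := hneg
      have hall : ∀ t ∈ J, t ∈ S := by
        intro t ht
        rw [hS t ht]
        by_contra hpos
        push Not at hpos
        obtain ⟨z, hz, hz0⟩ := hpc.intermediate_value hs ht hv ⟨hvs.le, hpos.le⟩
        exact hne z hz hz0
      rw [← hintg]
      congr 1
      ext t
      by_cases ht : t ∈ J
      · simp [indicator, hall t ht]
      · simp [indicator, h0 t ht]
    · push Not at hneg
      have : S.indicator (deriv h) = 0 := by
        ext t
        by_cases ht : t ∈ J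
        · have : t ∉ S := by
            rw [hS t ht, not_le]
            exact lt_of_le_of_ne (hneg t ht) (hne t ht).symm
          simp [indicator, this]
        · simp [indicator, h0 t ht]
      rw [this]; simp

lemma bv_meas_nonneg {X : Type*} [MeasurableSpace X] {σ κ : Measure X} {a : NNReal} (ha : 1 ≤ a)
    (h1 : σ ≤ a • κ) (h2 : κ ≤ a • σ) {f : X → ℝ} (hf : Integrable f κ) (hf0 : 0 ≤ f) :
    |∫ x, f x ∂σ - ∫ x, f x ∂κ| ≤ (a - 1) * ∫ x, f x ∂κ := by
  have hσ : Integrable f σ := (hf.smul_measure_nnreal (c := a)).mono_measure h1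
  have i1 : ∫ x, f x ∂σ ≤ a * ∫ x, f x ∂κ := by
    have := integral_mono_measure h1 (ae_of_all _ hf0) (hf.smul_measure_nnreal (c := a))
    rwa [integral_smul_nnreal_measure] at this
  have i2 : ∫ x, f x ∂κ ≤ a * ∫ x, f x ∂σ := by
    have := integral_mono_measure h2 (ae_of_all _ hf0) (hσ.smul_measure_nnreal (c := a))
    rwa [integral_smul_nnreal_measure] at this
  have ha' : (1 : ℝ) ≤ a := ha
  have p1 : 0 ≤ ∫ x, f x ∂κ := integral_nonneg hf0
  have p2 : 0 ≤ ∫ x, f x ∂σ := integral_nonneg hf0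
  rw [abs_le]
  constructor
  · by_contra hcon
    push Not at hcon
    nlinarith
  · linarith

lemma bv_meas {X : Type*} [MeasurableSpace X] {σ κ : Measure X} {a : NNReal} (ha : 1 ≤ a)
    (h1 : σ ≤ a • κ) (h2 : κ ≤ a • σ) {f : X → ℝ} (hf : Integrable f κ) :
    |∫ x, f x ∂σ - ∫ x, f x ∂κ| ≤ (a - 1) * ∫ x, |f x| ∂κ := by
  have hσ : Integrable f σ := (hf.smul_measure_nnreal (c := a)).mono_measure h1
  have e1 := bv_meas_nonneg ha h1 h2 hf.pos_part (fun x => le_max_right _ _)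
  have e2 := bv_meas_nonneg ha h1 h2 hf.neg_part (fun x => le_max_right _ _)
  have d1 : ∀ x, f x = max (f x) 0 - max (-f x) 0 := by
    intro x; rcases le_total 0 (f x) with h | h <;> simp [h]
  have d2 : ∀ x, |f x| = max (f x) 0 + max (-f x) 0 := by
    intro x; rcases le_total 0 (f x) with h | h <;> simp [h, abs_of_nonneg, abs_of_nonpos]
  have s1 : ∫ x, f x ∂σ = ∫ x, max (f x) 0 ∂σ - ∫ x, max (-f x) 0 ∂σ := by
    rw [← integral_sub hσ.pos_part hσ.neg_part]; exact integral_congr_ae (ae_of_all _ d1)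
  have s2 : ∫ x, f x ∂κ = ∫ x, max (f x) 0 ∂κ - ∫ x, max (-f x) 0 ∂κ := by
    rw [← integral_sub hf.pos_part hf.neg_part]; exact integral_congr_ae (ae_of_all _ d1)
  have s3 : ∫ x, |f x| ∂κ = ∫ x, max (f x) 0 ∂κ + ∫ x, max (-f x) 0 ∂κ := by
    rw [← integral_add hf.pos_part hf.neg_part]; exact integral_congr_ae (ae_of_all _ d2)
  rw [s1, s2, s3]
  rw [abs_le] at *
  constructor <;> linarith [e1.1, e1.2, e2.1, e2.2]

/-- Comparison of Hausdorff measures under a nearly isometric map. -/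
lemma bv_compare {X Y : Type*} [MetricSpace X] [MeasurableSpace X] [BorelSpace X]
    [MetricSpace Y] [MeasurableSpace Y] [BorelSpace Y] [SecondCountableTopology X]
    (m : ℕ) {P : X → Y} {G : Y → X} {K : Set X}
    (hK : IsCompact K) (hP : Continuous P) {L : NNReal} (hL : 1 ≤ L)
    (hlip : LipschitzOnWith L P K) (hG : LipschitzOnWith L G (P '' K)) (hGP : ∀ x ∈ K, G (P x) = x)
    {f : X → ℝ} (hf : Continuous f) (hfi : Integrable f ((μH[(m : ℝ)] : Measure X).restrict K)) :
    |∫ y in P '' K, f (G y) ∂(μH[(m : ℝ)] : Measure Y) - ∫ x in K, f x ∂(μH[(m : ℝ)] : Measure X)|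
      ≤ ((L : ℝ) ^ m - 1) * ∫ x in K, |f x| ∂(μH[(m : ℝ)] : Measure X) := by
  have hPK : MeasurableSet (P '' K) := (hK.image hP).isClosed.measurableSet
  have hGm : AEMeasurable G ((μH[(m : ℝ)] : Measure Y).restrict (P '' K)) :=
    hG.continuousOn.aemeasurable hPK
  have hσ : ∫ y in P '' K, f (G y) ∂(μH[(m : ℝ)] : Measure Y) =
      ∫ x, f x ∂(Measure.map G ((μH[(m : ℝ)] : Measure Y).restrict (P '' K))) := by
    rw [integral_map hGm hf.aestronglyMeasurable]
  have key : ∀ s : Set X, MeasurableSet s →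
      Measure.map G ((μH[(m : ℝ)] : Measure Y).restrict (P '' K)) s =
        (μH[(m : ℝ)] : Measure Y) (P '' (s ∩ K)) := by
    intro s hs
    rw [Measure.map_apply_of_aemeasurable hGm hs, Measure.restrict_apply' hPK]
    congr 1
    ext y
    constructor
    · rintro ⟨h1, x, hx, rfl⟩
      rw [mem_preimage, hGP x hx] at h1
      exact ⟨x, ⟨h1, hx⟩, rfl⟩
    · rintro ⟨x, ⟨h1, h2⟩, rfl⟩
      refine ⟨?_, x, h2, rfl⟩
      rw [mem_preimage, hGP x h2]; exact h1
  have ha : 1 ≤ L ^ m := one_le_pow₀ hL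
  rw [hσ]
  have := bv_meas ha (σ := Measure.map G ((μH[(m : ℝ)] : Measure Y).restrict (P '' K)))
    (κ := (μH[(m : ℝ)] : Measure X).restrict K) ?_ ?_ hfi
  · simpa using this
  · rw [Measure.le_iff]
    intro s hs
    rw [key s hs, Measure.smul_apply, Measure.restrict_apply hs]
    have := (hlip.mono (inter_subset_right (s := s))).hausdorffMeasure_image_le
      (d := (m : ℝ)) (by positivity)
    rw [ENNReal.rpow_natCast] at this
    simpa [ENNReal.smul_def] using this
  · rw [Measure.le_iff]
    intro s hs
    rw [Measure.smul_apply, key s hs, Measure.restrict_apply hs]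
    have := (hG.mono (image_mono (f := P) (inter_subset_right (s := s)))).hausdorffMeasure_image_le
      (d := (m : ℝ)) (by positivity)
    rw [ENNReal.rpow_natCast] at this
    have himg : G '' (P '' (s ∩ K)) = s ∩ K := by
      rw [image_image]
      exact (image_congr fun x hx => hGP x hx.2).trans (image_id' _)
    rw [himg] at this
    simpa [ENNReal.smul_def] using this

lemma bv_near_iso {d m : ℕ} {e w : EuclideanSpace ℝ (Fin d)}
    (hw : 0 < ⟪e, w⟫)
    (M : (EuclideanSpace ℝ (Fin m) × ℝ) ≃L[ℝ] EuclideanSpace ℝ (Fin d))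
    (hM1 : ∀ y, ‖M (y, 0)‖ = ‖y‖) (hM2 : ∀ y t, M (y, t) = M (y, 0) + t • w)
    (hM3 : ∀ y, ⟪e, M (y, 0)⟫ = 0) {δ : ℝ} {z : EuclideanSpace ℝ (Fin d)}
    (hz : |⟪e, z⟫| ≤ δ * ‖z‖) :
    ‖(M.symm z).1‖ ≤ (1 + δ * (‖w‖ / ⟪e, w⟫)) * ‖z‖ ∧
    (1 - δ * (‖w‖ / ⟪e, w⟫)) * ‖z‖ ≤ ‖(M.symm z).1‖ := by
  rcases hyt : M.symm z with ⟨y, t⟩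
  have hz' : z = M (y, 0) + t • w := by rw [← hM2, ← hyt]; simp
  have h1 : ⟪e, z⟫ = t * ⟪e, w⟫ := by
    rw [hz', inner_add_right, hM3, inner_smul_right, zero_add]
  have h2 : ‖t • w‖ ≤ δ * (‖w‖ / ⟪e, w⟫) * ‖z‖ := by
    rw [h1, abs_mul, abs_of_pos hw] at hz
    rw [norm_smul, Real.norm_eq_abs]
    have : |t| ≤ δ * ‖z‖ / ⟪e, w⟫ := by rwa [le_div_iff₀ hw]
    calc |t| * ‖w‖ ≤ δ * ‖z‖ / ⟪e, w⟫ * ‖w‖ := by gcongr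
      _ = _ := by ring
  have h3 : ‖z‖ ≤ ‖y‖ + ‖t • w‖ := by
    rw [← hM1 y, hz']; exact norm_add_le _ _
  have h4 : ‖y‖ ≤ ‖z‖ + ‖t • w‖ := by
    rw [← hM1 y]
    have : M (y, 0) = z - t • w := by rw [hz']; simp
    rw [this]; exact norm_sub_le _ _
  constructor <;> simp only <;> linarith

/-- The slicing computation of `∫_D ∂_w φ`. -/
lemma bv_slice {m : ℕ} {D : Set (EuclideanSpace ℝ (Fin (m+1)))} (hD : IsClosed D)
    {p e w : EuclideanSpace ℝ (Fin (m+1))} {C : NNReal} (hw : 0 < ⟪e, w⟫)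
    (M : (EuclideanSpace ℝ (Fin m) × ℝ) ≃L[ℝ] EuclideanSpace ℝ (Fin (m+1)))
    (hM2 : ∀ y t, M (y, t) = M (y, 0) + t • w)
    (hM4 : Measure.map M ((μH[(m : ℝ)] : Measure (EuclideanSpace ℝ (Fin m))).prod volume) =
        ENNReal.ofReal (C * ⟪e, w⟫⁻¹) • (volume : Measure (EuclideanSpace ℝ (Fin (m+1)))))
    {r : ℝ} {u : EuclideanSpace ℝ (Fin (m+1)) → ℝ} (hu : ContinuousOn u (closedBall p r))
    (hu1 : ∀ x ∈ closedBall p r, (x ∈ D ↔ u x ≤ 0))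
    (hu2 : ∀ x ∈ closedBall p r, (x ∈ frontier D ↔ u x = 0))
    (hu3 : ∀ x ∈ closedBall p r, ∀ s : ℝ, 0 < s → x + s • w ∈ closedBall p r →
      u x < u (x + s • w))
    {G : EuclideanSpace ℝ (Fin m) → EuclideanSpace ℝ (Fin (m+1))}
    (hG : ∀ x ∈ frontier D ∩ closedBall p r, G (M.symm x).1 = x)
    {φ : EuclideanSpace ℝ (Fin (m+1)) → ℝ} (hφ : ContDiff ℝ 1 φ) (hφc : HasCompactSupport φ)
    (hφs : tsupport φ ⊆ ball p r) :
    C * ∫ x in D, fderiv ℝ φ x w = ⟪e, w⟫ *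
      ∫ y in (fun x => (M.symm x).1) '' (frontier D ∩ closedBall p r), φ (G y)
        ∂(μH[(m : ℝ)] : Measure (EuclideanSpace ℝ (Fin m))) := by
  have hH : Measure.IsAddHaarMeasure (μH[(m : ℝ)] : Measure (EuclideanSpace ℝ (Fin m))) := by
    have := isAddHaarMeasure_hausdorffMeasure (E := EuclideanSpace ℝ (Fin m))
    simpa using this
  have hw0 : w ≠ 0 := by rintro rfl; simp at hw
  set K := frontier D ∩ closedBall p r with hKdef
  have hK : IsCompact K := (isCompact_closedBall p r).inter_left isClosed_frontier
  set A := (fun x => (M.symm x).1) '' K with hA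
  have hAm : MeasurableSet A :=
    (hK.image (continuous_fst.comp M.symm.continuous)).isClosed.measurableSet
  set ψ : EuclideanSpace ℝ (Fin (m+1)) → ℝ := fun x => fderiv ℝ φ x w with hψ
  have hψc : Continuous ψ := (hφ.continuous_fderiv one_ne_zero).clm_apply continuous_const
  have hψs : HasCompactSupport ψ := hφc.fderiv_apply ℝ w
  have hψi : Integrable (D.indicator ψ) :=
    (hψc.integrable_of_hasCompactSupport hψs).indicator hD.measurableSet
  have hk : 0 ≤ (C : ℝ) * ⟪e, w⟫⁻¹ := mul_nonneg C.coe_nonneg (inv_nonneg.2 hw.le)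
  have hi1 : Integrable (D.indicator ψ)
      (Measure.map M ((μH[(m : ℝ)] : Measure (EuclideanSpace ℝ (Fin m))).prod volume)) := by
    rw [hM4]; exact hψi.smul_measure ENNReal.ofReal_ne_top
  have hMemb : MeasurableEmbedding M := M.toHomeomorph.measurableEmbedding
  have hi2 : Integrable (fun z => D.indicator ψ (M z))
      ((μH[(m : ℝ)] : Measure (EuclideanSpace ℝ (Fin m))).prod volume) :=
    (hMemb.integrable_map_iff).1 hi1
  have hfub : (C * ⟪e, w⟫⁻¹) * ∫ x, D.indicator ψ x =
      ∫ y, ∫ t, D.indicator ψ (M (y, t)) ∂volume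
        ∂(μH[(m : ℝ)] : Measure (EuclideanSpace ℝ (Fin m))) := by
    rw [← integral_prod (fun z => D.indicator ψ (M z)) hi2, ← hMemb.integral_map, hM4,
      integral_smul_measure, ENNReal.toReal_ofReal hk, smul_eq_mul]
  have hinner : ∀ y, ∫ t, D.indicator ψ (M (y, t)) = A.indicator (fun y => φ (G y)) y := by
    intro y
    set b := M (y, 0) with hb
    set h : ℝ → ℝ := fun t => φ (b + t • w) with hh
    set S : Set ℝ := {t | b + t • w ∈ D} with hS
    set J : Set ℝ := {t | b + t • w ∈ closedBall p r} with hJ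
    have hd : ∀ t, deriv h t = ψ (b + t • w) := by
      intro t
      have h1 : HasDerivAt (fun t : ℝ => b + t • w) w t := by
        simpa using ((hasDerivAt_id t).smul_const w).const_add b
      exact (((hφ.differentiable one_ne_zero) _).hasFDerivAt.comp_hasDerivAt t h1).deriv
    have haff : Continuous (fun t : ℝ => b + t • w) := by fun_prop
    have e1 : (fun t => D.indicator ψ (M (y, t))) = fun t => S.indicator (deriv h) t := by
      ext t
      rw [hM2]
      simp only [indicator, hS, hd]
      rfl
    rw [e1]
    have hcemb : Topology.IsClosedEmbedding (fun t : ℝ => b + t • w) :=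
      (Homeomorph.addLeft b).isClosedEmbedding.comp (isClosedEmbedding_smul_left hw0)
    have hhc : HasCompactSupport h := hφc.comp_isClosedEmbedding hcemb
    have hh1 : ContDiff ℝ 1 h := hφ.comp (by fun_prop)
    have hJo : J.OrdConnected := by
      have : Convex ℝ J := by
        have := (convex_closedBall p r).affine_preimage (AffineMap.lineMap b (b + w) : ℝ →ᵃ[ℝ] _)
        have hJe : J = (AffineMap.lineMap b (b + w) : ℝ →ᵃ[ℝ] _) ⁻¹' closedBall p r := by
          ext t
          simp [hJ, AffineMap.lineMap_apply, add_comm]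
        rw [hJe]
        exact this
      exact this.ordConnected
    have hline := bv_line (v := fun t => u (b + t • w)) (S := S) hh1 hhc hJo
      (hu.comp haff.continuousOn fun t ht => ht) ?_ (fun t ht => hu1 _ ht) ?_
    · by_cases hy : y ∈ A
      · rw [indicator_of_mem hy]
        obtain ⟨x, hx, hxy⟩ := hy
        have hx' : x = b + (M.symm x).2 • w := by
          rw [hb, ← hM2, ← hxy]
          simp
        have := hline.1 (M.symm x).2 (by simpa only [hJ, Set.mem_ofPred_eq, ← hx'] using hx.2)
          (by simp only [← hx']; exact (hu2 x hx.2).1 hx.1)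
        rw [this]
        simp only [hh]
        rw [← hx', ← hxy, hG x hx]
      · rw [indicator_of_notMem hy]
        apply hline.2
        intro t ht h0
        refine hy ⟨b + t • w, ⟨(hu2 _ ht).2 h0, ht⟩, ?_⟩
        simp only
        rw [hb, ← hM2]; simp
    · intro s hs t ht hst
      have := hu3 _ hs (t - s) (sub_pos.2 hst)
      have e : b + s • w + (t - s) • w = b + t • w := by module
      rw [e] at this
      exact this ht
    · intro t ht
      rw [hd]
      have : b + t • w ∉ tsupport φ := fun hmem => ht (ball_subset_closedBall (hφs hmem))
      simp only [hψ]
      rw [fderiv_of_notMem_tsupport ℝ this]; simp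
  rw [← integral_indicator hD.measurableSet, ← integral_indicator hAm]
  simp only [hinner] at hfub
  rw [← hfub]
  have hfin : ∀ I : ℝ, C * I = ⟪e, w⟫ * (C * ⟪e, w⟫⁻¹ * I) := fun I => by field_simp
  exact hfin _

/-- The defect in the divergence theorem. -/
def bvErr {m : ℕ} (C : NNReal) (D : RegularDomain (m+1)) (w : EuclideanSpace ℝ (Fin (m+1)))
    (φ : EuclideanSpace ℝ (Fin (m+1)) → ℝ) : ℝ :=
  ∫ x in frontier D.carrier, φ x * ⟪D.normal x, w⟫ ∂(μH[(m : ℝ)] : Measure _) -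
    C * ∫ x in D.carrier, fderiv ℝ φ x w

/-- The property of the constant obtained in `bv_coords`. -/
def BvConst (m : ℕ) (C : NNReal) : Prop := ∀ e w : EuclideanSpace ℝ (Fin (m+1)), ‖e‖ = 1 →
    0 < ⟪e, w⟫ →
    ∃ M : (EuclideanSpace ℝ (Fin m) × ℝ) ≃L[ℝ] EuclideanSpace ℝ (Fin (m+1)),
      (∀ y, ‖M (y, 0)‖ = ‖y‖) ∧ (∀ y t, M (y, t) = M (y, 0) + t • w) ∧
      (∀ y, ⟪e, M (y, 0)⟫ = 0) ∧
      Measure.map M ((μH[(m : ℝ)] : Measure (EuclideanSpace ℝ (Fin m))).prod volume) =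
        ENNReal.ofReal (C * ⟪e, w⟫⁻¹) • (volume : Measure (EuclideanSpace ℝ (Fin (m+1))))

lemma bv_integrableOn {m : ℕ} (D : RegularDomain (m+1))
    (hfin : μH[(m : ℝ)] (frontier D.carrier) ≠ ⊤)
    {f : EuclideanSpace ℝ (Fin (m+1)) → ℝ} (hf : Continuous f) (hfc : HasCompactSupport f)
    (w : EuclideanSpace ℝ (Fin (m+1))) :
    IntegrableOn f (frontier D.carrier) (μH[(m : ℝ)]) ∧
    IntegrableOn (fun x => f x * ⟪D.normal x, w⟫) (frontier D.carrier) (μH[(m : ℝ)]) := by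
  have hfin' : IsFiniteMeasure ((μH[(m : ℝ)] : Measure _).restrict (frontier D.carrier)) :=
    ⟨by simpa using hfin.lt_top⟩
  have h1 : IntegrableOn f (frontier D.carrier) (μH[(m : ℝ)]) := by
    obtain ⟨B, hB⟩ := hf.bounded_above_of_compact_support hfc
    exact Integrable.of_bound hf.aestronglyMeasurable B (ae_of_all _ hB)
  refine ⟨h1, ?_⟩
  refine Integrable.mul_bdd (c := ‖w‖) h1 ?_ ?_
  · have : ContinuousOn (fun x => ⟪D.normal x, w⟫) (frontier D.carrier) :=
      (bv_normal D).1.inner continuousOn_const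
    exact this.aestronglyMeasurable isClosed_frontier.measurableSet
  · rw [ae_restrict_iff' isClosed_frontier.measurableSet]
    refine ae_of_all _ fun x hx => ?_
    have := norm_inner_le_norm (𝕜 := ℝ) (D.normal x) w
    rwa [(bv_normal D).2 x hx, one_mul] at this

lemma bv_main_pos {m : ℕ} {C : NNReal} (hC : BvConst m C) (D : RegularDomain (m+1))
    (hfin : μH[(m : ℝ)] (frontier D.carrier) ≠ ⊤)
    {p w : EuclideanSpace ℝ (Fin (m+1))} (hp : p ∈ frontier D.carrier)
    (hw : 0 < ⟪D.normal p, w⟫) {ε : ℝ} (hε : 0 < ε) :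
    ∃ r > 0, ∀ φ : EuclideanSpace ℝ (Fin (m+1)) → ℝ, ContDiff ℝ 1 φ → HasCompactSupport φ →
      tsupport φ ⊆ ball p r →
      |bvErr C D w φ| ≤ ε * ∫ x in frontier D.carrier, |φ x| ∂(μH[(m : ℝ)] : Measure _) := by
  set e := D.normal p with he
  obtain ⟨M, hM1, hM2, hM3, hM4⟩ := hC e w ((bv_normal D).2 p hp) hw
  set k := ‖w‖ / ⟪e, w⟫ with hk
  have hk0 : 0 ≤ k := by positivity
  obtain ⟨δ, hδ0, hδ1, hδ2⟩ : ∃ δ : ℝ, 0 < δ ∧ δ * k < 1 ∧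
      ⟪e, w⟫ * (((1 - δ * k)⁻¹) ^ m - 1) + δ * ‖w‖ < ε := by
    have t1 : ContinuousAt (fun δ : ℝ => ⟪e, w⟫ * (((1 - δ * k)⁻¹) ^ m - 1) + δ * ‖w‖) 0 := by
      have : ContinuousAt (fun δ : ℝ => (1 - δ * k)⁻¹) 0 :=
        ContinuousAt.inv₀ (by fun_prop) (by simp)
      fun_prop
    have t2 : ContinuousAt (fun δ : ℝ => δ * k) 0 := by fun_prop
    have e1 := t1.eventually_lt_const (u := ε) (by simpa using hε)
    have e2 := t2.eventually_lt_const (u := 1) (by simp)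
    obtain ⟨δ, ⟨h1, h2⟩, h3⟩ := (((e1.and e2).filter_mono nhdsWithin_le_nhds).and
      (self_mem_nhdsWithin (s := Ioi (0:ℝ)))).exists
    exact ⟨δ, h3, h2, h1⟩
  set q := δ * k with hq
  have hq0 : 0 ≤ q := by positivity
  have h1q : 0 < 1 - q := by linarith
  obtain ⟨r, hr, u, hu0, hu1, hu2, hu3, hu4, hu5⟩ := bv_local D hp hw hδ0
  refine ⟨r, hr, fun φ hφ hφc hφs => ?_⟩
  set K := frontier D.carrier ∩ closedBall p r with hKdef
  have hK : IsCompact K := (isCompact_closedBall p r).inter_left isClosed_frontier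
  set P : EuclideanSpace ℝ (Fin (m+1)) → EuclideanSpace ℝ (Fin m) := fun x => (M.symm x).1 with hP
  have hPc : Continuous P := continuous_fst.comp M.symm.continuous
  have hPs : ∀ x x', P x - P x' = (M.symm (x - x')).1 := by
    intro x x'; simp [hP]
  let L : NNReal := ⟨(1 - q)⁻¹, (inv_pos.2 h1q).le⟩
  have hLc : (L : ℝ) = (1 - q)⁻¹ := rfl
  have hL1 : (1 : ℝ) ≤ L := by rw [hLc]; exact (one_le_inv₀ h1q).2 (by linarith)
  have hL2 : 1 + q ≤ (L : ℝ) := by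
    rw [hLc, ← one_div, le_div_iff₀ h1q]; nlinarith
  have hlip : LipschitzOnWith L P K := by
    refine LipschitzOnWith.of_dist_le_mul fun x hx x' hx' => ?_
    rw [dist_eq_norm, dist_eq_norm, hPs]
    refine (bv_near_iso hw M hM1 hM2 hM3 (hu4 x hx x' hx')).1.trans ?_
    gcongr
  have hanti : ∀ x ∈ K, ∀ x' ∈ K, dist x x' ≤ L * dist (P x) (P x') := by
    intro x hx x' hx'
    rw [dist_eq_norm, dist_eq_norm, hPs, hLc, inv_mul_eq_div, le_div_iff₀ h1q, mul_comm]
    exact (bv_near_iso hw M hM1 hM2 hM3 (hu4 x hx x' hx')).2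
  have hinj : InjOn P K := by
    intro x hx x' hx' h
    have := hanti x hx x' hx'
    rw [h, dist_self, mul_zero] at this
    exact dist_le_zero.1 this
  set G := Function.invFunOn P K with hGdef
  have hGP : ∀ x ∈ K, G (P x) = x := fun x hx => hinj.leftInvOn_invFunOn hx
  have hGlip : LipschitzOnWith L G (P '' K) := by
    refine LipschitzOnWith.of_dist_le_mul ?_
    rintro _ ⟨x, hx, rfl⟩ _ ⟨x', hx', rfl⟩
    rw [hGP x hx, hGP x' hx']
    exact hanti x hx x' hx'
  obtain ⟨hint1, hint2⟩ := bv_integrableOn D hfin hφ.continuous hφc w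
  have hKsub : K ⊆ frontier D.carrier := inter_subset_left
  have hz : ∀ x ∈ frontier D.carrier \ K, φ x = 0 := by
    intro x hx
    by_contra h
    exact hx.2 ⟨hx.1, ball_subset_closedBall (hφs (subset_tsupport _ h))⟩
  have hslice := bv_slice D.isClosed hw M hM2 hM4 hu0 hu1 hu2 hu3 hGP hφ hφc hφs
  have hcmp := bv_compare m hK hPc hL1 hlip hGlip hGP hφ.continuous (hint1.mono_set hKsub)
  have r1 : ∫ x in frontier D.carrier, φ x * ⟪D.normal x, w⟫ ∂(μH[(m : ℝ)] : Measure _) =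
      ∫ x in K, φ x * ⟪D.normal x, w⟫ ∂(μH[(m : ℝ)] : Measure _) :=
    setIntegral_eq_of_subset_of_forall_sdiff_eq_zero isClosed_frontier.measurableSet hKsub
      (fun x hx => by rw [hz x hx, zero_mul])
  have r2 : ∫ x in frontier D.carrier, |φ x| ∂(μH[(m : ℝ)] : Measure _) =
      ∫ x in K, |φ x| ∂(μH[(m : ℝ)] : Measure _) :=
    setIntegral_eq_of_subset_of_forall_sdiff_eq_zero isClosed_frontier.measurableSet hKsub
      (fun x hx => by rw [hz x hx, abs_zero])
  have hb : |∫ x in K, φ x * ⟪D.normal x, w⟫ ∂(μH[(m : ℝ)] : Measure _) -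
      ⟪e, w⟫ * ∫ x in K, φ x ∂(μH[(m : ℝ)] : Measure _)| ≤
      δ * ‖w‖ * ∫ x in K, |φ x| ∂(μH[(m : ℝ)] : Measure _) := by
    rw [← integral_const_mul, ← integral_const_mul,
      ← integral_sub (hint2.mono_set hKsub) ((hint1.mono_set hKsub).const_mul _),
      ← Real.norm_eq_abs]
    refine norm_integral_le_of_norm_le (((hint1.mono_set hKsub).abs).const_mul _) ?_
    rw [ae_restrict_iff' hK.isClosed.measurableSet]
    refine ae_of_all _ fun x hx => ?_
    have : φ x * ⟪D.normal x, w⟫ - ⟪e, w⟫ * φ x = ⟪D.normal x - e, w⟫ * φ x := by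
      rw [inner_sub_left]; ring
    rw [this, norm_mul, Real.norm_eq_abs (φ x)]
    gcongr
    refine (norm_inner_le_norm _ _).trans ?_
    gcongr
    exact hu5 x hx
  have hI0 : 0 ≤ ∫ x in K, |φ x| ∂(μH[(m : ℝ)] : Measure _) := integral_nonneg fun x => abs_nonneg _
  rw [bvErr, r1, r2, hslice]
  set I1 := ∫ x in K, φ x * ⟪D.normal x, w⟫ ∂(μH[(m : ℝ)] : Measure _)
  set I2 := ∫ x in K, φ x ∂(μH[(m : ℝ)] : Measure _)
  set I3 := ∫ x in K, |φ x| ∂(μH[(m : ℝ)] : Measure _)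
  rw [hLc] at hcmp
  calc _ ≤ |I1 - ⟪e, w⟫ * I2| + |⟪e, w⟫ * I2 - _| := abs_sub_le _ _ _
    _ ≤ δ * ‖w‖ * I3 + ⟪e, w⟫ * ((((1 - q)⁻¹) ^ m - 1) * I3) := by
        refine add_le_add hb ?_
        rw [← mul_sub, abs_mul, abs_of_pos hw, abs_sub_comm]
        gcongr
    _ = (⟪e, w⟫ * (((1 - q)⁻¹) ^ m - 1) + δ * ‖w‖) * I3 := by ring
    _ ≤ ε * I3 := by gcongr

lemma bv_fderiv_integrable {m : ℕ} {φ : EuclideanSpace ℝ (Fin (m+1)) → ℝ}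
    (hφ : ContDiff ℝ 1 φ) (hφc : HasCompactSupport φ) (w : EuclideanSpace ℝ (Fin (m+1))) :
    Integrable (fun x => fderiv ℝ φ x w) := by
  have h1 : Continuous (fun x => fderiv ℝ φ x w) :=
    (hφ.continuous_fderiv one_ne_zero).clm_apply continuous_const
  refine h1.integrable_of_hasCompactSupport ?_
  exact (hφc.fderiv (𝕜 := ℝ)).comp_left (g := fun L : EuclideanSpace ℝ (Fin (m+1)) →L[ℝ] ℝ => L w)
    (by simp)

lemma bvErr_sub_w {m : ℕ} (C : NNReal) (D : RegularDomain (m+1))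
    (hfin : μH[(m : ℝ)] (frontier D.carrier) ≠ ⊤)
    {φ : EuclideanSpace ℝ (Fin (m+1)) → ℝ} (hφ : ContDiff ℝ 1 φ) (hφc : HasCompactSupport φ)
    (w v : EuclideanSpace ℝ (Fin (m+1))) :
    bvErr C D (w - v) φ = bvErr C D w φ - bvErr C D v φ := by
  unfold bvErr
  have h1 := bv_integrableOn D hfin hφ.continuous hφc
  have e1 : ∫ x in frontier D.carrier, φ x * ⟪D.normal x, w - v⟫ ∂(μH[(m : ℝ)] : Measure _) =
      ∫ x in frontier D.carrier, φ x * ⟪D.normal x, w⟫ ∂(μH[(m : ℝ)] : Measure _) -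
      ∫ x in frontier D.carrier, φ x * ⟪D.normal x, v⟫ ∂(μH[(m : ℝ)] : Measure _) := by
    rw [← integral_sub (h1 w).2 (h1 v).2]
    congr 1 with x
    rw [inner_sub_right]; ring
  have e2 : ∫ x in D.carrier, fderiv ℝ φ x (w - v) =
      (∫ x in D.carrier, fderiv ℝ φ x w) - ∫ x in D.carrier, fderiv ℝ φ x v := by
    rw [← integral_sub (bv_fderiv_integrable hφ hφc w).integrableOn
      (bv_fderiv_integrable hφ hφc v).integrableOn]
    congr 1 with x
    rw [map_sub]
  rw [e1, e2]; ring

lemma bvErr_sum {m : ℕ} (C : NNReal) (D : RegularDomain (m+1))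
    (hfin : μH[(m : ℝ)] (frontier D.carrier) ≠ ⊤) {ι : Type*} (s : Finset ι)
    {φ : ι → EuclideanSpace ℝ (Fin (m+1)) → ℝ} (hφ : ∀ i, ContDiff ℝ 1 (φ i))
    (hφc : ∀ i, HasCompactSupport (φ i)) (w : EuclideanSpace ℝ (Fin (m+1))) :
    bvErr C D w (fun x => ∑ i ∈ s, φ i x) = ∑ i ∈ s, bvErr C D w (φ i) := by
  unfold bvErr
  rw [Finset.sum_sub_distrib, ← Finset.mul_sum,
    ← integral_finsetSum _ fun i _ => (bv_integrableOn D hfin (hφ i).continuous (hφc i) w).2,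
    ← integral_finsetSum _ fun i _ => (bv_fderiv_integrable (hφ i) (hφc i) w).integrableOn]
  congr 3
  · ext x; rw [Finset.sum_mul]
  · ext x
    rw [fderiv_fun_sum fun i _ => (hφ i).differentiable one_ne_zero x]
    simp

lemma bv_main_frontier {m : ℕ} {C : NNReal} (hC : BvConst m C) (D : RegularDomain (m+1))
    (hfin : μH[(m : ℝ)] (frontier D.carrier) ≠ ⊤)
    {p : EuclideanSpace ℝ (Fin (m+1))} (hp : p ∈ frontier D.carrier)
    (w : EuclideanSpace ℝ (Fin (m+1))) {ε : ℝ} (hε : 0 < ε) :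
    ∃ r > 0, ∀ φ : EuclideanSpace ℝ (Fin (m+1)) → ℝ, ContDiff ℝ 1 φ → HasCompactSupport φ →
      tsupport φ ⊆ ball p r →
      |bvErr C D w φ| ≤ ε * ∫ x in frontier D.carrier, |φ x| ∂(μH[(m : ℝ)] : Measure _) := by
  set e := D.normal p with he
  have hn : ⟪e, e⟫ = 1 := by rw [real_inner_self_eq_norm_sq, (bv_normal D).2 p hp]; norm_num
  set s := |⟪e, w⟫| + 1 with hs
  have hs0 : 0 < s := by positivity
  have a1 : 0 < ⟪e, w + s • e⟫ := by
    rw [inner_add_right, inner_smul_right, hn]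
    have := neg_abs_le ⟪e, w⟫
    linarith
  have a2 : 0 < ⟪e, s • e⟫ := by rw [inner_smul_right, hn]; linarith
  obtain ⟨r1, hr1, h1⟩ := bv_main_pos hC D hfin hp a1 (half_pos hε)
  obtain ⟨r2, hr2, h2⟩ := bv_main_pos hC D hfin hp a2 (half_pos hε)
  refine ⟨min r1 r2, lt_min hr1 hr2, fun φ hφ hφc hφs => ?_⟩
  have b1 := h1 φ hφ hφc (hφs.trans (ball_subset_ball (min_le_left _ _)))
  have b2 := h2 φ hφ hφc (hφs.trans (ball_subset_ball (min_le_right _ _)))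
  have : w = (w + s • e) - s • e := by simp
  rw [this, bvErr_sub_w C D hfin hφ hφc]
  refine (abs_sub _ _).trans ?_
  linarith

lemma bv_integral_fderiv {m : ℕ} {φ : EuclideanSpace ℝ (Fin (m+1)) → ℝ}
    (hφ : ContDiff ℝ 1 φ) (hφc : HasCompactSupport φ) (w : EuclideanSpace ℝ (Fin (m+1))) :
    ∫ x, fderiv ℝ φ x w = 0 := by
  have := integral_mul_fderiv_eq_neg_fderiv_mul_of_integrable (𝕜 := ℝ)
    (μ := (volume : Measure (EuclideanSpace ℝ (Fin (m+1))))) (f := fun _ => (1:ℝ)) (g := φ) (v := w)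
    (by simp) (by simpa using bv_fderiv_integrable hφ hφc w)
    (by simpa using hφ.continuous.integrable_of_hasCompactSupport hφc)
    (fun x _ => by fun_prop) (fun x _ => hφ.differentiable one_ne_zero x)
  simpa using this

lemma bv_main_any {m : ℕ} {C : NNReal} (hC : BvConst m C) (D : RegularDomain (m+1))
    (hfin : μH[(m : ℝ)] (frontier D.carrier) ≠ ⊤)
    (p w : EuclideanSpace ℝ (Fin (m+1))) {ε : ℝ} (hε : 0 < ε) :
    ∃ r > 0, ∀ φ : EuclideanSpace ℝ (Fin (m+1)) → ℝ, ContDiff ℝ 1 φ → HasCompactSupport φ →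
      tsupport φ ⊆ ball p r →
      |bvErr C D w φ| ≤ ε * ∫ x in frontier D.carrier, |φ x| ∂(μH[(m : ℝ)] : Measure _) := by
  by_cases hp : p ∈ frontier D.carrier
  · exact bv_main_frontier hC D hfin hp w hε
  have key : ∀ r : ℝ, (ball p r ⊆ interior D.carrier ∨ ball p r ⊆ D.carrierᶜ) →
      ∀ φ : EuclideanSpace ℝ (Fin (m+1)) → ℝ, ContDiff ℝ 1 φ → HasCompactSupport φ →
      tsupport φ ⊆ ball p r →
      |bvErr C D w φ| ≤ ε * ∫ x in frontier D.carrier, |φ x| ∂(μH[(m : ℝ)] : Measure _) := by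
    intro r hr φ hφ hφc hφs
    have z : bvErr C D w φ = 0 := by
      have z1 : ∫ x in frontier D.carrier, φ x * ⟪D.normal x, w⟫ ∂(μH[(m : ℝ)] : Measure _) = 0 := by
        refine setIntegral_eq_zero_of_forall_eq_zero fun x hx => ?_
        have : φ x = 0 := by
          by_contra h
          have hb := hφs (subset_tsupport _ h)
          rcases hr with hr | hr
          · exact hx.2 (hr hb)
          · exact hr hb (D.isClosed.frontier_subset hx)
        rw [this, zero_mul]
      have z2 : ∫ x in D.carrier, fderiv ℝ φ x w = 0 := by
        rcases hr with hr | hr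
        · rw [setIntegral_eq_integral_of_forall_compl_eq_zero, bv_integral_fderiv hφ hφc]
          intro x hx
          rw [fderiv_of_notMem_tsupport ℝ fun h => hx (interior_subset (hr (hφs h)))]
          simp
        · refine setIntegral_eq_zero_of_forall_eq_zero fun x hx => ?_
          rw [fderiv_of_notMem_tsupport ℝ fun h => hr (hφs h) hx]
          simp
      rw [bvErr, z1, z2]; simp
    rw [z, abs_zero]
    exact mul_nonneg hε.le (integral_nonneg fun x => abs_nonneg _)
  by_cases hD : p ∈ D.carrier
  · have : p ∈ interior D.carrier := by
      by_contra h
      exact hp ⟨subset_closure hD, h⟩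
    obtain ⟨r, hr, hb⟩ := Metric.isOpen_iff.1 isOpen_interior p this
    exact ⟨r, hr, key r (Or.inl hb)⟩
  · obtain ⟨r, hr, hb⟩ := Metric.isOpen_iff.1 D.isClosed.isOpen_compl p hD
    exact ⟨r, hr, key r (Or.inr hb)⟩

open scoped Manifold ContDiff in
lemma bv_divergence {m : ℕ} {C : NNReal} (hC : BvConst m C) (D : RegularDomain (m+1))
    (hfin : μH[(m : ℝ)] (frontier D.carrier) ≠ ⊤)
    (w : EuclideanSpace ℝ (Fin (m+1))) {φ : EuclideanSpace ℝ (Fin (m+1)) → ℝ}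
    (hφ : ContDiff ℝ ∞ φ) (hφc : HasCompactSupport φ) :
    bvErr C D w φ = 0 := by
  have main : ∀ ε : ℝ, 0 < ε → |bvErr C D w φ| ≤
      ε * ∫ x in frontier D.carrier, |φ x| ∂(μH[(m : ℝ)] : Measure _) := by
    intro ε hε
    choose r hr h using fun p => bv_main_any hC D hfin p w hε
    obtain ⟨t, ht⟩ := hφc.elim_finite_subcover (fun p => ball p (r p)) (fun _ => isOpen_ball)
      (fun x _ => mem_iUnion.2 ⟨x, mem_ball_self (hr x)⟩)
    obtain ⟨f, hf⟩ := SmoothPartitionOfUnity.exists_isSubordinate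
      (𝓘(ℝ, EuclideanSpace ℝ (Fin (m+1)))) (isClosed_tsupport φ)
      (fun p : t => ball (p : EuclideanSpace ℝ (Fin (m+1))) (r p)) (fun _ => isOpen_ball)
      (fun x hx => by
        obtain ⟨p, hp, hx⟩ := mem_iUnion₂.1 (ht hx)
        exact mem_iUnion.2 ⟨⟨p, hp⟩, hx⟩)
    have hfs : ∀ i, ContDiff ℝ 1 (f i) := fun i =>
      ((f i).contMDiff.contDiff).of_le (by exact_mod_cast le_top)
    have hφ1 : ContDiff ℝ 1 φ := hφ.of_le (by exact_mod_cast le_top)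
    set ψ : t → EuclideanSpace ℝ (Fin (m+1)) → ℝ := fun i x => f i x * φ x with hψ
    have c1 : ∀ i, ContDiff ℝ 1 (ψ i) := fun i => (hfs i).mul hφ1
    have c2 : ∀ i, HasCompactSupport (ψ i) := fun i => hφc.mul_left
    have c3 : ∀ i, tsupport (ψ i) ⊆ ball (i : EuclideanSpace ℝ (Fin (m+1))) (r i) := fun i =>
      (tsupport_mul_subset_left).trans (hf i)
    have hsum : ∀ x ∈ tsupport φ, ∑ i, f i x = 1 := by
      intro x hx
      rw [← f.sum_eq_one hx, finsum_eq_sum_of_fintype]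
    have s1 : φ = fun x => ∑ i, ψ i x := by
      ext x
      simp only [hψ, ← Finset.sum_mul]
      by_cases hx : x ∈ tsupport φ
      · rw [hsum x hx, one_mul]
      · rw [image_eq_zero_of_notMem_tsupport hx, mul_zero]
    have s2 : ∀ x, |φ x| = ∑ i, |ψ i x| := by
      intro x
      simp only [hψ, abs_mul, ← Finset.sum_mul, abs_of_nonneg (f.nonneg _ _)]
      by_cases hx : x ∈ tsupport φ
      · rw [hsum x hx, one_mul]
      · rw [image_eq_zero_of_notMem_tsupport hx, abs_zero, mul_zero]
    simp_rw [s2]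
    rw [integral_finsetSum _ fun i _ =>
      ((bv_integrableOn D hfin (c1 i).continuous (c2 i) w).1).abs]
    have s3 : bvErr C D w φ = ∑ i, bvErr C D w (ψ i) := by
      rw [← bvErr_sum C D hfin Finset.univ c1 c2 w, ← s1]
    rw [s3, Finset.mul_sum]
    refine (Finset.abs_sum_le_sum_abs _ _).trans (Finset.sum_le_sum fun i _ => ?_)
    exact h i _ (c1 i) (c2 i) (c3 i)
  have hI0 : 0 ≤ ∫ x in frontier D.carrier, |φ x| ∂(μH[(m : ℝ)] : Measure _) :=
    integral_nonneg fun x => abs_nonneg _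
  set I := ∫ x in frontier D.carrier, |φ x| ∂(μH[(m : ℝ)] : Measure _)
  have : |bvErr C D w φ| ≤ 0 := by
    refine le_of_forall_pos_le_add fun δ hδ => ?_
    refine (main (δ / (I + 1)) (by positivity)).trans ?_
    rw [zero_add, div_mul_eq_mul_div, div_le_iff₀ (by positivity)]
    nlinarith
  exact abs_nonpos_iff.1 this

lemma bv_emp {m : ℕ} (D : RegularDomain (m+1))
    {g : EuclideanSpace ℝ (Fin (m+1)) × EuclideanSpace ℝ (Fin (m+1)) → ℝ} (hg : Continuous g) :
    ∫ p, g p ∂(empiricalMeasure D) = ((μH[(m : ℝ)] (frontier D.carrier))⁻¹).toReal *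
      ∫ x in frontier D.carrier, g (x, D.normal x) ∂(μH[(m : ℝ)] : Measure _) := by
  have hm : (((m + 1 : ℕ) : ℝ) - 1) = (m : ℝ) := by push_cast; ring
  unfold empiricalMeasure
  rw [hm, integral_smul_measure, integral_map _ hg.aestronglyMeasurable, smul_eq_mul]
  exact aemeasurable_id.prodMk
    ((bv_normal D).1.aemeasurable isClosed_frontier.measurableSet)

/-- **Limits of hypersurfaces.**  Let `Dᵢ` be compact regular domains in `ℝ^d` whose boundary
areas tend to infinity, and suppose the empirical measures `μᵢ` of `∂Dᵢ` converge weakly to a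
probability measure `μ₀`.  If `μ₀(dx,dn) = p₀(dx) μ₀^x(dn)` is the disintegration of `μ₀`
with respect to its first marginal `p₀` (given by the conditional kernel `μ₀.condKernel`),
then for `p₀`-almost every `x` the barycenter `∫ n μ₀^x(dn)` vanishes. -/
theorem barycenter_vanishes (d : ℕ) (Dseq : ℕ → RegularDomain d)
    (hcpt : ∀ i, IsCompact (Dseq i).carrier)
    (hpos : ∀ i, μH[(d : ℝ) - 1] (frontier (Dseq i).carrier) ≠ 0)
    (hfin : ∀ i, μH[(d : ℝ) - 1] (frontier (Dseq i).carrier) ≠ ⊤)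
    (harea : Filter.Tendsto (fun i => μH[(d : ℝ) - 1] (frontier (Dseq i).carrier))
      Filter.atTop (nhds ⊤))
    (μ₀ : Measure (EuclideanSpace ℝ (Fin d) × EuclideanSpace ℝ (Fin d)))
    [IsProbabilityMeasure μ₀]
    (hweak : ∀ g : BoundedContinuousFunction
        (EuclideanSpace ℝ (Fin d) × EuclideanSpace ℝ (Fin d)) ℝ,
      Filter.Tendsto (fun i => ∫ p, g p ∂(empiricalMeasure (Dseq i))) Filter.atTop
        (nhds (∫ p, g p ∂μ₀))) :
    ∀ᵐ x ∂μ₀.fst, (∫ n, n ∂(μ₀.condKernel x)) = 0 := by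
  rcases d with _ | m
  · exact ae_of_all _ fun x => Subsingleton.elim _ _
  have hm : (((m + 1 : ℕ) : ℝ) - 1) = (m : ℝ) := by push_cast; ring
  obtain ⟨C, hC⟩ := bv_coords m
  have hemp : ∀ (i : ℕ) (g : EuclideanSpace ℝ (Fin (m+1)) × EuclideanSpace ℝ (Fin (m+1)) → ℝ),
      Continuous g → ∫ p, g p ∂(empiricalMeasure (Dseq i)) =
        ((μH[(m : ℝ)] (frontier (Dseq i).carrier))⁻¹).toReal *
          ∫ x in frontier (Dseq i).carrier, g (x, (Dseq i).normal x)
            ∂(μH[(m : ℝ)] : Measure _) := fun i g hg => bv_emp (Dseq i) hg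
  simp only [hm] at hpos hfin harea
  have hinv : Tendsto (fun i => ((μH[(m : ℝ)] (frontier (Dseq i).carrier))⁻¹).toReal) atTop
      (𝓝 0) := by
    have h1 := harea.inv
    rw [ENNReal.inv_top] at h1
    exact (ENNReal.tendsto_toReal ENNReal.zero_ne_top).comp h1
  have hnorm : ∀ᵐ p ∂μ₀, ‖p.2‖ = 1 := by
    let g : BoundedContinuousFunction
        (EuclideanSpace ℝ (Fin (m+1)) × EuclideanSpace ℝ (Fin (m+1))) ℝ :=
      BoundedContinuousFunction.ofNormedAddCommGroup (fun p => min |‖p.2‖ - 1| 1)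
        (by fun_prop) 1 (fun p => by
          rw [Real.norm_eq_abs, abs_of_nonneg (le_min (abs_nonneg _) zero_le_one)]
          exact min_le_right _ _)
    have hg : ∀ p, g p = min |‖p.2‖ - 1| 1 := fun _ => rfl
    have h1 : ∀ i, ∫ p, g p ∂(empiricalMeasure (Dseq i)) = 0 := by
      intro i
      rw [hemp i g g.continuous, setIntegral_eq_zero_of_forall_eq_zero, mul_zero]
      intro x hx
      rw [hg, (bv_normal (Dseq i)).2 x hx]
      simp
    have h2 : ∫ p, g p ∂μ₀ = 0 := by
      refine tendsto_nhds_unique (hweak g) ?_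
      simp_rw [h1]
      exact tendsto_const_nhds
    rw [integral_eq_zero_iff_of_nonneg (f := fun p => g p) (fun p => le_min (abs_nonneg _) zero_le_one)
      (g.integrable μ₀)] at h2
    filter_upwards [h2] with p hp
    change g p = 0 at hp
    rw [hg] at hp
    rcases min_choice |‖p.2‖ - 1| (1:ℝ) with h | h
    · rw [h, abs_eq_zero] at hp; linarith
    · rw [h] at hp; norm_num at hp
  have hintg : Integrable (fun p : EuclideanSpace ℝ (Fin (m+1)) × EuclideanSpace ℝ (Fin (m+1)) =>
      p.2) μ₀ :=
    Integrable.of_bound continuous_snd.aestronglyMeasurable 1 (hnorm.mono fun p hp => hp.le)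
  refine ae_eq_zero_of_integral_contDiff_smul_eq_zero
    (hintg.integral_condKernel.locallyIntegrable) fun φ hφ hφc => ?_
  have hφ1 : ContDiff ℝ 1 φ := hφ.of_le (by exact_mod_cast le_top)
  obtain ⟨B, hB⟩ := hφ.continuous.bounded_above_of_compact_support hφc
  have hint2 : Integrable (fun p : EuclideanSpace ℝ (Fin (m+1)) × EuclideanSpace ℝ (Fin (m+1)) =>
      φ p.1 • p.2) μ₀ :=
    hintg.bdd_smul B (hφ.continuous.comp continuous_fst).aestronglyMeasurable
      (ae_of_all _ fun p => hB p.1)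
  have e1 : ∫ x, φ x • ∫ n, n ∂(μ₀.condKernel x) ∂μ₀.fst = ∫ p, φ p.1 • p.2 ∂μ₀ := by
    rw [← Measure.integral_condKernel hint2]
    congr 1 with x : 1
    exact (integral_smul (φ x) (fun n => n)).symm
  rw [e1]
  refine ext_inner_left ℝ fun w => ?_
  rw [inner_zero_right, ← integral_inner hint2]
  let g : BoundedContinuousFunction
      (EuclideanSpace ℝ (Fin (m+1)) × EuclideanSpace ℝ (Fin (m+1))) ℝ :=
    BoundedContinuousFunction.ofNormedAddCommGroup
      (fun p => φ p.1 * max (-‖w‖) (min ⟪p.2, w⟫ ‖w‖))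
      ((hφ.continuous.comp continuous_fst).mul (by fun_prop)) (B * ‖w‖) (fun p => by
        rw [norm_mul]
        have h0 := norm_nonneg w
        have h2 : ‖max (-‖w‖) (min ⟪p.2, w⟫ ‖w‖)‖ ≤ ‖w‖ := by
          rw [Real.norm_eq_abs, abs_le]
          exact ⟨le_max_left _ _, max_le (by linarith) (min_le_right _ _)⟩
        exact mul_le_mul (hB _) h2 (norm_nonneg _) ((norm_nonneg _).trans (hB p.1)))
  have hg : ∀ p : EuclideanSpace ℝ (Fin (m+1)) × EuclideanSpace ℝ (Fin (m+1)), ‖p.2‖ = 1 →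
      g p = φ p.1 * ⟪p.2, w⟫ := by
    intro p hp
    have := abs_le.1 (abs_real_inner_le_norm p.2 w)
    rw [hp, one_mul] at this
    change φ p.1 * max (-‖w‖) (min ⟪p.2, w⟫ ‖w‖) = _
    rw [min_eq_left this.2, max_eq_right this.1]
  have e2 : ∫ p, ⟪w, φ p.1 • p.2⟫ ∂μ₀ = ∫ p, g p ∂μ₀ := by
    refine integral_congr_ae (hnorm.mono fun p hp => ?_)
    change ⟪w, φ p.1 • p.2⟫ = g p
    rw [hg p hp, inner_smul_right, real_inner_comm]
  rw [e2]
  refine tendsto_nhds_unique (hweak g) ?_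
  set J := ∫ x, ‖fderiv ℝ φ x w‖ with hJ
  have e3 : ∀ i, ‖∫ p, g p ∂(empiricalMeasure (Dseq i))‖ ≤
      ((μH[(m : ℝ)] (frontier (Dseq i).carrier))⁻¹).toReal * (C * J) := by
    intro i
    have h3 : ∫ x in frontier (Dseq i).carrier, g (x, (Dseq i).normal x)
        ∂(μH[(m : ℝ)] : Measure _) = C * ∫ x in (Dseq i).carrier, fderiv ℝ φ x w := by
      rw [← sub_eq_zero, ← bv_divergence hC (Dseq i) (hfin i) w hφ hφc, bvErr]
      congr 1
      refine setIntegral_congr_fun isClosed_frontier.measurableSet fun x hx => ?_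
      exact hg _ ((bv_normal (Dseq i)).2 x hx)
    rw [hemp i g g.continuous, h3, norm_mul, norm_mul, Real.norm_of_nonneg ENNReal.toReal_nonneg,
      Real.norm_of_nonneg C.coe_nonneg]
    gcongr
    refine (norm_integral_le_integral_norm _).trans ?_
    exact setIntegral_le_integral (bv_fderiv_integrable hφ1 hφc w).norm
      (ae_of_all _ fun x => norm_nonneg _)
  refine squeeze_zero_norm e3 ?_
  simpa using hinv.mul_const ((C : ℝ) * J)

end
end
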